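/- For every ε > 0 and K > 0 there exists d₀ such that for all d ≥ d₀: every properly edge-coloured graph G with minimum degree at least d and maximum degree at most Kd contains a rainbow path of length at least (1−ε)d. -/

import Mathlib

/-- A proper edge-colouring of an undirected graph: the colour function is symmetric on
edges, and no two edges sharing a vertex have the same colour. -/
def IsProperEdgeColoring {V C : Type*} (G : SimpleGraph V) (c : V → V → C) : Prop :=
  (∀ u v, G.Adj u v → c u v = c v u) ∧
  (∀ u v w, G.Adj u v → G.Adj u w → v ≠ w → c u v ≠ c u w)

/-- A rainbow path of length `ℓ`. -/
def IsRainbowPath {V C : Type*} (G : SimpleGraph V) (c : V → V → C) {ℓ : ℕ}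
    (p : Fin (ℓ + 1) → V) : Prop :=
  Function.Injective p ∧ (∀ i : Fin ℓ, G.Adj (p i.castSucc) (p i.succ)) ∧
    Function.Injective fun i : Fin ℓ => c (p i.castSucc) (p i.succ)

section helpers
open Classical
set_option linter.all false

/-- A rainbow path from `u` to `v` along the relation `A` with vertex set `S`, colour set `T`. -/
inductive RP {V C : Type} (A : V → V → Prop) (c : V → V → C) :
    V → V → Finset V → Finset C → Prop
  | nil (u : V) : RP A c u u {u} ∅
  | snoc {u v w : V} {S : Finset V} {T : Finset C} (h : RP A c u v S T) (hA : A v w)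
      (hw : w ∉ S) (hc : c v w ∉ T) : RP A c u w (insert w S) (insert (c v w) T)

namespace RP
variable {V C : Type} {A B : V → V → Prop} {c : V → V → C} {u v w : V} {S S' : Finset V}
  {T T' : Finset C}

theorem start_mem (h : RP A c u v S T) : u ∈ S := by
  induction h with
  | nil => simp
  | snoc h hA hw hc ih => simp [ih]

theorem end_mem (h : RP A c u v S T) : v ∈ S := by
  cases h <;> simp

theorem card (h : RP A c u v S T) : S.card = T.card + 1 := by
  induction h with
  | nil => simp
  | snoc h hA hw hc ih =>
    rw [Finset.card_insert_of_notMem hw, Finset.card_insert_of_notMem hc, ih]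

theorem mono (hAB : ∀ x y, x ∈ S → y ∈ S → A x y → B x y) (h : RP A c u v S T) : RP B c u v S T := by
  induction h with
  | nil => exact RP.nil _
  | snoc h hA hw hc ih =>
    refine RP.snoc (ih fun x y hx hy hxy => hAB x y (by simp [hx]) (by simp [hy]) hxy) ?_ hw hc
    exact hAB _ _ (by simp [h.end_mem]) (by simp) hA

theorem append (h : RP A c u v S T) (h' : RP A c v w S' T')
    (hS : ∀ x ∈ S', x ∈ S → x = v) (hT : Disjoint T T') : RP A c u w (S ∪ S') (T ∪ T') := by
  induction h' with
  | nil =>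
    have : S ∪ {v} = S := by simpa using h.end_mem
    simpa [this] using h
  | @snoc x y S' T' h' hA hw hc ih =>
    have ih := ih (fun x hx hx' => hS x (by simp [hx]) hx')
      (Finset.disjoint_of_subset_right (Finset.subset_insert _ _) hT)
    have h1 : y ∉ S ∪ S' := by
      intro hy
      rcases Finset.mem_union.1 hy with hy | hy
      · have := hS y (by simp) hy
        subst this
        exact hw h'.start_mem
      · exact hw hy
    have h2 : c x y ∉ T ∪ T' := by
      intro hy
      rcases Finset.mem_union.1 hy with hy | hy
      · exact (Finset.disjoint_left.1 hT hy) (by simp)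
      · exact hc hy
    have := RP.snoc ih hA h1 h2
    rwa [← Finset.union_insert, ← Finset.union_insert] at this

theorem pre (h : RP A c u v S T) {x : V} (hx : x ∈ S) :
    ∃ S' T', S' ⊆ S ∧ T' ⊆ T ∧ RP A c u x S' T' ∧ (x ≠ v → T'.card < T.card) := by
  induction h with
  | nil =>
    have : x = u := by simpa using hx
    subst this
    exact ⟨{x}, ∅, by simp, by simp, RP.nil _, by simp⟩
  | @snoc v w S T h hA hw hc ih =>
    rcases Finset.mem_insert.1 hx with rfl | hx
    · exact ⟨_, _, subset_rfl, subset_rfl, RP.snoc h hA hw hc, by simp⟩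
    · obtain ⟨S', T', h1, h2, h3, h4⟩ := ih hx
      refine ⟨S', T', h1.trans (Finset.subset_insert _ _), h2.trans (Finset.subset_insert _ _),
        h3, fun _ => ?_⟩
      rw [Finset.card_insert_of_notMem hc]
      exact Nat.lt_succ_of_le (Finset.card_le_card h2)

theorem vert (h : RP A c u v S T) {x : V} (hx : x ∈ S) : x = u ∨ ∃ y ∈ S, A y x := by
  induction h with
  | nil => left; simpa using hx
  | @snoc v w S T h hA hw hc ih =>
    rcases Finset.mem_insert.1 hx with rfl | hx
    · exact Or.inr ⟨v, by simp [h.end_mem], hA⟩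
    · rcases ih hx with h | ⟨y, hy, h⟩
      · exact Or.inl h
      · exact Or.inr ⟨y, by simp [hy], h⟩

theorem col (h : RP A c u v S T) {t : C} (ht : t ∈ T) : ∃ x ∈ S, ∃ y ∈ S, A x y ∧ c x y = t := by
  induction h with
  | nil => simp at ht
  | @snoc v w S T h hA hw hc ih =>
    rcases Finset.mem_insert.1 ht with rfl | ht
    · exact ⟨v, by simp [h.end_mem], w, by simp, hA, rfl⟩
    · obtain ⟨x, hx, y, hy, h⟩ := ih ht
      exact ⟨x, by simp [hx], y, by simp [hy], h⟩

theorem fn (h : RP A c u v S T) : ∃ p : ℕ → V, p 0 = u ∧ p T.card = v ∧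
    S = (Finset.range (T.card + 1)).image p ∧
    T = (Finset.range T.card).image (fun i => c (p i) (p (i+1))) ∧
    (∀ i < T.card, A (p i) (p (i+1))) := by
  induction h with
  | nil => exact ⟨fun _ => u, rfl, rfl, by simp, by simp, by simp⟩
  | @snoc v w S T h hA hw hc ih =>
    obtain ⟨p, h0, h1, h2, h3, h4⟩ := ih
    have hcard : (insert (c v w) T).card = T.card + 1 := Finset.card_insert_of_notMem hc
    rw [hcard]
    have e : ∀ i ≤ T.card, (fun i => if i ≤ T.card then p i else w) i = p i := by
      intro i hi; simp [hi]
    refine ⟨fun i => if i ≤ T.card then p i else w, by simp [h0], by simp, ?_, ?_, ?_⟩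
    · rw [Finset.range_add_one, Finset.image_insert]
      congr 1
      · simp
      · conv_lhs => rw [h2]
        apply Finset.image_congr
        intro i hi
        have : i ≤ T.card := by simpa [Nat.lt_succ_iff] using hi
        simp [this]
    · rw [Finset.range_add_one, Finset.image_insert]
      congr 1
      · simp [h1]
      · conv_lhs => rw [h3]
        apply Finset.image_congr
        intro i hi
        have : i < T.card := by simpa using hi
        have h' : i + 1 ≤ T.card := this
        simp [this.le, h']
    · intro i hi
      rcases Nat.lt_succ_iff_lt_or_eq.1 hi with hi | rfl
      · have h' : i + 1 ≤ T.card := hi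
        simpa [hi.le, h'] using h4 i hi
      · simpa [h1] using hA

theorem injp {p : ℕ → V} {n : ℕ} (h : (Finset.image p (Finset.range n)).card = n) :
    ∀ i < n, ∀ j < n, p i = p j → i = j := by
  have : Set.InjOn p (Finset.range n) := by
    apply Finset.card_image_iff.1
    simpa using h
  intro i hi j hj hij
  exact this (by simpa using hi) (by simpa using hj) hij

theorem map_val {X : Type} (f : X → V) (hf : Function.Injective f)
    {A : X → X → Prop} {B : V → V → Prop} {c' : X → X → C}
    (hAB : ∀ x y : X, A x y → B (f x) (f y)) (hc : ∀ x y : X, c' x y = c (f x) (f y))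
    {u v : X} {S : Finset X} {T : Finset C} (h : RP A c' u v S T) :
    RP B c (f u) (f v) (S.image f) T := by
  induction h with
  | nil => simpa using RP.nil _
  | snoc h hA hw hcc ih =>
    rw [Finset.image_insert, hc]
    refine RP.snoc ih (hAB _ _ hA) ?_ (by rwa [← hc])
    intro h
    obtain ⟨a, ha, e⟩ := Finset.mem_image.1 h
    exact hw (hf e ▸ ha)

/-- segments of a function path -/
theorem ofFn {p : ℕ → V} {n : ℕ} (hp : ∀ i ≤ n, ∀ j ≤ n, p i = p j → i = j)
    (hcol : ∀ i < n, ∀ j < n, c (p i) (p (i+1)) = c (p j) (p (j+1)) → i = j)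
    (hA : ∀ i < n, A (p i) (p (i+1))) (a k : ℕ) (hak : a + k ≤ n) :
    RP A c (p a) (p (a + k)) ((Finset.Icc a (a+k)).image p)
      ((Finset.Ico a (a+k)).image (fun i => c (p i) (p (i+1)))) := by
  induction k with
  | zero => simpa using RP.nil _
  | succ k ih =>
    have ih := ih (by omega)
    have e1 : Finset.Icc a (a + (k+1)) = insert (a+k+1) (Finset.Icc a (a+k)) := by
      ext x; simp; omega
    have e2 : Finset.Ico a (a + (k+1)) = insert (a+k) (Finset.Ico a (a+k)) := by
      ext x; simp; omega
    rw [e1, e2, Finset.image_insert, Finset.image_insert]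
    refine RP.snoc ih (hA _ (by omega)) ?_ ?_
    · simp only [Finset.mem_image, Finset.mem_Icc, not_exists, not_and]
      intro i hi h
      have := hp i (by omega) (a+k+1) (by omega) h
      omega
    · simp only [Finset.mem_image, Finset.mem_Ico, not_exists, not_and]
      intro i hi h
      have := hcol i (by omega) (a+k) (by omega) h
      omega

end RP

/-- directed path systems -/
structure PS {V C : Type} (adj : V → V → Prop) (c : V → V → C) (A S : Finset V)
    (E : Finset (V × V)) : Prop where
  sub : S ⊆ A
  edge : ∀ u v, (u, v) ∈ E → u ∈ S ∧ v ∈ S ∧ adj u v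
  outU : ∀ u v w, (u, v) ∈ E → (u, w) ∈ E → v = w
  inU : ∀ u v w, (v, u) ∈ E → (w, u) ∈ E → v = w
  rank : ∃ f : V → ℕ, ∀ u v, (u, v) ∈ E → f u < f v
  rain : ∀ u v u' v', (u, v) ∈ E → (u', v') ∈ E → c u v = c u' v' → u = u' ∧ v = v'

namespace PS
variable {V C : Type} {adj : V → V → Prop} {c : V → V → C} {A S : Finset V}
  {E : Finset (V × V)}

theorem gain {M : Finset (V × V)} (h : PS adj c A S M) {v w : V} (hv : v ∈ S) (hw : w ∉ S)
    (hwA : w ∈ A) (ha : adj v w) (hout : ∀ x, (v, x) ∉ M)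
    (hg : ∀ x y, (x, y) ∈ M → c x y ≠ c v w) :
    PS adj c A (insert w S) (insert (v, w) M) := by
  obtain ⟨f, hf⟩ := h.rank
  have hM : ∀ x y, (x, y) ∈ M → x ≠ w ∧ y ≠ w := by
    intro x y hxy
    obtain ⟨h1, h2, -⟩ := h.edge x y hxy
    exact ⟨fun e => hw (e ▸ h1), fun e => hw (e ▸ h2)⟩
  have hvw : v ≠ w := fun e => hw (e ▸ hv)
  refine ⟨Finset.insert_subset hwA h.sub, ?_, ?_, ?_, ?_, ?_⟩
  · intro a b hab
    rcases Finset.mem_insert.1 hab with hab | hab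
    · obtain ⟨rfl, rfl⟩ := Prod.mk.inj hab
      exact ⟨by simp [hv], by simp, ha⟩
    · obtain ⟨h1, h2, h3⟩ := h.edge a b hab
      exact ⟨by simp [h1], by simp [h2], h3⟩
  · intro a b b' h1 h2
    simp only [Finset.mem_insert, Prod.mk.injEq] at h1 h2
    rcases h1 with ⟨rfl, rfl⟩ | h1 <;> rcases h2 with ⟨h2, rfl⟩ | h2
    · rfl
    · exact absurd h2 (hout _)
    · subst h2; exact absurd h1 (hout _)
    · exact h.outU _ _ _ h1 h2
  · intro a b b' h1 h2
    simp only [Finset.mem_insert, Prod.mk.injEq] at h1 h2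
    rcases h1 with ⟨rfl, rfl⟩ | h1 <;> rcases h2 with ⟨h2, h3⟩ | h2
    · exact h2.symm
    · exact absurd rfl (hM _ _ h2).2
    · subst h3; exact absurd rfl (hM _ _ h1).2
    · exact h.inU _ _ _ h1 h2
  · refine ⟨fun x => if x = w then f v + 1 else f x, ?_⟩
    intro a b hab
    simp only [Finset.mem_insert, Prod.mk.injEq] at hab
    rcases hab with ⟨rfl, rfl⟩ | hab
    · simp [hvw]
    · have := hM _ _ hab
      simp [this.1, this.2, hf _ _ hab]
  · intro a b a' b' h1 h2 he
    simp only [Finset.mem_insert, Prod.mk.injEq] at h1 h2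
    rcases h1 with ⟨rfl, rfl⟩ | h1 <;> rcases h2 with ⟨rfl, rfl⟩ | h2
    · exact ⟨rfl, rfl⟩
    · exact absurd he.symm (hg _ _ h2)
    · exact absurd he (hg _ _ h1)
    · exact h.rain _ _ _ _ h1 h2 he

theorem switch {M : Finset (V × V)} (h : PS adj c A S M) {v y z : V} (hv : v ∈ S)
    (hyz : (y, z) ∈ M) (ha : adj v z) (hout : ∀ x, (v, x) ∉ M)
    (hg : ∀ x y, (x, y) ∈ M → c x y ≠ c v z) (P : Finset V) (hvP : v ∈ P) (hz : z ∉ P)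
    (hP : ∀ a b, (a, b) ∈ M → b ∈ P → a ∈ P) :
    PS adj c A S (insert (v, z) (M.erase (y, z))) := by
  obtain ⟨f, hf⟩ := h.rank
  refine ⟨h.sub, ?_, ?_, ?_, ?_, ?_⟩
  · intro a b hab
    simp only [Finset.mem_insert, Prod.mk.injEq, Finset.mem_erase] at hab
    rcases hab with ⟨rfl, rfl⟩ | ⟨-, hab⟩
    · exact ⟨hv, (h.edge _ _ hyz).2.1, ha⟩
    · exact h.edge a b hab
  · intro a b b' h1 h2
    simp only [Finset.mem_insert, Prod.mk.injEq, Finset.mem_erase] at h1 h2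
    rcases h1 with ⟨rfl, rfl⟩ | ⟨-, h1⟩ <;> rcases h2 with ⟨h2, rfl⟩ | ⟨-, h2⟩
    · rfl
    · exact absurd h2 (hout _)
    · subst h2; exact absurd h1 (hout _)
    · exact h.outU _ _ _ h1 h2
  · intro a b b' h1 h2
    simp only [Finset.mem_insert, Prod.mk.injEq, Finset.mem_erase] at h1 h2
    rcases h1 with ⟨rfl, rfl⟩ | ⟨h1', h1⟩ <;> rcases h2 with ⟨h2, h3⟩ | ⟨h2', h2⟩
    · exact h2.symm
    · exact absurd (by rw [h.inU _ _ _ h2 hyz]) h2'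
    · subst h3; exact absurd (by rw [h.inU _ _ _ h1 hyz]) h1'
    · exact h.inU _ _ _ h1 h2
  · refine ⟨fun x => if x ∈ P then f x else f x + (f v + 1), ?_⟩
    intro a b hab
    simp only [Finset.mem_insert, Prod.mk.injEq, Finset.mem_erase] at hab
    rcases hab with ⟨rfl, rfl⟩ | ⟨-, hab⟩
    · simp [hvP, hz]; omega
    · have := hf _ _ hab
      have h2 := hP _ _ hab
      by_cases hb : b ∈ P
      · simp [hb, h2 hb, this]
      · simp only [hb, if_false]
        split_ifs <;> omega
  · intro a b a' b' h1 h2 he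
    simp only [Finset.mem_insert, Prod.mk.injEq, Finset.mem_erase] at h1 h2
    rcases h1 with ⟨rfl, rfl⟩ | ⟨-, h1⟩ <;> rcases h2 with ⟨rfl, rfl⟩ | ⟨-, h2⟩
    · exact ⟨rfl, rfl⟩
    · exact absurd he.symm (hg _ _ h2)
    · exact absurd he (hg _ _ h1)
    · exact h.rain _ _ _ _ h1 h2 he

/-- colours of E -/
noncomputable def cE (c : V → V → C) (E : Finset (V × V)) : Finset C := E.image fun e => c e.1 e.2

theorem mem_cE {x : C} : x ∈ cE c E ↔ ∃ u v, (u, v) ∈ E ∧ c u v = x := by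
  simp [cE]

def Good (adj : V → V → Prop) (c : V → V → C) (A S : Finset V) (E : Finset (V × V))
    (P : V → Finset V) (F : Finset C) (J : Finset V) : Prop :=
  ∀ f ∈ F, ∃ M, PS adj c A S M ∧ M.card = E.card ∧ f ∉ cE c M ∧
    (∀ v ∈ J, (∀ x, (v, x) ∉ M) ∧ ∀ a b, (a, b) ∈ M → b ∈ P v → a ∈ P v) ∧
    ∀ u v, (u, v) ∈ E → (u, v) ∉ M → c u v ∈ F

theorem step (hE : PS adj c A S E) {m D : ℕ} (hm : S.card = E.card + m)
    (hmax : ∀ S' E', PS adj c A S' E' → S'.card = E'.card + m → E'.card ≤ E.card)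
    (hdeg : ∀ v ∈ A, D ≤ (A.filter (adj v)).card)
    (hinj : ∀ v w w', adj v w → adj v w' → c v w = c v w' → w = w')
    {P : V → Finset V} {B : Finset V} {F : Finset C} {v : V} {J : Finset V}
    (hG : Good adj c A S E P F (insert v J)) (hvJ : v ∉ J)
    (hF : ∀ x, x ∉ cE c E → x ∈ F) (hPB : ∀ x ∈ insert v J, P x ⊆ B ∧ x ∈ P x) (hvS : v ∈ S) :
    ∃ F', F ⊆ F' ∧ Good adj c A S E P F' J ∧
      (F ∩ cE c E).card + D ≤ (F' ∩ cE c E).card + E.card + B.card + m := by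
  let N := A.filter (adj v)
  let E1 := E.filter fun e => e.2 ∉ B ∧ adj v e.2 ∧ c v e.2 ∈ F
  let F' := F ∪ cE c E1
  have hF' : F ⊆ F' := Finset.subset_union_left
  have hcE1 : cE c E1 ⊆ cE c E := Finset.image_subset_image (Finset.filter_subset _ _)
  refine ⟨F', hF', ?_, ?_⟩
  · have hG' : ∀ f ∈ F, ∃ M, PS adj c A S M ∧ M.card = E.card ∧ f ∉ cE c M ∧
        (∀ v ∈ J, (∀ x, (v, x) ∉ M) ∧ ∀ a b, (a, b) ∈ M → b ∈ P v → a ∈ P v) ∧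
        ∀ u v, (u, v) ∈ E → (u, v) ∉ M → c u v ∈ F' := by
      intro f hf
      obtain ⟨M, h1, h2, h3, h4, h5⟩ := hG f hf
      exact ⟨M, h1, h2, h3, fun v hv => h4 v (by simp [hv]), fun a b ha hb => hF' (h5 a b ha hb)⟩
    intro f hf
    by_cases hfF : f ∈ F
    · exact hG' f hfF
    have hf1 : f ∈ cE c E1 := (Finset.mem_union.1 hf).resolve_left hfF
    obtain ⟨y, z, hyz, rfl⟩ := mem_cE.1 hf1
    obtain ⟨hyz, hzB, hadj, hgF⟩ := Finset.mem_filter.1 hyz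
    simp only at hzB hadj hgF
    obtain ⟨M, h1, h2, h3, h4, h5⟩ := hG _ hgF
    by_cases hyzM : (y, z) ∈ M
    swap
    · exact absurd (h5 _ _ hyz hyzM) hfF
    have hg : ∀ x y, (x, y) ∈ M → c x y ≠ c v z := fun a b hab e =>
      h3 (mem_cE.2 ⟨a, b, hab, e⟩)
    obtain ⟨h4a, h4b⟩ := h4 v (by simp)
    refine ⟨_, h1.switch hvS hyzM hadj h4a hg (P v) (hPB v (by simp)).2
      (fun h => hzB ((hPB v (by simp)).1 h)) h4b, ?_, ?_, ?_, ?_⟩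
    · rw [Finset.card_insert_of_notMem, Finset.card_erase_of_mem hyzM, ← h2]
      · have := Finset.card_pos.2 ⟨_, hyzM⟩
        omega
      · intro h; exact h4a _ (Finset.mem_of_mem_erase h)
    · intro h
      obtain ⟨a, b, hab, e⟩ := mem_cE.1 h
      simp only [Finset.mem_insert, Prod.mk.injEq, Finset.mem_erase] at hab
      rcases hab with ⟨rfl, rfl⟩ | ⟨hne, hab⟩
      · exact hg _ _ hyzM e.symm
      · obtain ⟨rfl, rfl⟩ := h1.rain _ _ _ _ hab hyzM e; exact hne rfl
    · intro w hw
      obtain ⟨h4c, h4d⟩ := h4 w (by simp [hw])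
      have hwv : w ≠ v := fun e => hvJ (e ▸ hw)
      refine ⟨?_, ?_⟩
      · intro x hx
        simp only [Finset.mem_insert, Prod.mk.injEq, Finset.mem_erase] at hx
        rcases hx with ⟨h, -⟩ | ⟨-, h⟩
        · exact hwv h
        · exact h4c _ h
      · intro a b hab hb
        simp only [Finset.mem_insert, Prod.mk.injEq, Finset.mem_erase] at hab
        rcases hab with ⟨rfl, rfl⟩ | ⟨-, h⟩
        · exact absurd ((hPB w (by simp [hw])).1 hb) hzB
        · exact h4d _ _ h hb
    · intro a b hab hab'
      by_cases h : (a, b) ∈ M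
      · have : (a, b) = (y, z) := by
          by_contra hne
          exact hab' (by simp only [Finset.mem_insert, Finset.mem_erase]; exact Or.inr ⟨hne, h⟩)
        obtain ⟨rfl, rfl⟩ := Prod.mk.inj this
        exact hf
      · exact hF' (h5 _ _ hab h)
  · -- counting
    have hN : D ≤ N.card := hdeg v (hE.sub hvS)
    let N1 := N.filter fun w => c v w ∈ F
    have hN1 : N1 ⊆ S := by
      intro w hw
      obtain ⟨hw, hwF⟩ := Finset.mem_filter.1 hw
      obtain ⟨hwA, hadj⟩ := Finset.mem_filter.1 hw
      by_contra hwS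
      obtain ⟨M, h1, h2, h3, h4, h5⟩ := hG _ hwF
      obtain ⟨h4a, h4b⟩ := h4 v (by simp)
      have := hmax _ _ (h1.gain hvS hwS hwA hadj h4a
        fun a b hab e => h3 (mem_cE.2 ⟨a, b, hab, e⟩)) (by
          rw [Finset.card_insert_of_notMem hwS, Finset.card_insert_of_notMem (h4a _)]
          omega)
      rw [Finset.card_insert_of_notMem (h4a _)] at this
      omega
    -- N \ N1 colours
    have h1 : (N.filter fun w => ¬ c v w ∈ F).card ≤ (cE c E \ F).card := by
      apply Finset.card_le_card_of_injOn (fun w => c v w)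
      · intro w hw
        simp only [Finset.coe_filter, Set.mem_ofPred_eq] at hw
        simp only [Finset.coe_sdiff, Set.mem_sdiff, Finset.mem_coe]
        exact ⟨by_contra fun h => hw.2 (hF _ h), hw.2⟩
      · intro w hw w' hw' e
        simp only [Finset.coe_filter, Set.mem_ofPred_eq, N, Finset.mem_filter] at hw hw'
        exact hinj _ _ _ hw.1.2 hw'.1.2 e
    have h2 : (cE c E \ F).card + (F ∩ cE c E).card = E.card := by
      have : (cE c E).card = E.card := by
        apply Finset.card_image_of_injOn
        rintro ⟨a, b⟩ hab ⟨a', b'⟩ hab' e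
        obtain ⟨rfl, rfl⟩ := hE.rain _ _ _ _ hab hab' e
        rfl
      rw [← this, Finset.inter_comm]
      exact Finset.card_sdiff_add_card_inter _ _
    have h3 : N1.card + (N.filter fun w => ¬ c v w ∈ F).card = N.card :=
      Finset.card_filter_add_card_filter_not _
    have h4 : (S \ E.image Prod.snd).card ≤ m := by
      have : (E.image Prod.snd).card = E.card := by
        apply Finset.card_image_of_injOn
        rintro ⟨a, b⟩ hab ⟨a', b'⟩ hab' e
        simp only at e
        subst e
        rw [hE.inU _ _ _ hab hab']
      have h' : E.image Prod.snd ⊆ S := by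
        intro x hx
        obtain ⟨⟨a, b⟩, hab, rfl⟩ := Finset.mem_image.1 hx
        exact (hE.edge _ _ hab).2.1
      rw [Finset.card_sdiff_of_subset h']
      omega
    have h5 : N1 ⊆ (B ∪ (S \ E.image Prod.snd)) ∪ E1.image Prod.snd := by
      intro w hw
      simp only [Finset.mem_union, Finset.mem_sdiff, Finset.mem_image, Prod.exists, not_exists]
      by_cases hB : w ∈ B
      · exact Or.inl (Or.inl hB)
      by_cases hs : ∃ y, (y, w) ∈ E
      · obtain ⟨y, hy⟩ := hs
        right
        refine ⟨y, w, ?_, rfl⟩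
        simp only [E1, Finset.mem_filter]
        simp only [N1, N, Finset.mem_filter] at hw
        exact ⟨hy, hB, hw.1.2, hw.2⟩
      · left; right
        refine ⟨hN1 hw, ?_⟩
        rintro a b ⟨hab, rfl⟩
        exact hs ⟨a, hab⟩
    have h6 : (E1.image Prod.snd).card ≤ (F' ∩ cE c E).card := by
      calc _ ≤ E1.card := Finset.card_image_le
        _ = (cE c E1).card := by
          symm
          apply Finset.card_image_of_injOn
          rintro ⟨a, b⟩ hab ⟨a', b'⟩ hab' e
          obtain ⟨rfl, rfl⟩ := hE.rain _ _ _ _ (Finset.mem_of_mem_filter _ hab)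
            (Finset.mem_of_mem_filter _ hab') e
          rfl
        _ ≤ _ := Finset.card_le_card (Finset.subset_inter Finset.subset_union_right hcE1)
    have h7 := Finset.card_le_card h5
    have h8 := Finset.card_union_le (B ∪ (S \ E.image Prod.snd)) (E1.image Prod.snd)
    have h9 := Finset.card_union_le B (S \ E.image Prod.snd)
    omega

theorem steps (hE : PS adj c A S E) {m D : ℕ} (hm : S.card = E.card + m)
    (hmax : ∀ S' E', PS adj c A S' E' → S'.card = E'.card + m → E'.card ≤ E.card)
    (hdeg : ∀ v ∈ A, D ≤ (A.filter (adj v)).card)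
    (hinj : ∀ v w w', adj v w → adj v w' → c v w = c v w' → w = w')
    {P : V → Finset V} {B : Finset V} (J : Finset V) : ∀ (F : Finset C)
    (hG : Good adj c A S E P F J)
    (hF : ∀ x, x ∉ cE c E → x ∈ F) (hPB : ∀ x ∈ J, P x ⊆ B ∧ x ∈ P x) (hvS : J ⊆ S),
    (F ∩ cE c E).card + J.card * D ≤ E.card + J.card * (E.card + B.card + m) := by
  induction J using Finset.induction_on with
  | empty =>
    intro F _ _ _ _
    have : (F ∩ cE c E).card ≤ (cE c E).card := Finset.card_le_card Finset.inter_subset_right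
    have h2 : (cE c E).card ≤ E.card := Finset.card_image_le
    simp; omega
  | insert v J hvJ ih =>
    intro F hG hF hPB hvS
    obtain ⟨F', h1, h2, h3⟩ := step hE hm hmax hdeg hinj hG hvJ hF hPB (hvS (by simp))
    have := ih F' h2 (fun x hx => h1 (hF x hx)) (fun x hx => hPB x (by simp [hx]))
      (fun x hx => hvS (by simp [hx]))
    rw [Finset.card_insert_of_notMem hvJ]
    nlinarith

end PS

namespace PS
variable {V C : Type} {adj : V → V → Prop} {c : V → V → C} {A S : Finset V}
  {E : Finset (V × V)}

def rel (E : Finset (V × V)) (a b : V) : Prop := (a, b) ∈ E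

noncomputable def Anc (S : Finset V) (E : Finset (V × V)) (t : V) : Finset V :=
  S.filter fun x => Relation.ReflTransGen (rel E) x t

noncomputable def Ends (S : Finset V) (E : Finset (V × V)) : Finset V :=
  S \ E.image Prod.fst

theorem ends_card (h : PS adj c A S E) {m : ℕ} (hm : S.card = E.card + m) :
    (Ends S E).card = m := by
  have : (E.image Prod.fst).card = E.card := by
    apply Finset.card_image_of_injOn
    rintro ⟨a, b⟩ hab ⟨a', b'⟩ hab' e
    simp only at e
    subst e
    rw [h.outU _ _ _ hab hab']
  have h' : E.image Prod.fst ⊆ S := by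
    intro x hx
    obtain ⟨⟨a, b⟩, hab, rfl⟩ := Finset.mem_image.1 hx
    exact (h.edge _ _ hab).1
  rw [Ends, Finset.card_sdiff_of_subset h']
  omega

theorem ends_out {t : V} (ht : t ∈ Ends S E) (x : V) : (t, x) ∉ E := by
  intro h
  exact (Finset.mem_sdiff.1 ht).2 (Finset.mem_image.2 ⟨_, h, rfl⟩)

theorem ends_sub : Ends S E ⊆ S := Finset.sdiff_subset

theorem anc_self {t : V} (ht : t ∈ S) : t ∈ Anc S E t :=
  Finset.mem_filter.2 ⟨ht, Relation.ReflTransGen.refl⟩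

theorem anc_pred (h : PS adj c A S E) {t a b : V} (hab : (a, b) ∈ E) (hb : b ∈ Anc S E t) :
    a ∈ Anc S E t :=
  Finset.mem_filter.2 ⟨(h.edge _ _ hab).1, (Finset.mem_filter.1 hb).2.head hab⟩

theorem end_refl {t y : V} (ht : t ∈ Ends S E) (h : Relation.ReflTransGen (rel E) t y) : y = t := by
  rcases Relation.ReflTransGen.cases_head h with h | ⟨z, h, -⟩
  · exact h.symm
  · exact absurd h (ends_out ht z)

theorem anc_disj (h : PS adj c A S E) {t t' : V} (ht : t ∈ Ends S E) (ht' : t' ∈ Ends S E)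
    (hne : t ≠ t') : Disjoint (Anc S E t) (Anc S E t') := by
  rw [Finset.disjoint_left]
  intro x hx hx'
  have h1 := (Finset.mem_filter.1 hx).2
  have h2 := (Finset.mem_filter.1 hx').2
  have U : Relator.RightUnique (rel E) := fun a b c hb hc => h.outU _ _ _ hb hc
  rcases Relation.ReflTransGen.total_of_right_unique U h1 h2 with h3 | h3
  · exact hne (end_refl ht h3).symm
  · exact hne (end_refl ht' h3)

theorem anc_cover (h : PS adj c A S E) {x : V} (hx : x ∈ S) : ∃ t ∈ Ends S E, x ∈ Anc S E t := by
  obtain ⟨f, hf⟩ := h.rank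
  obtain ⟨n, hn⟩ : ∃ n, n = S.sup f - f x := ⟨_, rfl⟩
  induction n using Nat.strong_induction_on generalizing x with
  | _ n ih =>
    by_cases he : x ∈ Ends S E
    · exact ⟨x, he, anc_self hx⟩
    · have : x ∈ E.image Prod.fst := by
        by_contra h; exact he (Finset.mem_sdiff.2 ⟨hx, h⟩)
      obtain ⟨⟨a, b⟩, hab, rfl⟩ := Finset.mem_image.1 this
      have hb := (h.edge _ _ hab).2.1
      have h1 := hf _ _ hab
      have h2 : f b ≤ S.sup f := Finset.le_sup hb
      obtain ⟨t, ht, hbt⟩ := ih (S.sup f - f b) (by simp only at hn; omega) hb rfl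
      exact ⟨t, ht, anc_pred h hab hbt⟩

theorem anc_rank {f : V → ℕ} (hf : ∀ u v, (u, v) ∈ E → f u < f v) {x y : V}
    (h : Relation.ReflTransGen (rel E) x y) : f x ≤ f y := by
  induction h with
  | refl => exact le_rfl
  | tail _ h ih => exact ih.trans (hf _ _ h).le

noncomputable def Col (c : V → V → C) (S : Finset V) (E : Finset (V × V)) (t : V) : Finset C :=
  cE c (E.filter fun e => e.2 ∈ Anc S E t)

theorem rp (h : PS adj c A S E) {x : V} (hx : x ∈ S) :
    ∃ s, RP adj c s x (Anc S E x) (Col c S E x) := by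
  obtain ⟨f, hf⟩ := h.rank
  obtain ⟨n, hn⟩ : ∃ n, n = f x := ⟨_, rfl⟩
  induction n using Nat.strong_induction_on generalizing x with
  | _ n ih =>
    by_cases he : ∃ y, (y, x) ∈ E
    · obtain ⟨y, hy⟩ := he
      have hyx := hf _ _ hy
      obtain ⟨s, hs⟩ := ih (f y) (by omega) (h.edge _ _ hy).1 rfl
      refine ⟨s, ?_⟩
      have e1 : Anc S E x = insert x (Anc S E y) := by
        ext z
        simp only [Anc, Finset.mem_filter, Finset.mem_insert]
        constructor
        · rintro ⟨hz, hzx⟩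
          rcases Relation.ReflTransGen.cases_tail hzx with e | ⟨w, hw, hwx⟩
          · exact Or.inl e.symm
          · rw [h.inU _ _ _ hwx hy] at hw
            exact Or.inr ⟨hz, hw⟩
        · rintro (rfl | ⟨hz, hzy⟩)
          · exact ⟨hx, Relation.ReflTransGen.refl⟩
          · exact ⟨hz, hzy.tail hy⟩
      have hxn : x ∉ Anc S E y := by
        intro hxy
        have := anc_rank hf (Finset.mem_filter.1 hxy).2
        omega
      have e2 : Col c S E x = insert (c y x) (Col c S E y) := by
        ext t
        simp only [Col, mem_cE, Finset.mem_insert, Finset.mem_filter, e1]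
        constructor
        · rintro ⟨a, b, ⟨hab, rfl | hb⟩, rfl⟩
          · rw [h.inU _ _ _ hab hy]; exact Or.inl rfl
          · exact Or.inr ⟨a, b, ⟨hab, hb⟩, rfl⟩
        · rintro (rfl | ⟨a, b, ⟨hab, hb⟩, rfl⟩)
          · exact ⟨y, x, ⟨hy, Or.inl rfl⟩, rfl⟩
          · exact ⟨a, b, ⟨hab, Or.inr hb⟩, rfl⟩
      rw [e1, e2]
      refine RP.snoc hs (h.edge _ _ hy).2.2 hxn ?_
      intro hc
      obtain ⟨a, b, hab, e⟩ := mem_cE.1 hc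
      obtain ⟨hab, hb⟩ := Finset.mem_filter.1 hab
      obtain ⟨rfl, rfl⟩ := h.rain _ _ _ _ hab hy e
      exact hxn hb
    · refine ⟨x, ?_⟩
      have e1 : Anc S E x = {x} := by
        ext z
        simp only [Anc, Finset.mem_filter, Finset.mem_singleton]
        constructor
        · rintro ⟨hz, hzx⟩
          rcases Relation.ReflTransGen.cases_tail hzx with e | ⟨w, hw, hwx⟩
          · exact e.symm
          · exact absurd ⟨w, hwx⟩ he
        · rintro rfl
          exact ⟨hx, Relation.ReflTransGen.refl⟩
      have e2 : Col c S E x = ∅ := by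
        ext t
        simp only [Col, mem_cE, Finset.mem_filter, e1, Finset.mem_singleton, Finset.notMem_empty,
          iff_false]
        rintro ⟨a, b, ⟨hab, rfl⟩, -⟩
        exact he ⟨a, hab⟩
      rw [e1, e2]
      exact RP.nil x

theorem col_disj (h : PS adj c A S E) {t t' : V} (ht : t ∈ Ends S E) (ht' : t' ∈ Ends S E)
    (hne : t ≠ t') : Disjoint (Col c S E t) (Col c S E t') := by
  rw [Finset.disjoint_left]
  intro x hx hx'
  obtain ⟨a, b, hab, e⟩ := mem_cE.1 hx
  obtain ⟨a', b', hab', e'⟩ := mem_cE.1 hx'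
  obtain ⟨h1, h2⟩ := Finset.mem_filter.1 hab
  obtain ⟨h1', h2'⟩ := Finset.mem_filter.1 hab'
  obtain ⟨rfl, rfl⟩ := h.rain _ _ _ _ h1 h1' (e.trans e'.symm)
  exact Finset.disjoint_left.1 (anc_disj h ht ht' hne) h2 h2'

theorem sum_anc (h : PS adj c A S E) : ∑ t ∈ Ends S E, (Anc S E t).card = S.card := by
  rw [← Finset.card_biUnion]
  · congr 1
    ext x
    simp only [Finset.mem_biUnion]
    constructor
    · rintro ⟨t, ht, hx⟩
      exact Finset.mem_of_mem_filter _ hx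
    · exact anc_cover h
  · intro t ht t' ht' hne
    exact anc_disj h ht ht' hne

theorem sum_col (h : PS adj c A S E) {m : ℕ} (hm : S.card = E.card + m) :
    ∑ t ∈ Ends S E, (Col c S E t).card = E.card := by
  have h1 := sum_anc h
  have h2 : ∑ t ∈ Ends S E, (Anc S E t).card = ∑ t ∈ Ends S E, ((Col c S E t).card + 1) := by
    apply Finset.sum_congr rfl
    intro t ht
    obtain ⟨s, hs⟩ := rp h (ends_sub ht)
    exact hs.card
  rw [Finset.sum_add_distrib] at h2
  simp [ends_card h hm] at h2
  omega

theorem exists_max (hinj : True) {m : ℕ} (hA : m ≤ A.card) : ∃ S E, PS adj c A S E ∧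
    S.card = E.card + m ∧
    ∀ S' E', PS adj c A S' E' → S'.card = E'.card + m → E'.card ≤ E.card := by
  let p : ℕ → Prop := fun n => ∃ S E, PS adj c A S E ∧ S.card = E.card + m ∧ E.card = n
  have h0 : p 0 := by
    obtain ⟨S, hS, hSm⟩ := Finset.exists_subset_card_eq hA
    exact ⟨S, ∅, ⟨hS, by simp, by simp, by simp, ⟨fun _ => 0, by simp⟩, by simp⟩, by simp [hSm], rfl⟩
  have hb : ∀ n, p n → n ≤ A.card := by
    rintro n ⟨S, E, h1, h2, rfl⟩
    have := Finset.card_le_card h1.sub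
    omega
  obtain ⟨S, E, h1, h2, h3⟩ := Nat.findGreatest_spec (P := p) (Nat.zero_le A.card) h0
  refine ⟨S, E, h1, h2, ?_⟩
  intro S' E' h1' h2'
  have := Nat.le_findGreatest (P := p) (hb _ ⟨S', E', h1', h2', rfl⟩) ⟨S', E', h1', h2', rfl⟩
  omega

theorem main_count [Fintype C] (hE : PS adj c A S E) {m D q τ : ℕ} (hm : S.card = E.card + m)
    (hmax : ∀ S' E', PS adj c A S' E' → S'.card = E'.card + m → E'.card ≤ E.card)
    (hdeg : ∀ v ∈ A, D ≤ (A.filter (adj v)).card)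
    (hinj : ∀ v w w', adj v w → adj v w' → c v w = c v w' → w = w')
    (hq : E.card + m + q * (τ + 1) < (m + 1) * (τ + 1)) :
    q * D ≤ E.card + q * (E.card + q * τ + m) := by
  let J0 := (Ends S E).filter fun t => (Anc S E t).card ≤ τ
  have hJ0 : q ≤ J0.card := by
    by_contra hlt
    have h1 : ((Ends S E).filter fun t => ¬ (Anc S E t).card ≤ τ).card * (τ + 1) ≤ S.card := by
      rw [← sum_anc hE]
      calc _ ≤ ∑ t ∈ (Ends S E).filter fun t => ¬ (Anc S E t).card ≤ τ, (Anc S E t).card := by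
            rw [← smul_eq_mul]
            apply Finset.card_nsmul_le_sum
            intro t ht
            have := (Finset.mem_filter.1 ht).2
            omega
        _ ≤ _ := Finset.sum_le_sum_of_subset (Finset.filter_subset _ _)
    have h2 : J0.card + ((Ends S E).filter fun t => ¬ (Anc S E t).card ≤ τ).card = m := by
      rw [← ends_card hE hm]
      exact Finset.card_filter_add_card_filter_not _
    nlinarith
  obtain ⟨J, hJ, hJq⟩ := Finset.exists_subset_card_eq hJ0
  let B := J.biUnion (Anc S E)
  have hB : B.card ≤ q * τ := by
    rw [← hJq]
    apply Finset.card_biUnion_le_card_mul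
    intro t ht
    exact (Finset.mem_filter.1 (hJ ht)).2
  have hJe : ∀ t ∈ J, t ∈ Ends S E := fun t ht => Finset.mem_of_mem_filter _ (hJ ht)
  have := steps hE hm hmax hdeg hinj (P := Anc S E) (B := B) J (Finset.univ \ cE c E) ?_ ?_ ?_ ?_
  · rw [hJq] at this
    have h3 : q * (E.card + B.card + m) ≤ q * (E.card + q * τ + m) :=
      Nat.mul_le_mul_left _ (by omega)
    omega
  · intro f hf
    refine ⟨E, hE, rfl, (Finset.mem_sdiff.1 hf).2, fun v hv => ⟨ends_out (hJe v hv), fun a b hab hb =>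
      anc_pred hE hab hb⟩, fun u v h1 h2 => absurd h1 h2⟩
  · intro x hx; simp [hx]
  · intro x hx
    exact ⟨Finset.subset_biUnion_of_mem _ hx, anc_self (ends_sub (hJe x hx))⟩
  · intro x hx; exact ends_sub (hJe x hx)

end PS

/-- Lemma F -/
theorem lemmaF (ε : ℝ) (hε : 0 < ε) : ∃ m D0 : ℕ, ∀ D : ℕ, D0 ≤ D →
    ∀ (V C : Type) [Fintype C] (adj : V → V → Prop) (c : V → V → C) (A : Finset V),
    A.Nonempty → (∀ v ∈ A, D ≤ (A.filter (adj v)).card) →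
    (∀ v w w', adj v w → adj v w' → c v w = c v w' → w = w') →
    ∃ (Q : Finset V) (s : V → V) (P : V → Finset V) (Co : V → Finset C), Q.card = m ∧
      (∀ t ∈ Q, RP adj c (s t) t (P t) (Co t) ∧ P t ⊆ A) ∧
      (∀ t ∈ Q, ∀ t' ∈ Q, t ≠ t' → Disjoint (P t) (P t') ∧ Disjoint (Co t) (Co t')) ∧
      (1 - ε) * D ≤ ∑ t ∈ Q, ((Co t).card : ℝ) := by
  obtain ⟨q, hq⟩ := exists_nat_gt (2 / ε)
  obtain ⟨m1, hm1⟩ := exists_nat_gt (8 * q / ε)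
  have hq0 : (0:ℝ) < q := lt_trans (by positivity) hq
  let m := m1 + q
  obtain ⟨D0, hD0⟩ := exists_nat_gt (4 * m / ε + m)
  refine ⟨m, D0, ?_⟩
  intro D hD V C _ adj c A hA hdeg hinj
  have hDr : (4 * m / ε + m : ℝ) < D := hD0.trans_le (by exact_mod_cast hD)
  have hDm : (m:ℝ) < D := lt_of_le_of_lt (by have : (0:ℝ) ≤ 4 * m / ε := by positivity
                                             linarith) hDr
  have hDe : (4 * m : ℝ) < ε * D := by
    have : (4 * m / ε : ℝ) < D := by
      have : (0:ℝ) ≤ m := by positivity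
      linarith
    rw [div_lt_iff₀ hε] at this; linarith
  obtain ⟨v0, hv0⟩ := hA
  have hmA : m ≤ A.card := by
    have h1 := hdeg v0 hv0
    have h2 := Finset.card_filter_le A (adj v0)
    have h3 : m < D := by exact_mod_cast hDm
    omega
  obtain ⟨S, E, hE, hm, hmax⟩ := PS.exists_max (adj := adj) (c := c) trivial hmA
  have key : (1 - ε) * D ≤ E.card := by
    by_contra hlt
    push Not at hlt
    have hD0' : (0:ℝ) < D := lt_of_le_of_lt (by positivity) hDm
    let τ := ⌊ε * D / (4 * q)⌋₊
    have hτ1 : (τ:ℝ) ≤ ε * D / (4 * q) := Nat.floor_le (by positivity)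
    have hτ2 : ε * D / (4 * q) < τ + 1 := Nat.lt_floor_add_one _
    have h1 := PS.main_count (q := q) (τ := τ) hE hm hmax hdeg hinj ?_
    · have h1r : (q:ℝ) * D ≤ E.card + q * (E.card + q * τ + m) := by exact_mod_cast h1
      have h2 : (q:ℝ) * τ ≤ ε * D / 4 := by
        calc (q:ℝ) * τ ≤ q * (ε * D / (4 * q)) := by gcongr
          _ = _ := by field_simp
      have h3 : (q:ℝ) * (ε * D / 2) ≤ E.card := by
        have : (q:ℝ) * (E.card + q * τ + m) ≤ q * (D - ε * D / 2) := by
          apply mul_le_mul_of_nonneg_left _ hq0.le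
          nlinarith
        nlinarith
      have h4 : 2 < q * ε := by rwa [div_lt_iff₀ hε] at hq
      nlinarith
    · have h2 : (2 * D : ℝ) < (m1 + 1) * (τ + 1) := by
        rw [div_lt_iff₀ hε] at hm1
        have : (2 * D : ℝ) ≤ m1 * (ε * D / (4 * q)) := by
          rw [mul_div_assoc', le_div_iff₀ (by positivity)]
          nlinarith
        calc (2 * D : ℝ) ≤ m1 * (ε * D / (4 * q)) := this
          _ ≤ m1 * (τ + 1) := by gcongr
          _ < _ := by nlinarith [(Nat.cast_nonneg τ : (0:ℝ) ≤ τ)]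
      have h3 : (E.card:ℝ) ≤ D := by nlinarith
      have h4 : (E.card + m + q * (τ + 1) : ℝ) < (m + 1) * (τ + 1) := by
        have : (m:ℝ) = m1 + q := by simp [m]
        have h5 : (E.card + m:ℝ) < (m1 + 1) * (τ + 1) := by linarith
        nlinarith
      exact_mod_cast h4
  have hs : ∀ t, ∃ s, t ∈ PS.Ends S E → RP adj c s t (PS.Anc S E t) (PS.Col c S E t) := by
    intro t
    by_cases ht : t ∈ PS.Ends S E
    · obtain ⟨s, hs⟩ := PS.rp hE (PS.ends_sub ht)
      exact ⟨s, fun _ => hs⟩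
    · exact ⟨t, fun h => absurd h ht⟩
  choose s hs using hs
  refine ⟨PS.Ends S E, s, PS.Anc S E, PS.Col c S E, PS.ends_card hE hm,
    fun t ht => ⟨hs t ht, (Finset.filter_subset _ _).trans hE.sub⟩,
    fun t ht t' ht' hne => ⟨PS.anc_disj hE ht ht' hne, PS.col_disj hE ht ht' hne⟩, ?_⟩
  have := PS.sum_col hE hm
  rw [← Nat.cast_sum, this]
  exact key

section sampling
variable {I : Type} [Fintype I] {r : ℕ}

theorem resample (i : I) (F : (I → Fin r) → ℝ) :
    ∑ θ : I → Fin r, ∑ x : Fin r, F (Function.update θ i x) = r * ∑ θ : I → Fin r, F θ := by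
  rw [← Fintype.sum_prod_type' (f := fun (θ : I → Fin r) (x : Fin r) => F (Function.update θ i x))]
  let e : ((I → Fin r) × Fin r) ≃ ((I → Fin r) × Fin r) :=
    { toFun := fun p => (Function.update p.1 i p.2, p.1 i)
      invFun := fun p => (Function.update p.1 i p.2, p.1 i)
      left_inv := by intro p; simp
      right_inv := by intro p; simp }
  rw [Fintype.sum_equiv e (fun p => F (Function.update p.1 i p.2)) (fun p => F p.1) (fun p => rfl)]
  rw [Fintype.sum_prod_type' (f := fun (θ : I → Fin r) (x : Fin r) => F θ)]
  simp [Finset.mul_sum]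

theorem block {V : Type} (g : Fin r → Fin r → ℝ) (hg : ∀ x y, 0 ≤ g x y) (μ : ℝ) (hμ0 : 0 ≤ μ)
    (hμ1 : ∑ x, ∑ y, g x y ≤ r * (r * μ)) (hμ2 : ∑ x, g x x ≤ r * μ) (hr : 0 < r)
    (Z : Finset V) (a b : V → I)
    (hd : ∀ z ∈ Z, ∀ z' ∈ Z, z ≠ z' → a z ≠ a z' ∧ a z ≠ b z' ∧ b z ≠ b z') :
    ∑ θ : I → Fin r, ∏ z ∈ Z, g (θ (a z)) (θ (b z)) ≤ (r:ℝ) ^ (Fintype.card I) * μ ^ Z.card := by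
  have hr' : (0:ℝ) < r := by exact_mod_cast hr
  induction Z using Finset.induction_on with
  | empty => simp
  | insert z Z hz ih =>
    have ih := ih (fun z hz z' hz' hne => hd z (by simp [hz]) z' (by simp [hz']) hne)
    let H : (I → Fin r) → ℝ := fun θ => ∏ z ∈ Z, g (θ (a z)) (θ (b z))
    have hH0 : ∀ θ, 0 ≤ H θ := fun θ => Finset.prod_nonneg fun z _ => hg _ _
    have hHa : ∀ θ x, H (Function.update θ (a z) x) = H θ := by
      intro θ x
      apply Finset.prod_congr rfl
      intro w hw
      have hne : z ≠ w := fun e => hz (e ▸ hw)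
      have := hd z (by simp) w (by simp [hw]) hne
      rw [Function.update_of_ne this.1.symm, Function.update_of_ne this.2.1.symm]
    have hHb : ∀ θ x, H (Function.update θ (b z) x) = H θ := by
      intro θ x
      apply Finset.prod_congr rfl
      intro w hw
      have hne : w ≠ z := fun e => hz (e ▸ hw)
      have := hd w (by simp [hw]) z (by simp) hne
      rw [Function.update_of_ne this.2.1, Function.update_of_ne this.2.2]
    rw [Finset.card_insert_of_notMem hz]
    have e1 : ∑ θ : I → Fin r, ∏ z ∈ insert z Z, g (θ (a z)) (θ (b z))
        = ∑ θ : I → Fin r, g (θ (a z)) (θ (b z)) * H θ := by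
      apply Finset.sum_congr rfl
      intro θ _
      rw [Finset.prod_insert hz]
    rw [e1]
    have key : (∑ θ : I → Fin r, g (θ (a z)) (θ (b z)) * H θ) ≤ ∑ θ : I → Fin r, μ * H θ := by
      by_cases hab : a z = b z
      · apply le_of_mul_le_mul_left _ hr'
        rw [← resample (a z), Finset.mul_sum]
        apply Finset.sum_le_sum
        intro θ _
        simp only [hHa, ← hab, Function.update_self]
        rw [← Finset.sum_mul, ← mul_assoc]
        exact mul_le_mul_of_nonneg_right hμ2 (hH0 θ)
      · apply le_of_mul_le_mul_left _ hr'
        apply le_of_mul_le_mul_left _ hr'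
        rw [← resample (a z), ← resample (b z), Finset.mul_sum, Finset.mul_sum]
        apply Finset.sum_le_sum
        intro θ _
        have : ∀ y x, g (Function.update (Function.update θ (b z) y) (a z) x (a z))
            (Function.update (Function.update θ (b z) y) (a z) x (b z)) *
            H (Function.update (Function.update θ (b z) y) (a z) x) = g x y * H θ := by
          intro y x
          rw [hHa, hHb, Function.update_self, Function.update_of_ne (Ne.symm hab),
            Function.update_self]
        simp only [this]
        rw [Finset.sum_comm]
        simp only [← Finset.sum_mul]
        rw [← mul_assoc, ← mul_assoc]
        rw [← mul_assoc] at hμ1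
        exact mul_le_mul_of_nonneg_right hμ1 (hH0 θ)
    rw [← Finset.mul_sum] at key
    calc _ ≤ _ := key
      _ ≤ μ * ((r:ℝ) ^ (Fintype.card I) * μ ^ Z.card) := mul_le_mul_of_nonneg_left ih hμ0
      _ = _ := by ring

theorem lowE {V : Type} (i0 : Fin r) (Z : Finset V) (a b : V → I)
    (hd : ∀ z ∈ Z, ∀ z' ∈ Z, z ≠ z' → a z ≠ a z' ∧ a z ≠ b z' ∧ b z ≠ b z') (t : ℝ)
    (ht : t ≤ Z.card) :
    ∑ θ : I → Fin r, Real.exp (t / (4 * r ^ 2)) *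
      ∏ z ∈ Z, (if θ (a z) = i0 ∧ θ (b z) = i0 then (1/2 : ℝ) else 1)
      ≤ (r:ℝ) ^ (Fintype.card I) * Real.exp (- (t / (4 * r ^ 2))) := by
  have hr : 0 < r := i0.pos
  have hr' : (1:ℝ) ≤ r := by exact_mod_cast hr
  have hb := block (fun x y : Fin r => if x = i0 ∧ y = i0 then (1/2 : ℝ) else 1)
    (fun x y => by split_ifs <;> norm_num) (1 - 1 / (2 * r ^ 2)) (by
      rw [sub_nonneg, div_le_one (by positivity)]; nlinarith) (by
      have : ∀ x y : Fin r, (if x = i0 ∧ y = i0 then (1/2 : ℝ) else 1)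
        = 1 - (if x = i0 then (if y = i0 then (1/2 : ℝ) else 0) else 0) := by
        intro x y; by_cases h1 : x = i0 <;> by_cases h2 : y = i0 <;> simp [h1, h2]; norm_num
      simp only [this]
      simp [Finset.sum_sub_distrib]
      field_simp
      ring_nf; rfl) (by
      have : ∀ x : Fin r, (if x = i0 ∧ x = i0 then (1/2 : ℝ) else 1)
        = 1 - (if x = i0 then (1/2 : ℝ) else 0) := by
        intro x; by_cases h1 : x = i0 <;> simp [h1]; norm_num
      simp only [this]
      simp [Finset.sum_sub_distrib]
      rw [mul_sub]
      have : (r:ℝ) * ((r ^ 2 : ℝ)⁻¹ * 2⁻¹) ≤ 2⁻¹ := by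
        rw [← mul_assoc]
        have : (r:ℝ) * (r ^ 2 : ℝ)⁻¹ ≤ 1 := by
          rw [← div_eq_mul_inv, div_le_one (by positivity)]; nlinarith
        nlinarith
      linarith) hr Z a b hd
  rw [← Finset.mul_sum]
  calc _ ≤ Real.exp (t / (4 * r ^ 2)) * ((r:ℝ) ^ (Fintype.card I) * (1 - 1 / (2 * r ^ 2)) ^ Z.card) :=
        mul_le_mul_of_nonneg_left hb (Real.exp_pos _).le
    _ ≤ Real.exp (t / (4 * r ^ 2)) * ((r:ℝ) ^ (Fintype.card I) * Real.exp (- (1 / (2 * r^2)) * Z.card)) := by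
        gcongr
        rw [mul_comm (-_), Real.exp_nat_mul]
        apply pow_le_pow_left₀
        · rw [sub_nonneg, div_le_one (by positivity)]; nlinarith
        · have := Real.add_one_le_exp (-(1 / (2 * (r:ℝ)^2)))
          linarith
    _ ≤ Real.exp (t / (4 * r ^ 2)) * ((r:ℝ) ^ (Fintype.card I) * Real.exp (- (1 / (2 * r^2)) * t)) := by
        refine mul_le_mul_of_nonneg_left (mul_le_mul_of_nonneg_left (Real.exp_le_exp.2 ?_) (by positivity)) (Real.exp_pos _).le
        have : (0:ℝ) ≤ 1 / (2 * r^2) := by positivity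
        have := mul_le_mul_of_nonneg_left ht this
        linarith
    _ = (r:ℝ) ^ (Fintype.card I) * (Real.exp (t / (4 * r ^ 2)) * Real.exp (- (1 / (2 * r^2)) * t)) := by ring
    _ = _ := by
        rw [← Real.exp_add]
        congr 2
        field_simp
        ring

theorem upE {V : Type} (i0 : Fin r) (Z : Finset V) (a b : V → I)
    (hd : ∀ z ∈ Z, ∀ z' ∈ Z, z ≠ z' → a z ≠ a z' ∧ a z ≠ b z' ∧ b z ≠ b z') (t : ℝ)
    (ht0 : 0 ≤ t) (ht : t ≤ Z.card) :
    ∑ θ : I → Fin r, Real.exp (- (8 / r * Z.card)) *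
      ∏ z ∈ Z, (if θ (a z) = i0 ∨ θ (b z) = i0 then (3 : ℝ) else 1)
      ≤ (r:ℝ) ^ (Fintype.card I) * Real.exp (- (t / (4 * r ^ 2))) := by
  have hr : 0 < r := i0.pos
  have hr' : (1:ℝ) ≤ r := by exact_mod_cast hr
  have hb := block (fun x y : Fin r => if x = i0 ∨ y = i0 then (3 : ℝ) else 1)
    (fun x y => by split_ifs <;> norm_num) (1 + 4 / r) (by positivity) (by
      have : ∀ x y : Fin r, (if x = i0 ∨ y = i0 then (3 : ℝ) else 1)
        ≤ 1 + (if x = i0 then 2 else 0) + (if y = i0 then (2 : ℝ) else 0) := by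
        intro x y; by_cases h1 : x = i0 <;> by_cases h2 : y = i0 <;> simp [h1, h2] <;> norm_num
      calc _ ≤ ∑ x : Fin r, ∑ y : Fin r, (1 + (if x = i0 then 2 else 0) + (if y = i0 then (2 : ℝ) else 0)) :=
            Finset.sum_le_sum fun x _ => Finset.sum_le_sum fun y _ => this x y
        _ = _ := by
          simp [Finset.sum_add_distrib]
          field_simp
          ring) (by
      have : ∀ x : Fin r, (if x = i0 ∨ x = i0 then (3 : ℝ) else 1)
        = 1 + (if x = i0 then (2 : ℝ) else 0) := by
        intro x; by_cases h1 : x = i0 <;> simp [h1]; norm_num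
      simp only [this]
      simp [Finset.sum_add_distrib]
      rw [mul_add, mul_div_cancel₀ _ (by positivity)]
      linarith) hr Z a b hd
  rw [← Finset.mul_sum]
  have hZ : (0:ℝ) ≤ Z.card := by positivity
  calc _ ≤ Real.exp (- (8 / r * Z.card)) * ((r:ℝ) ^ (Fintype.card I) * (1 + 4 / r) ^ Z.card) :=
        mul_le_mul_of_nonneg_left hb (Real.exp_pos _).le
    _ ≤ Real.exp (- (8 / r * Z.card)) * ((r:ℝ) ^ (Fintype.card I) * Real.exp ((4 / r) * Z.card)) := by
        gcongr
        rw [mul_comm (4 / (r:ℝ)), Real.exp_nat_mul]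
        apply pow_le_pow_left₀
        · positivity
        · have := Real.add_one_le_exp (4 / (r:ℝ))
          linarith
    _ = (r:ℝ) ^ (Fintype.card I) * (Real.exp (- (8 / r * Z.card)) * Real.exp ((4 / r) * Z.card)) := by ring
    _ ≤ _ := by
        rw [← Real.exp_add]
        gcongr
        have h1 : t / (4 * r ^ 2) ≤ 4 / r * Z.card := by
          rw [div_le_iff₀ (by positivity)]
          have : 4 / (r:ℝ) * Z.card * (4 * r^2) = 16 * r * Z.card := by field_simp; ring
          rw [this]
          nlinarith
        have h2 : - (8 / r * Z.card) + (4 / r) * Z.card = - (4 / (r:ℝ) * Z.card) := by ring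
        linarith

theorem prod_ite_pow {V : Type} (Z : Finset V) (p : V → Prop) [DecidablePred p] (x : ℝ) :
    ∏ z ∈ Z, (if p z then x else 1) = x ^ (Z.filter p).card := by
  rw [Finset.prod_ite]; simp

/-- abstract sampling -/
theorem sample {V ι κ : Type} [Fintype ι] [Fintype κ] (hr : 0 < r) (t : ℝ) (ht0 : 0 ≤ t)
    (Z : ι → Finset V) (a b : ι → V → I) (Y : κ → Finset V) (a' b' : κ → V → I)
    (hd : ∀ j, ∀ z ∈ Z j, ∀ z' ∈ Z j, z ≠ z' → a j z ≠ a j z' ∧ a j z ≠ b j z' ∧ b j z ≠ b j z')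
    (hd' : ∀ j, ∀ z ∈ Y j, ∀ z' ∈ Y j, z ≠ z' → a' j z ≠ a' j z' ∧ a' j z ≠ b' j z' ∧ b' j z ≠ b' j z')
    (hsmall : ((Fintype.card ι : ℝ) + Fintype.card κ) * Real.exp (- (t / (4 * r ^ 2))) < 1) :
    ∃ W : Set I, (∀ j, t ≤ (Z j).card →
        t / (4 * r ^ 2) ≤ ((Z j).filter fun z => a j z ∈ W ∧ b j z ∈ W).card) ∧
      ∀ j, t ≤ (Y j).card →
        (((Y j).filter fun z => a' j z ∈ W ∨ b' j z ∈ W).card : ℝ) ≤ 8 / r * (Y j).card := by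
  let i0 : Fin r := ⟨0, hr⟩
  have hr' : (0:ℝ) < r := by exact_mod_cast hr
  let f : ι → (I → Fin r) → ℝ := fun j θ => Real.exp (t / (4 * r ^ 2)) *
      ∏ z ∈ Z j, (if θ (a j z) = i0 ∧ θ (b j z) = i0 then (1/2 : ℝ) else 1)
  let g : κ → (I → Fin r) → ℝ := fun j θ => Real.exp (- (8 / r * (Y j).card)) *
      ∏ z ∈ Y j, (if θ (a' j z) = i0 ∨ θ (b' j z) = i0 then (3 : ℝ) else 1)
  have hf0 : ∀ j θ, 0 ≤ f j θ := fun j θ => mul_nonneg (Real.exp_pos _).le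
    (Finset.prod_nonneg fun z _ => by split_ifs <;> norm_num)
  have hg0 : ∀ j θ, 0 ≤ g j θ := fun j θ => mul_nonneg (Real.exp_pos _).le
    (Finset.prod_nonneg fun z _ => by split_ifs <;> norm_num)
  let J := Finset.univ.filter fun j : ι => t ≤ (Z j).card
  let L := Finset.univ.filter fun j : κ => t ≤ (Y j).card
  let X : ℝ := (r:ℝ) ^ (Fintype.card I)
  have hX : 0 < X := by positivity
  have h1 : ∃ θ : I → Fin r, ∑ j ∈ J, f j θ + ∑ j ∈ L, g j θ < 1 := by
    by_contra hcon
    push Not at hcon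
    have h2 : X ≤ ∑ θ : I → Fin r, (∑ j ∈ J, f j θ + ∑ j ∈ L, g j θ) := by
      calc X = ∑ θ : I → Fin r, (1:ℝ) := by simp [X]
        _ ≤ _ := Finset.sum_le_sum fun θ _ => hcon θ
    rw [Finset.sum_add_distrib, Finset.sum_comm, Finset.sum_comm (t := L)] at h2
    have h3 : ∑ j ∈ J, ∑ θ : I → Fin r, f j θ ≤ J.card • (X * Real.exp (- (t / (4 * r ^ 2)))) :=
      Finset.sum_le_card_nsmul _ _ _ fun j hj =>
        lowE i0 (Z j) (a j) (b j) (hd j) t (Finset.mem_filter.1 hj).2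
    have h4 : ∑ j ∈ L, ∑ θ : I → Fin r, g j θ ≤ L.card • (X * Real.exp (- (t / (4 * r ^ 2)))) :=
      Finset.sum_le_card_nsmul _ _ _ fun j hj =>
        upE i0 (Y j) (a' j) (b' j) (hd' j) t ht0 (Finset.mem_filter.1 hj).2
    rw [nsmul_eq_mul] at h3 h4
    have h5 : (J.card : ℝ) ≤ Fintype.card ι := by exact_mod_cast Finset.card_le_univ J
    have h6 : (L.card : ℝ) ≤ Fintype.card κ := by exact_mod_cast Finset.card_le_univ L
    have h7 : 0 < Real.exp (- (t / (4 * (r:ℝ) ^ 2))) := Real.exp_pos _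
    have h8 : X ≤ X * (((Fintype.card ι : ℝ) + Fintype.card κ) * Real.exp (- (t / (4 * r ^ 2)))) := by
      calc X ≤ _ := h2
        _ ≤ J.card * (X * Real.exp (- (t / (4 * r ^ 2)))) + L.card * (X * Real.exp (- (t / (4 * r ^ 2)))) := by
          linarith
        _ ≤ Fintype.card ι * (X * Real.exp (- (t / (4 * r ^ 2)))) + Fintype.card κ * (X * Real.exp (- (t / (4 * r ^ 2)))) := by
          gcongr
        _ = _ := by ring
    nlinarith
  obtain ⟨θ, hθ⟩ := h1
  have hF : 0 ≤ ∑ j ∈ J, f j θ := Finset.sum_nonneg fun j _ => hf0 j θ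
  have hGs : 0 ≤ ∑ j ∈ L, g j θ := Finset.sum_nonneg fun j _ => hg0 j θ
  refine ⟨{i | θ i = i0}, ?_, ?_⟩
  · intro j hj
    have hjJ : j ∈ J := by simp [J, hj]
    have h2 : f j θ < 1 := by
      have := Finset.single_le_sum (f := fun j => f j θ) (fun j _ => hf0 j θ) hjJ
      linarith
    simp only [f, prod_ite_pow] at h2
    by_contra hlt
    push Not at hlt
    have h3 : (1/2 : ℝ) ^ ((Z j).filter fun z => θ (a j z) = i0 ∧ θ (b j z) = i0).card
        ≥ Real.exp (- (t / (4 * r ^ 2))) := by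
      calc _ ≥ Real.exp (-1) ^ ((Z j).filter fun z => θ (a j z) = i0 ∧ θ (b j z) = i0).card := by
            apply pow_le_pow_left₀ (Real.exp_pos _).le
            rw [Real.exp_neg, one_div]
            apply inv_anti₀ (by norm_num)
            have := Real.add_one_le_exp (1:ℝ)
            linarith
        _ = Real.exp (((Z j).filter fun z => θ (a j z) = i0 ∧ θ (b j z) = i0).card * (-1)) := by
            rw [Real.exp_nat_mul]
        _ ≥ _ := by
            apply Real.exp_le_exp.2
            have : (((Z j).filter fun z => θ (a j z) = i0 ∧ θ (b j z) = i0).card : ℝ) < t / (4 * r ^ 2) := by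
              refine lt_of_eq_of_lt ?_ hlt; congr 2; ext; simp
            linarith
    have h4 : Real.exp (t / (4 * (r:ℝ) ^ 2)) * Real.exp (- (t / (4 * r ^ 2))) = 1 := by
      rw [← Real.exp_add]; simp
    nlinarith [Real.exp_pos (t / (4 * (r:ℝ) ^ 2))]
  · intro j hj
    have hjJ : j ∈ L := by simp [L, hj]
    have h2 : g j θ < 1 := by
      have := Finset.single_le_sum (f := fun j => g j θ) (fun j _ => hg0 j θ) hjJ
      linarith
    simp only [g, prod_ite_pow] at h2
    by_contra hlt
    push Not at hlt
    have h3 : (3 : ℝ) ^ ((Y j).filter fun z => θ (a' j z) = i0 ∨ θ (b' j z) = i0).card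
        ≥ Real.exp (8 / r * (Y j).card) := by
      calc _ ≥ Real.exp 1 ^ ((Y j).filter fun z => θ (a' j z) = i0 ∨ θ (b' j z) = i0).card := by
            apply pow_le_pow_left₀ (Real.exp_pos _).le
            have := Real.exp_one_lt_d9
            linarith
        _ = Real.exp (((Y j).filter fun z => θ (a' j z) = i0 ∨ θ (b' j z) = i0).card * 1) := by
            rw [Real.exp_nat_mul]
        _ ≥ _ := by
            apply Real.exp_le_exp.2
            have : 8 / r * (Y j).card < (((Y j).filter fun z => θ (a' j z) = i0 ∨ θ (b' j z) = i0).card : ℝ) := by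
              refine lt_of_lt_of_eq hlt ?_; congr 2; ext; simp
            linarith
    have h4 : Real.exp (- (8 / r * (Y j).card)) * Real.exp (8 / r * (Y j).card) = 1 := by
      rw [← Real.exp_add]; simp
    nlinarith [Real.exp_pos (- (8 / r * (Y j).card : ℝ))]
end sampling

/-- sampling vertices and colours -/
theorem sampleVC {V C : Type} [Fintype V] [Fintype C] {ι κ : Type} [Fintype ι] [Fintype κ]
    (c : V → V → C) {r : ℕ} (hr : 0 < r) (t : ℝ) (ht0 : 0 ≤ t)
    (y : ι → V) (Z : ι → Finset V) (X : κ → Finset V) (Nb : V → Finset V)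
    (hZ : ∀ j, ∀ z ∈ Z j, ∀ z' ∈ Z j, c (y j) z = c (y j) z' → z = z')
    (hN : ∀ v, ∀ z ∈ Nb v, ∀ z' ∈ Nb v, c v z = c v z' → z = z')
    (hsmall : ((Fintype.card ι : ℝ) + Fintype.card κ + Fintype.card V)
      * Real.exp (- (t / (4 * r ^ 2))) < 1) :
    ∃ (W : Finset V) (R : Finset C),
      (∀ j, t ≤ (Z j).card → t / (4 * r ^ 2) ≤ ((Z j).filter fun z => z ∈ W ∧ c (y j) z ∈ R).card) ∧
      (∀ j, t ≤ (X j).card → t / (4 * r ^ 2) ≤ ((X j).filter fun z => z ∈ W).card) ∧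
      (∀ v, t ≤ (Nb v).card →
        (((Nb v).filter fun z => z ∈ W ∨ c v z ∈ R).card : ℝ) ≤ 8 / r * (Nb v).card) := by
  obtain ⟨W, h1, h2⟩ := sample (I := V ⊕ C) (ι := ι ⊕ κ) (κ := V) hr t ht0 (Sum.elim Z X)
    (fun j z => Sum.inl z) (fun j z => j.elim (fun j => Sum.inr (c (y j) z)) (fun _ => Sum.inl z))
    Nb (fun v z => Sum.inl z) (fun v z => Sum.inr (c v z)) (by
      rintro (j | j) z hz z' hz' hne
      · simp [hne]
        exact fun e => hne (hZ j z hz z' hz' e)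
      · simp [hne]) (by
      intro v z hz z' hz' hne
      simp [hne]
      exact fun e => hne (hN v z hz z' hz' e)) (by simpa using hsmall)
  refine ⟨Finset.univ.filter fun v => Sum.inl v ∈ W, Finset.univ.filter fun x => Sum.inr x ∈ W, ?_, ?_, ?_⟩
  · intro j hj
    convert h1 (Sum.inl j) hj using 4 <;> simp
  · intro j hj
    convert h1 (Sum.inr j) hj using 4 <;> simp
  · intro v hv
    convert h2 v hv using 4 <;> simp

structure PG {V C : Type} (Adj : V → V → Prop) (c : V → V → C) : Prop where
  symm : ∀ u v, Adj u v → Adj v u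
  irrefl : ∀ u, ¬ Adj u u
  csymm : ∀ u v, Adj u v → c u v = c v u
  proper : ∀ u v w, Adj u v → Adj u w → c u v = c u w → v = w

noncomputable def layer {V : Type} (Adj : V → V → Prop) (U S0 : Finset V) (t : ℝ) : ℕ → Finset V
  | 0 => S0
  | i+1 => layer Adj U S0 t i ∪ U.filter fun y => t ≤ ((layer Adj U S0 t i).filter (Adj y)).card

theorem layers {V C : Type} [Fintype V] [Fintype C] {Adj : V → V → Prop} {c : V → V → C}
    (hP : PG Adj c) (U : Finset V) {r : ℕ} (hr : 0 < r) (t1 t2 : ℝ) (ht2 : 0 ≤ t2)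
    (ht12 : t2 ≤ t1) (s : ℕ) (X1 X2 : Finset V → Finset V) (Lw : Finset V → V → Finset V)
    (hLw : ∀ S x, ∀ y ∈ Lw S x, Adj x y)
    (hsmall : (10 * ((s:ℝ) + 1) * (Fintype.card V : ℝ) ^ 2) * Real.exp (- (t2 / (4 * r ^ 2))) < 1) :
    ∃ (W : Finset V) (R : Finset C) (L : V → ℕ → Finset V),
      (∀ v, ∀ z ∈ L v 0, z ∈ U ∧ Adj v z ∧ z ∈ W ∧ c v z ∈ R) ∧
      (∀ v, t1 ≤ (U.filter (Adj v)).card → t1 / (4 * r ^ 2) ≤ (L v 0).card) ∧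
      (∀ v i, L v (i+1) = L v i ∪ U.filter fun y => t2 ≤ ((L v i).filter (Adj y)).card) ∧
      (∀ v, ∀ i ≤ s, ∀ y ∈ L v (i+1), y ∉ L v i →
        t2 / (4 * r ^ 2) ≤ ((L v i).filter fun z => Adj y z ∧ z ∈ W ∧ c y z ∈ R).card) ∧
      (∀ v, ∀ i ≤ s, t2 ≤ (X1 (L v i)).card → t2 / (4 * r ^ 2) ≤ ((X1 (L v i)).filter fun z => z ∈ W).card) ∧
      (∀ v, ∀ i ≤ s, t2 ≤ (X2 (L v i)).card → t2 / (4 * r ^ 2) ≤ ((X2 (L v i)).filter fun z => z ∈ W).card) ∧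
      (∀ v, ∀ i ≤ s, ∀ x, t2 ≤ (Lw (L v i) x).card → t2 / (4 * r ^ 2) ≤
        ((Lw (L v i) x).filter fun z => z ∈ W ∧ c x z ∈ R).card) ∧
      (∀ v, t1 ≤ (U.filter (Adj v)).card →
        (((U.filter (Adj v)).filter fun z => z ∈ W ∨ c v z ∈ R).card : ℝ)
          ≤ 16 / r * (U.filter (Adj v)).card) := by
  have hN : ∀ v, ∀ z ∈ U.filter (Adj v), ∀ z' ∈ U.filter (Adj v), c v z = c v z' → z = z' := by
    intro v z hz z' hz' e
    exact hP.proper v z z' (Finset.mem_filter.1 hz).2 (Finset.mem_filter.1 hz').2 e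
  by_cases hV : Fintype.card V = 0
  · have : IsEmpty V := Fintype.card_eq_zero_iff.1 hV
    exact ⟨∅, ∅, fun v => isEmptyElim v, fun v => isEmptyElim v, fun v => isEmptyElim v,
      fun v => isEmptyElim v, fun v => isEmptyElim v, fun v => isEmptyElim v, fun v => isEmptyElim v,
      fun v => isEmptyElim v, fun v => isEmptyElim v⟩
  have hV1 : (1:ℝ) ≤ Fintype.card V := by exact_mod_cast Nat.one_le_iff_ne_zero.2 hV
  have hs1 : (1:ℝ) ≤ (s:ℝ) + 1 := by have : (0:ℝ) ≤ s := by positivity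
                                     linarith
  have hV2 : (Fintype.card V : ℝ) ≤ (Fintype.card V : ℝ)^2 := by nlinarith
  have hV3 : (Fintype.card V : ℝ)^2 ≤ ((s:ℝ)+1) * (Fintype.card V : ℝ)^2 := by nlinarith
  have hV4 : ((s:ℝ)+1) * (Fintype.card V : ℝ) ≤ ((s:ℝ)+1) * (Fintype.card V : ℝ)^2 := by nlinarith
  obtain ⟨W1, R1, h1, -, h1u⟩ := sampleVC (ι := V) (κ := Empty) c hr t1 (ht2.trans ht12)
    id (fun v => U.filter (Adj v)) (fun e => isEmptyElim e) (fun v => U.filter (Adj v)) hN hN (by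
      refine lt_of_le_of_lt ?_ hsmall
      apply mul_le_mul
      · simp; linarith
      · apply Real.exp_le_exp.2
        apply neg_le_neg
        gcongr
      · positivity
      · positivity)
  let L : V → ℕ → Finset V := fun v => layer Adj U
    ((U.filter (Adj v)).filter fun z => z ∈ W1 ∧ c v z ∈ R1) t2
  obtain ⟨W2, R2, h2, h2x, h2u⟩ := sampleVC (ι := (V × Fin (s+1) × V) ⊕ (V × Fin (s+1) × V))
    (κ := (V × Fin (s+1)) ⊕ (V × Fin (s+1))) c hr t2 ht2
    (Sum.elim (fun p => p.2.2) (fun p => p.2.2))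
    (Sum.elim (fun p => (L p.1 p.2.1).filter (Adj p.2.2)) (fun p => Lw (L p.1 p.2.1) p.2.2))
    (Sum.elim (fun p => X1 (L p.1 p.2)) (fun p => X2 (L p.1 p.2))) (fun v => U.filter (Adj v)) (by
      rintro (⟨v, i, y⟩ | ⟨v, i, y⟩) z hz z' hz' e
      · simp only [Sum.elim_inl, Finset.mem_filter] at hz hz' e
        exact hP.proper y z z' hz.2 hz'.2 e
      · simp only [Sum.elim_inr] at hz hz' e
        exact hP.proper y z z' (hLw _ _ _ hz) (hLw _ _ _ hz') e) hN (by
      refine lt_of_le_of_lt ?_ hsmall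
      apply mul_le_mul_of_nonneg_right _ (Real.exp_pos _).le
      simp only [Fintype.card_sum, Fintype.card_prod, Fintype.card_fin]
      push_cast
      nlinarith)
  refine ⟨W1 ∪ W2, R1 ∪ R2, L, ?_, ?_, ?_, ?_, ?_, ?_, ?_, ?_⟩
  · intro v z hz
    simp only [L, layer, Finset.mem_filter] at hz
    simp only [Finset.mem_union]
    exact ⟨hz.1.1, hz.1.2, Or.inl hz.2.1, Or.inl hz.2.2⟩
  · intro v hv
    exact h1 v hv
  · intro v i
    rfl
  · intro v i hi y hy hy'
    have h3 : t2 ≤ ((L v i).filter (Adj y)).card := by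
      have : y ∈ L v i ∪ U.filter fun y => t2 ≤ ((L v i).filter (Adj y)).card := hy
      rcases Finset.mem_union.1 this with h | h
      · exact absurd h hy'
      · exact (Finset.mem_filter.1 h).2
    have h4 := h2 (Sum.inl (v, ⟨i, by omega⟩, y)) h3
    refine h4.trans ?_
    norm_cast
    apply Finset.card_le_card
    intro z hz
    simp only [Sum.elim_inl, Finset.mem_filter, Finset.mem_union] at hz ⊢
    exact ⟨hz.1.1, hz.1.2, Or.inr hz.2.1, Or.inr hz.2.2⟩
  · intro v i hi h
    refine (h2x (Sum.inl (v, ⟨i, by omega⟩)) h).trans ?_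
    norm_cast
    apply Finset.card_le_card
    intro z hz
    simp only [Sum.elim_inl, Finset.mem_filter, Finset.mem_union] at hz ⊢
    exact ⟨hz.1, Or.inr hz.2⟩
  · intro v i hi h
    refine (h2x (Sum.inr (v, ⟨i, by omega⟩)) h).trans ?_
    norm_cast
    apply Finset.card_le_card
    intro z hz
    simp only [Sum.elim_inr, Finset.mem_filter, Finset.mem_union] at hz ⊢
    exact ⟨hz.1, Or.inr hz.2⟩
  · intro v i hi x h
    refine (h2 (Sum.inr (v, ⟨i, by omega⟩, x)) h).trans ?_
    norm_cast
    apply Finset.card_le_card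
    intro z hz
    have hz := Finset.mem_filter.1 hz
    exact Finset.mem_filter.2 ⟨hz.1, Finset.mem_union_right _ hz.2.1, Finset.mem_union_right _ hz.2.2⟩
  · intro v hv
    have h5 := h1u v hv
    have h6 := h2u v (ht12.trans hv)
    have h7 : ((U.filter (Adj v)).filter fun z => z ∈ W1 ∪ W2 ∨ c v z ∈ R1 ∪ R2).card ≤
      ((U.filter (Adj v)).filter fun z => z ∈ W1 ∨ c v z ∈ R1).card +
      ((U.filter (Adj v)).filter fun z => z ∈ W2 ∨ c v z ∈ R2).card := by
      refine le_trans (Finset.card_le_card ?_) (Finset.card_union_le _ _)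
      intro z hz
      simp only [Finset.mem_filter, Finset.mem_union] at hz ⊢
      tauto
    have h8 : (((U.filter (Adj v)).filter fun z => z ∈ W1 ∪ W2 ∨ c v z ∈ R1 ∪ R2).card : ℝ) ≤
      ((U.filter (Adj v)).filter fun z => z ∈ W1 ∨ c v z ∈ R1).card +
      ((U.filter (Adj v)).filter fun z => z ∈ W2 ∨ c v z ∈ R2).card := by exact_mod_cast h7
    have e : (16 / r * (U.filter (Adj v)).card : ℝ) = 8 / r * (U.filter (Adj v)).card + 8 / r * (U.filter (Adj v)).card := by ring
    rw [e]
    linarith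

theorem PG.card_col {V C : Type} {Adj : V → V → Prop} {c : V → V → C}
    (hP : PG Adj c) (v : V) (X : Finset V) (F : Finset C) (hX : ∀ x ∈ X, Adj v x ∧ c v x ∈ F) :
    X.card ≤ F.card := by
  apply Finset.card_le_card_of_injOn (c v)
  · intro x hx; exact (hX x hx).2
  · intro x hx y hy e
    exact hP.proper v x y (hX x hx).1 (hX y hy).1 e

theorem link {V C : Type} {Adj : V → V → Prop} {c : V → V → C}
    (hP : PG Adj c) {W : Finset V} {R : Finset C} {L : ℕ → Finset V} {v : V} {k : ℝ} {s : ℕ}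
    (h0 : ∀ z ∈ L 0, Adj v z ∧ z ∈ W ∧ c v z ∈ R)
    (h1 : ∀ i ≤ s, ∀ y ∈ L (i+1), y ∉ L i →
      k ≤ ((L i).filter fun z => Adj y z ∧ z ∈ W ∧ c y z ∈ R).card) (i : ℕ) :
    i ≤ s + 1 → ∀ (y : V) (FV : Finset V) (FC : Finset C), y ∈ L i → v ∈ FV → y ∉ FV →
      (y ∈ L 0 → c v y ∉ FC) → (FV.card : ℝ) + 2 * FC.card + 3 * i < k →
      ∃ S T, RP Adj c v y S T ∧ (∀ x ∈ S, x = v ∨ x = y ∨ (x ∈ W ∧ x ∉ FV)) ∧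
        (∀ x ∈ T, x ∈ R ∧ x ∉ FC) ∧ T.card ≤ i + 1 := by
  induction i with
  | zero =>
    intro _ y FV FC hy hv hyF hc hk
    obtain ⟨ha, hw, hr⟩ := h0 y hy
    have hne : y ≠ v := fun e => hyF (e ▸ hv)
    refine ⟨_, _, RP.snoc (RP.nil v) ha (by simpa using hne) (by simp), ?_, ?_, ?_⟩
    · intro x hx; simp at hx; tauto
    · intro x hx; simp at hx; subst hx; exact ⟨hr, hc hy⟩
    · simp
  | succ i ih =>
    intro hi y FV FC hy hv hyF hc hk
    by_cases hyi : y ∈ L i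
    · obtain ⟨S, T, g1, g2, g3, g4⟩ := ih (by omega) y FV FC hyi hv hyF hc (by push_cast at hk; linarith)
      exact ⟨S, T, g1, g2, g3, by omega⟩
    let Z := (L i).filter fun z => Adj y z ∧ z ∈ W ∧ c y z ∈ R
    have hZ : k ≤ Z.card := h1 i (by omega) y hy hyi
    let Z1 := Z.filter fun z => z ∈ FV
    let Z2 := Z.filter fun z => c y z ∈ FC
    let Z3 := Z.filter fun z => Adj v z ∧ c v z ∈ FC
    have hz1 : Z1.card ≤ FV.card := Finset.card_le_card fun z hz => (Finset.mem_filter.1 hz).2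
    have hz2 : Z2.card ≤ FC.card := hP.card_col y Z2 FC fun z hz => by
      simp only [Z2, Z, Finset.mem_filter] at hz; exact ⟨hz.1.2.1, hz.2⟩
    have hz3 : Z3.card ≤ FC.card := hP.card_col v Z3 FC fun z hz => (Finset.mem_filter.1 hz).2
    obtain ⟨z, hz, hzn⟩ : ∃ z ∈ Z, z ∉ Z1 ∪ Z2 ∪ Z3 := by
      by_contra hcon
      push Not at hcon
      have h2 : Z.card ≤ (Z1 ∪ Z2 ∪ Z3).card := Finset.card_le_card hcon
      have h3 := Finset.card_union_le (Z1 ∪ Z2) Z3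
      have h4 := Finset.card_union_le Z1 Z2
      have h5 : Z.card ≤ FV.card + 2 * FC.card := by omega
      have h6 : (Z.card:ℝ) ≤ FV.card + 2 * FC.card := by exact_mod_cast h5
      push_cast at hk
      have : (0:ℝ) ≤ i := by positivity
      linarith
    have hz' := Finset.mem_filter.1 hz
    obtain ⟨hzL, hadj, hzW, hzR⟩ := hz'
    simp only [Finset.mem_union, not_or, Z1, Z2, Z3, Finset.mem_filter, hz, true_and] at hzn
    obtain ⟨⟨hzF, hzC⟩, hzv⟩ := hzn
    have hyv : y ≠ v := fun e => hyF (e ▸ hv)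
    have hzy : z ≠ y := fun e => hP.irrefl y (e ▸ hadj)
    obtain ⟨S, T, g1, g2, g3, g4⟩ := ih (by omega) z (insert y FV) (insert (c y z) FC) hzL
      (by simp [hv]) (by simp [hzy, hzF]) (by
        intro hz0
        have hvz := (h0 z hz0).1
        simp only [Finset.mem_insert, not_or]
        refine ⟨fun e => ?_, fun h => hzv ⟨hvz, h⟩⟩
        rw [hP.csymm _ _ hvz, hP.csymm _ _ hadj] at e
        exact hyv (hP.proper z v y (hP.symm _ _ hvz) (hP.symm _ _ hadj) e).symm) (by
        have a1 : ((insert y FV).card : ℝ) ≤ FV.card + 1 := by exact_mod_cast Finset.card_insert_le _ _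
        have a2 : ((insert (c y z) FC).card : ℝ) ≤ FC.card + 1 := by exact_mod_cast Finset.card_insert_le _ _
        push_cast at hk
        linarith)
    have e : c z y = c y z := (hP.csymm _ _ hadj).symm
    refine ⟨_, _, RP.snoc g1 (hP.symm _ _ hadj) ?_ ?_, ?_, ?_, ?_⟩
    · intro hyS
      rcases g2 y hyS with h | h | h
      · exact hyv h
      · exact hzy h.symm
      · exact h.2 (by simp)
    · intro hcT
      exact (g3 _ hcT).2 (by simp [e])
    · intro x hx
      rcases Finset.mem_insert.1 hx with rfl | hx
      · tauto
      · rcases g2 x hx with h | rfl | h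
        · exact Or.inl h
        · exact Or.inr (Or.inr ⟨hzW, hzF⟩)
        · refine Or.inr (Or.inr ⟨h.1, fun h' => h.2 (by simp [h'])⟩)
    · intro x hx
      rcases Finset.mem_insert.1 hx with rfl | hx
      · rw [e]; exact ⟨hzR, hzC⟩
      · exact ⟨(g3 x hx).1, fun h' => (g3 x hx).2 (by simp [h'])⟩
    · exact (Finset.card_insert_le _ _).trans (by omega)

theorem expsmall (A : ℝ) (p : ℕ) (a : ℝ) (ha : 0 < a) : ∃ d0 : ℕ, ∀ d : ℕ, d0 ≤ d →
    A * (d:ℝ)^p * Real.exp (-(a * d)) < 1 := by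
  have h := Real.tendsto_pow_mul_exp_neg_atTop_nhds_zero p
  have h2 : Filter.Tendsto (fun d : ℕ => a * (d:ℝ)) Filter.atTop Filter.atTop :=
    Filter.Tendsto.const_mul_atTop ha tendsto_natCast_atTop_atTop
  have h3 := (h.comp h2).const_mul (A / a^p)
  simp only [mul_zero] at h3
  have h4 := h3.eventually (gt_mem_nhds (show (0:ℝ) < 1 by norm_num))
  obtain ⟨d0, hd0⟩ := Filter.eventually_atTop.1 h4
  refine ⟨d0, fun d hd => ?_⟩
  have := hd0 d hd
  refine lt_of_eq_of_lt ?_ this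
  simp only [Function.comp]
  rw [mul_pow]
  field_simp

theorem linkall {V C : Type} {Adj : V → V → Prop} {c : V → V → C}
    {W U A : Finset V} {R : Finset C} {k : ℝ} {b : ℕ}
    (hA : ∀ x ∈ A, x ∈ U ∧ x ∉ W)
    (hlink : ∀ v ∈ U, ∀ y ∈ A, ∀ (FV : Finset V) (FC : Finset C), v ∈ FV → y ∉ FV →
      (FV.card : ℝ) + 2 * FC.card < k →
      ∃ S T, RP Adj c v y S T ∧ (∀ x ∈ S, x = v ∨ x = y ∨ (x ∈ W ∧ x ∉ FV)) ∧
        (∀ x ∈ T, x ∈ R ∧ x ∉ FC) ∧ T.card ≤ b)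
    {v0 u : V} {SQ : Finset V} {TQ : Finset C} (hQ : RP Adj c v0 u SQ TQ) (hu : u ∈ U)
    (hQA : ∀ x ∈ SQ, x ∉ A) {Q : Finset V} {s : V → V} {P : V → Finset V} {Co : V → Finset C}
    (hRP : ∀ t ∈ Q, RP Adj c (s t) t (P t) (Co t) ∧ P t ⊆ A ∧ ∀ x ∈ Co t, x ∉ R ∧ x ∉ TQ)
    (hdisj : ∀ t ∈ Q, ∀ t' ∈ Q, t ≠ t' → Disjoint (P t) (P t') ∧ Disjoint (Co t) (Co t'))
    (hk : (SQ.card : ℝ) + 1 + Q.card * (b + 1) + 2 * (TQ.card + Q.card * b) < k)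
    (Q' : Finset V) : Q' ⊆ Q → ∃ v ∈ U, ∃ S T, RP Adj c v0 v S T ∧
      (∀ x ∈ S, x ∈ A → ∃ t ∈ Q', x ∈ P t) ∧ (∀ x ∈ T, x ∈ R ∨ x ∈ TQ ∨ ∃ t ∈ Q', x ∈ Co t) ∧
      (S \ Q'.biUnion P).card ≤ SQ.card + Q'.card * (b + 1) ∧
      (T \ Q'.biUnion Co).card ≤ TQ.card + Q'.card * b ∧
      ∑ t ∈ Q', (Co t).card ≤ T.card := by
  induction Q' using Finset.induction_on with
  | empty =>
    intro _
    refine ⟨u, hu, SQ, TQ, hQ, fun x hx hxA => absurd hxA (hQA x hx), fun x hx => Or.inr (Or.inl hx),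
      by simp, by simp, by simp⟩
  | insert t Q' ht ih =>
    intro hQ'
    obtain ⟨v, hv, S, T, g1, g2, g3, g4, g5, g6⟩ := ih fun x hx => hQ' (by simp [hx])
    have htQ : t ∈ Q := hQ' (by simp)
    have hQ'c : Q'.card ≤ Q.card := Finset.card_le_card fun x hx => hQ' (by simp [hx])
    obtain ⟨p1, p2, p3⟩ := hRP t htQ
    have hdis : ∀ t' ∈ Q', Disjoint (P t) (P t') ∧ Disjoint (Co t) (Co t') := fun t' ht' =>
      hdisj t htQ t' (hQ' (by simp [ht'])) (fun e => ht (e ▸ ht'))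
    have hPS : ∀ x ∈ P t, x ∉ S := by
      intro x hx hxS
      obtain ⟨t', ht', hx'⟩ := g2 x hxS (p2 hx)
      exact Finset.disjoint_left.1 (hdis t' ht').1 hx hx'
    have hyP : s t ∈ P t := p1.start_mem
    have hyA : s t ∈ A := p2 hyP
    obtain ⟨S1, T1, l1, l2, l3, l4⟩ := hlink v hv (s t) hyA (insert v (S \ Q'.biUnion P))
      (T \ Q'.biUnion Co) (by simp) (by
        simp only [Finset.mem_insert, Finset.mem_sdiff, not_or, not_and_or]
        exact ⟨fun e => hPS _ hyP (e ▸ g1.end_mem), Or.inl (hPS _ hyP)⟩) (by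
        have a1 : ((insert v (S \ Q'.biUnion P)).card : ℝ) ≤ SQ.card + Q'.card * (b + 1) + 1 := by
          exact_mod_cast (Finset.card_insert_le _ _).trans (by omega)
        have a2 : ((T \ Q'.biUnion Co).card : ℝ) ≤ TQ.card + Q'.card * b := by exact_mod_cast g5
        have a3 : (Q'.card : ℝ) ≤ Q.card := by exact_mod_cast hQ'c
        have a4 : (Q'.card : ℝ) * b ≤ Q.card * b := by gcongr
        nlinarith)
    have hcW : ∀ x ∈ S, x ∉ insert v (S \ Q'.biUnion P) → x ∉ W := by
      intro x hxS hxF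
      have : x ∈ Q'.biUnion P := by
        by_contra h
        exact hxF (by simp only [Finset.mem_insert, Finset.mem_sdiff]; exact Or.inr ⟨hxS, h⟩)
      obtain ⟨t', ht', hx'⟩ := Finset.mem_biUnion.1 this
      exact (hA x ((hRP t' (hQ' (by simp [ht']))).2.1 hx')).2
    have hcR : ∀ x ∈ T, x ∉ T \ Q'.biUnion Co → x ∉ R := by
      intro x hxS hxF
      have : x ∈ Q'.biUnion Co := by
        by_contra h
        exact hxF (by simp only [Finset.mem_sdiff]; exact ⟨hxS, h⟩)
      obtain ⟨t', ht', hx'⟩ := Finset.mem_biUnion.1 this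
      exact ((hRP t' (hQ' (by simp [ht']))).2.2 x hx').1
    have r1 : RP Adj c v0 (s t) (S ∪ S1) (T ∪ T1) := by
      apply g1.append l1
      · intro x hx hxS
        rcases l2 x hx with h | rfl | h
        · exact h
        · exact absurd hxS (hPS _ hyP)
        · exact absurd h.1 (hcW x hxS h.2)
      · rw [Finset.disjoint_left]
        intro x hx hx1
        exact hcR x hx (l3 x hx1).2 (l3 x hx1).1
    have r2 : RP Adj c v0 t (S ∪ S1 ∪ P t) (T ∪ T1 ∪ Co t) := by
      apply r1.append p1
      · intro x hx hxS
        rcases Finset.mem_union.1 hxS with h | h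
        · exact absurd h (hPS x hx)
        · rcases l2 x h with rfl | h' | h'
          · exact absurd g1.end_mem (hPS x hx)
          · exact h'
          · exact absurd h'.1 (hA x (p2 hx)).2
      · rw [Finset.disjoint_right]
        intro x hx hxT
        rcases Finset.mem_union.1 hxT with h | h
        · rcases g3 x h with h' | h' | ⟨t', ht', h'⟩
          · exact (p3 x hx).1 h'
          · exact (p3 x hx).2 h'
          · exact Finset.disjoint_left.1 (hdis t' ht').2 hx h'
        · exact (p3 x hx).1 (l3 x h).1
    have hc1 := l1.card
    have hTd : Disjoint (Co t) T := by
      rw [Finset.disjoint_left]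
      intro x hx h
      rcases g3 x h with h' | h' | ⟨t', ht', h'⟩
      · exact (p3 x hx).1 h'
      · exact (p3 x hx).2 h'
      · exact Finset.disjoint_left.1 (hdis t' ht').2 hx h'
    refine ⟨t, (hA t (p2 p1.end_mem)).1, _, _, r2, ?_, ?_, ?_, ?_, ?_⟩
    · intro x hx hxA
      simp only [Finset.mem_union] at hx
      rcases hx with (h | h) | h
      · obtain ⟨t', ht', h'⟩ := g2 x h hxA
        exact ⟨t', by simp [ht'], h'⟩
      · rcases l2 x h with rfl | rfl | h'
        · obtain ⟨t', ht', h'⟩ := g2 x g1.end_mem hxA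
          exact ⟨t', by simp [ht'], h'⟩
        · exact ⟨t, by simp, hyP⟩
        · exact absurd h'.1 (hA x hxA).2
      · exact ⟨t, by simp, h⟩
    · intro x hx
      simp only [Finset.mem_union] at hx
      rcases hx with (h | h) | h
      · rcases g3 x h with h' | h' | ⟨t', ht', h'⟩
        · exact Or.inl h'
        · exact Or.inr (Or.inl h')
        · exact Or.inr (Or.inr ⟨t', by simp [ht'], h'⟩)
      · exact Or.inl (l3 x h).1
      · exact Or.inr (Or.inr ⟨t, by simp, h⟩)
    · rw [Finset.card_insert_of_notMem ht]
      have : (S ∪ S1 ∪ P t) \ (insert t Q').biUnion P ⊆ (S \ Q'.biUnion P) ∪ S1 := by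
        intro x hx
        simp only [Finset.mem_sdiff, Finset.mem_union, Finset.biUnion_insert] at hx ⊢
        tauto
      have h2 := (Finset.card_le_card this).trans (Finset.card_union_le _ _)
      nlinarith
    · rw [Finset.card_insert_of_notMem ht]
      have : (T ∪ T1 ∪ Co t) \ (insert t Q').biUnion Co ⊆ (T \ Q'.biUnion Co) ∪ T1 := by
        intro x hx
        simp only [Finset.mem_sdiff, Finset.mem_union, Finset.biUnion_insert] at hx ⊢
        tauto
      have h2 := (Finset.card_le_card this).trans (Finset.card_union_le _ _)
      nlinarith
    · rw [Finset.sum_insert ht]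
      have h2 : (Co t ∪ T).card ≤ (T ∪ T1 ∪ Co t).card := Finset.card_le_card (by
        intro x hx; simp only [Finset.mem_union] at hx ⊢; tauto)
      rw [Finset.card_union_of_disjoint hTd] at h2
      omega

theorem growA {V : Type} {Adj : V → V → Prop} {U : Finset V} {α β a0 z : ℝ} (hβ : 0 ≤ β)
    (ha0 : 0 < a0) (hz : 2 * z ≤ β * a0)
    (hU : ∀ u ∈ U, α + β * U.card ≤ (U.filter (Adj u)).card)
    (hmin : ∀ B ⊆ U, B.Nonempty → B.card < U.card → ∃ u ∈ B, ((B.filter (Adj u)).card : ℝ) < α + β * B.card)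
    {L : ℕ → Finset V} (hL0 : L 0 ⊆ U) (hL0c : a0 ≤ (L 0).card)
    (hL : ∀ i, L (i+1) = L i ∪ U.filter fun y => z ≤ ((L i).filter (Adj y)).card) (i : ℕ) :
    L i = U ∨ (L i ⊆ U ∧ a0 ≤ (L i).card ∧ i * z ≤ (L i).card) := by
  induction i with
  | zero => exact Or.inr ⟨hL0, hL0c, by simp⟩
  | succ i ih =>
    have hmono : L i ⊆ L (i+1) := by rw [hL i]; exact Finset.subset_union_left
    have hsub : L i ⊆ U → L (i+1) ⊆ U := by
      intro h; rw [hL i]; exact Finset.union_subset h (Finset.filter_subset _ _)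
    rcases ih with ih | ⟨h1, h2, h3⟩
    · left
      exact Finset.Subset.antisymm (hsub (by rw [ih])) (by rw [← ih]; exact hmono)
    · by_cases hE : L (i+1) = U
      · exact Or.inl hE
      right
      refine ⟨hsub h1, h2.trans (by exact_mod_cast Finset.card_le_card hmono), ?_⟩
      have hBne : (U \ L (i+1)).Nonempty := by
        rw [Finset.sdiff_nonempty]
        exact fun h => hE (Finset.Subset.antisymm (hsub h1) h)
      have hBc : ((U \ L (i+1)).card : ℝ) = U.card - (L (i+1)).card := by
        rw [Finset.card_sdiff_of_subset (hsub h1), Nat.cast_sub (Finset.card_le_card (hsub h1))]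
      have hLc : ((L i).card : ℝ) ≤ (L (i+1)).card := by exact_mod_cast Finset.card_le_card hmono
      have hlt : (U \ L (i+1)).card < U.card := by
        have : ((U \ L (i+1)).card : ℝ) < U.card := by rw [hBc]; linarith
        exact_mod_cast this
      obtain ⟨u, hu, hlow⟩ := hmin _ Finset.sdiff_subset hBne hlt
      obtain ⟨huU, huL⟩ := Finset.mem_sdiff.1 hu
      have hlow2 : (((L i).filter (Adj u)).card : ℝ) < z := by
        by_contra h
        push Not at h
        apply huL
        rw [hL i]
        exact Finset.mem_union_right _ (Finset.mem_filter.2 ⟨huU, h⟩)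
      have hcov : U.filter (Adj u) ⊆ ((U \ L (i+1)).filter (Adj u) ∪ (L i).filter (Adj u)) ∪ (L (i+1) \ L i) := by
        intro x hx
        simp only [Finset.mem_filter, Finset.mem_union, Finset.mem_sdiff] at hx ⊢
        tauto
      have h4 := Finset.card_le_card hcov
      have h5 := Finset.card_union_le ((U \ L (i+1)).filter (Adj u) ∪ (L i).filter (Adj u)) (L (i+1) \ L i)
      have h6 := Finset.card_union_le ((U \ L (i+1)).filter (Adj u)) ((L i).filter (Adj u))
      have h7 : ((U.filter (Adj u)).card : ℝ) ≤ ((U \ L (i+1)).filter (Adj u)).card +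
        ((L i).filter (Adj u)).card + (L (i+1) \ L i).card := by
        have := h4.trans (h5.trans (Nat.add_le_add_right h6 _))
        exact_mod_cast this
      have h8 : ((L (i+1) \ L i).card : ℝ) = (L (i+1)).card - (L i).card := by
        rw [Finset.card_sdiff_of_subset hmono, Nat.cast_sub (Finset.card_le_card hmono)]
      have h9 := hU u huU
      rw [hBc] at hlow
      push_cast
      nlinarith

theorem exists_nat_ge' (x : ℝ) : ∃ n : ℕ, ∀ d : ℕ, n ≤ d → x ≤ d := by
  obtain ⟨n, hn⟩ := exists_nat_ge x
  exact ⟨n, fun d hd => hn.trans (by exact_mod_cast hd)⟩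

/-- a shortest path into a set -/
theorem shortest_into {V C : Type} {Adj : V → V → Prop} {c : V → V → C} {v0 : V} {U : Finset V}
    (hne : U.Nonempty) {L : ℕ} (hreach : ∀ x, ∃ S T, RP Adj c v0 x S T ∧ T.card ≤ L) :
    ∃ u ∈ U, ∃ S T, RP Adj c v0 u S T ∧ T.card ≤ L ∧ ∀ x ∈ S, x ∈ U → x = u := by
  let p : ℕ → Prop := fun n => ∃ u ∈ U, ∃ S T, RP Adj c v0 u S T ∧ T.card = n
  obtain ⟨u0, hu0⟩ := hne
  obtain ⟨S0, T0, h0, hT0⟩ := hreach u0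
  have hp : ∃ n, p n := ⟨_, u0, hu0, S0, T0, h0, rfl⟩
  obtain ⟨u, hu, S, T, h, hT⟩ := Nat.find_spec hp
  refine ⟨u, hu, S, T, h, ?_, ?_⟩
  · rw [hT]
    exact (Nat.find_min' hp ⟨u0, hu0, S0, T0, h0, rfl⟩).trans hT0
  · intro x hx hxU
    by_contra hne
    obtain ⟨S', T', -, -, h3, h4⟩ := h.pre hx
    have := Nat.find_min' hp ⟨x, hxU, S', T', h3, rfl⟩
    have := h4 hne
    omega

set_option maxHeartbeats 4000000 in
theorem caseA (ε K M' : ℝ) (hε : 0 < ε) (hε1 : ε ≤ 1) (hK : 1 ≤ K) (hM : 1 ≤ M') (L p : ℕ) :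
    ∃ d0 : ℕ, ∀ d : ℕ, d0 ≤ d → ∀ (V C : Type) [Fintype V] [Fintype C] (Adj : V → V → Prop)
      (c : V → V → C), PG Adj c → (∀ v, ((Finset.univ.filter (Adj v)).card : ℝ) ≤ K * d) →
      ((Fintype.card V : ℝ) ≤ (d:ℝ)^p) →
      ∀ v0 : V, (∀ x, ∃ S T, RP Adj c v0 x S T ∧ T.card ≤ L) →
      ∀ U0 : Finset V, U0.Nonempty → (U0.card : ℝ) ≤ M' * d →
      (∀ u ∈ U0, (1 - ε / 16) * d ≤ (U0.filter (Adj u)).card) →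
      ∃ v S T, RP Adj c v0 v S T ∧ (1 - ε) * d ≤ T.card := by
  set ξ := ε / 16 with hξ
  have hξ0 : 0 < ξ := by positivity
  have hξ1 : ξ ≤ 1 / 16 := by rw [hξ]; linarith
  obtain ⟨r, hr⟩ := exists_nat_ge (16 * K / ξ)
  have hr0 : (0:ℝ) < r := lt_of_lt_of_le (by positivity) hr
  have hrN : 0 < r := by exact_mod_cast hr0
  have hr16 : 16 / r * K ≤ ξ := by
    rw [div_le_iff₀ hξ0] at hr
    rw [div_mul_eq_mul_div, div_le_iff₀ hr0]; linarith
  set δ : ℝ := 1 / (8 * r ^ 2) with hδ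
  have hδ0 : 0 < δ := by positivity
  have hδ1 : δ ≤ 1/8 := by
    rw [hδ]
    apply one_div_le_one_div_of_le (by norm_num)
    have : (1:ℝ) ≤ r := by exact_mod_cast hrN
    nlinarith
  set ζ : ℝ := ξ / M' * δ / 2 with hζ
  have hζ0 : 0 < ζ := by positivity
  have hζ1 : ζ ≤ 1/2 := by
    have : ξ / M' ≤ 1 := by rw [div_le_one (by linarith)]; linarith
    have : ξ / M' * δ ≤ 1 * (1/8) := by gcongr
    rw [hζ]; linarith
  obtain ⟨s, hs⟩ := exists_nat_gt (M' / ζ)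
  have hs' : M' < s * ζ := by rwa [div_lt_iff₀ hζ0] at hs
  obtain ⟨m, D0, hF⟩ := lemmaF ξ hξ0
  set k0 : ℝ := ζ / (4 * r ^ 2) with hk0
  have hk00 : 0 < k0 := by positivity
  obtain ⟨d1, hd1⟩ := expsmall (10 * ((s:ℝ) + 1)) (2 * p) k0 hk00
  obtain ⟨d2, hd2⟩ := exists_nat_ge' ((L + 2) / ξ)
  obtain ⟨d3, hd3⟩ := exists_nat_ge' ((((L:ℝ) + 1) + 1 + m * ((s + 1) + 1) + 2 * (L + m * (s + 1)) + 3 * s + 1) / k0)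
  obtain ⟨d4, hd4⟩ := exists_nat_ge' (2 * (D0 + 1))
  refine ⟨max (max d1 d2) (max d3 (max d4 1)), ?_⟩
  intro d hd V C _ _ Adj c hP hmax hcard v0 hreach U0 hU0 hU0c hU0d
  simp only [max_le_iff] at hd
  obtain ⟨⟨hda, hdb⟩, hdc, hdd, hde⟩ := hd
  replace hda := hd1 d hda
  replace hdb := hd2 d hdb
  replace hdc := hd3 d hdc
  replace hdd := hd4 d hdd
  rw [div_le_iff₀ hξ0] at hdb
  rw [div_le_iff₀ hk00] at hdc
  have hdpos : (0:ℝ) < d := by exact_mod_cast hde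
  -- minimal U
  set α : ℝ := (1 - 2 * ξ) * d with hα
  set β : ℝ := ξ / M' with hβ
  have hβ0 : 0 < β := by positivity
  let good : Finset V → Prop := fun U => U.Nonempty ∧ ∀ u ∈ U, α + β * U.card ≤ (U.filter (Adj u)).card
  have hgood0 : good U0 := by
    refine ⟨hU0, fun u hu => le_trans ?_ (hU0d u hu)⟩
    have : β * U0.card ≤ ξ * d := by
      calc β * U0.card ≤ β * (M' * d) := by gcongr
        _ = _ := by rw [hβ]; field_simp
    rw [hα]; nlinarith
  have hex : ∃ n, ∃ U, good U ∧ U.card = n := ⟨_, U0, hgood0, rfl⟩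
  obtain ⟨U, hUg, hUn⟩ := Nat.find_spec hex
  have hUmin : ∀ B, good B → U.card ≤ B.card := fun B hB => by
    rw [hUn]; exact Nat.find_min' hex ⟨B, hB, rfl⟩
  obtain ⟨hUne, hU⟩ := hUg
  have hUc : (U.card : ℝ) ≤ M' * d := le_trans (by exact_mod_cast hUmin U0 hgood0) hU0c
  have hUdeg : ∀ u ∈ U, (1 - 2 * ξ) * d ≤ (U.filter (Adj u)).card := fun u hu =>
    le_trans (by have : 0 ≤ β * U.card := by positivity
                 linarith) (hU u hu)
  have hUK : ∀ u, ((U.filter (Adj u)).card : ℝ) ≤ K * d := fun u =>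
    le_trans (by exact_mod_cast Finset.card_le_card (Finset.filter_subset_filter _ (Finset.subset_univ _))) (hmax u)
  -- sampling
  have hk0d : ζ * d / (4 * r ^ 2) = k0 * d := by rw [hk0]; ring
  obtain ⟨W, R, Ly, y1, y2, y3, y4, -, -, -, y8⟩ := layers hP U hrN (d / 2) (ζ * d) (by positivity)
    (by nlinarith) s (fun _ => ∅) (fun _ => ∅) (fun _ _ => ∅) (by simp) (by
      rw [hk0d]
      refine lt_of_le_of_lt ?_ hda
      gcongr
      rw [mul_comm 2 p, pow_mul]
      gcongr)
  have hhalf : ∀ u ∈ U, (d:ℝ) / 2 ≤ (U.filter (Adj u)).card := fun u hu => le_trans (by nlinarith) (hUdeg u hu)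
  have hLs : ∀ v ∈ U, Ly v s = U := by
    intro v hv
    rcases growA (z := ζ * d) (a0 := δ * d) hβ0.le (by positivity) (by rw [hζ]; apply le_of_eq; ring) hU (by
      intro B hB hBne hlt
      by_contra hcon
      push Not at hcon
      exact absurd (hUmin B ⟨hBne, hcon⟩) (by omega)) (L := Ly v) (fun z hz => (y1 v z hz).1) (by
      have := y2 v (hhalf v hv)
      refine le_trans (le_of_eq ?_) this
      rw [hδ]; field_simp; norm_num) (y3 v) s with h | ⟨h1, h2, h3⟩
    · exact h
    · exfalso
      have : ((Ly v s).card : ℝ) ≤ U.card := by exact_mod_cast Finset.card_le_card h1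
      nlinarith
  -- path into U
  obtain ⟨u, huU, SQ, TQ, hQ, hTQ, hQU⟩ := shortest_into hUne hreach
  let A := (U \ W).erase u
  let adj : V → V → Prop := fun x y => Adj x y ∧ c x y ∉ R ∧ c x y ∉ TQ
  have hLr : ((TQ.card : ℝ)) ≤ L := by exact_mod_cast hTQ
  have hdegA : ∀ x ∈ U, (1 - 4 * ξ) * d ≤ (A.filter (adj x)).card := by
    intro x hx
    have h1 := y8 x (hhalf x hx)
    have h2 : 16 / r * ((U.filter (Adj x)).card : ℝ) ≤ ξ * d := by
      calc 16 / r * ((U.filter (Adj x)).card : ℝ) ≤ 16 / r * (K * d) := by gcongr; exact hUK x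
        _ = (16 / r * K) * d := by ring
        _ ≤ _ := by gcongr
    let B := (U.filter (Adj x)).filter fun z => z ∈ W ∨ c x z ∈ R
    let Cc := (U.filter (Adj x)).filter fun z => c x z ∈ TQ
    have hCc : Cc.card ≤ TQ.card := hP.card_col x Cc TQ fun z hz => by
      simp only [Cc, Finset.mem_filter] at hz
      exact ⟨hz.1.2, hz.2⟩
    have hcov : U.filter (Adj x) ⊆ (A.filter (adj x) ∪ B) ∪ (Cc ∪ {u}) := by
      intro z hz
      simp only [A, B, Cc, adj, Finset.mem_filter, Finset.mem_union, Finset.mem_erase,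
        Finset.mem_sdiff, Finset.mem_singleton] at hz ⊢
      tauto
    have h4 := Finset.card_le_card hcov
    have h5 := Finset.card_union_le (A.filter (adj x) ∪ B) (Cc ∪ {u})
    have h6 := Finset.card_union_le (A.filter (adj x)) B
    have h7 := Finset.card_union_le Cc {u}
    rw [Finset.card_singleton] at h7
    have h8 : (U.filter (Adj x)).card ≤ (A.filter (adj x)).card + B.card + (TQ.card + 1) := by omega
    have h8' : ((U.filter (Adj x)).card : ℝ) ≤ (A.filter (adj x)).card + B.card + (TQ.card + 1) := by
      exact_mod_cast h8
    have h9 := hUdeg x hx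
    have h10 : (B.card : ℝ) ≤ ξ * d := h1.trans h2
    nlinarith
  have hAne : A.Nonempty := by
    have h1 := hdegA u huU
    have h2 : (0:ℝ) < (A.filter (adj u)).card := lt_of_lt_of_le (by nlinarith) h1
    have h3 : 0 < (A.filter (adj u)).card := by exact_mod_cast h2
    obtain ⟨x, hx⟩ := Finset.card_pos.1 h3
    exact ⟨x, Finset.mem_of_mem_filter _ hx⟩
  have hAU : ∀ x ∈ A, x ∈ U ∧ x ∉ W := by
    intro x hx
    simp only [A, Finset.mem_erase, Finset.mem_sdiff] at hx
    exact hx.2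
  have hD1 : ((⌊(1 - 4 * ξ) * d⌋₊ : ℕ) : ℝ) ≤ (1 - 4 * ξ) * d := Nat.floor_le (by nlinarith)
  have hD2 : (1 - 4 * ξ) * d < (⌊(1 - 4 * ξ) * d⌋₊ : ℕ) + 1 := Nat.lt_floor_add_one _
  obtain ⟨Q, st, P, Co, q1, q2, q3, q4⟩ := hF ⌊(1 - 4 * ξ) * d⌋₊ (by
      have : (D0 : ℝ) ≤ (⌊(1 - 4 * ξ) * d⌋₊ : ℕ) := by nlinarith
      exact_mod_cast this) V C adj c A hAne (by
      intro x hx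
      have h := hD1.trans (hdegA x (hAU x hx).1)
      rw [Nat.cast_le] at h
      convert h) (fun v w w' h1 h2 e => hP.proper v w w' h1.1 h2.1 e)
  have := linkall (k := k0 * d - 3 * s) (b := s + 1) hAU (by
      intro v hv y hy FV FC h1 h2 h3
      refine link hP (W := W) (R := R) (L := Ly v) (k := k0 * d) (s := s) (fun z hz => (y1 v z hz).2)
        (by intro i hi y hy hy'; rw [← hk0d]; exact y4 v i hi y hy hy') s (by omega) y FV FC ?_ h1 h2 ?_ (by linarith)
      · rw [hLs v hv]; exact (hAU y hy).1
      · intro h0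
        exact absurd (y1 v y h0).2.2.1 (hAU y hy).2) hQ huU (by
      intro x hx hxA
      have := hQU x hx (hAU x hxA).1
      subst this
      simp [A] at hxA) (Q := Q) (s := st) (P := P) (Co := Co) (by
      intro t ht
      obtain ⟨h1, h2⟩ := q2 t ht
      refine ⟨h1.mono fun x y _ _ h => h.1, h2, ?_⟩
      intro x hx
      obtain ⟨a, -, b, -, hab, rfl⟩ := h1.col hx
      exact hab.2) q3 (by
      have hSQ : (SQ.card : ℝ) = TQ.card + 1 := by exact_mod_cast hQ.card
      rw [hSQ, q1]
      push_cast
      linarith) Q subset_rfl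
  obtain ⟨v, -, S, T, g1, -, -, -, -, g6⟩ := this
  refine ⟨v, S, T, g1, ?_⟩
  have g6' : ∑ t ∈ Q, ((Co t).card : ℝ) ≤ T.card := by exact_mod_cast g6
  refine le_trans ?_ (q4.trans g6')
  have hξd : 2 ≤ ξ * d := by
    have : (0:ℝ) ≤ L := by positivity
    linarith
  have : ε = 16 * ξ := by rw [hξ]; ring
  rw [this]
  nlinarith

theorem dcount {V : Type} (r : V → V → Prop) (S Y : Finset V) :
    ∑ y ∈ Y, (S.filter (r y)).card = ∑ x ∈ S, (Y.filter fun y => r y x).card :=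
  Finset.sum_card_bipartiteAbove_eq_sum_card_bipartiteBelow r

theorem coreZ {V : Type} (h : V → V → Prop) (D : ℝ) (n : ℕ) : ∀ (X : Finset V), X.card = n →
    (∀ x ∈ X, ∀ y ∈ X, h x y → h y x) →
    (2 * D * X.card < ∑ x ∈ X, ((X.filter (h x)).card : ℝ)) →
    ∃ Z ⊆ X, Z.Nonempty ∧ ∀ z ∈ Z, D ≤ (Z.filter (h z)).card := by
  induction n with
  | zero =>
    intro X hX _ hlt
    rw [Finset.card_eq_zero] at hX
    subst hX
    simp at hlt
  | succ n ih =>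
    intro X hX hs hlt
    by_cases hall : ∀ z ∈ X, D ≤ (X.filter (h z)).card
    · exact ⟨X, subset_rfl, Finset.card_pos.1 (by omega), hall⟩
    push Not at hall
    obtain ⟨z, hz, hzD⟩ := hall
    obtain ⟨Z, h1, h2, h3⟩ := ih (X.erase z) (by rw [Finset.card_erase_of_mem hz, hX]; rfl)
      (fun x hx y hy => hs x (Finset.mem_of_mem_erase hx) y (Finset.mem_of_mem_erase hy)) (by
      have e1 : ((X.erase z).card : ℝ) = X.card - 1 := by
        rw [Finset.card_erase_of_mem hz, Nat.cast_sub (Finset.card_pos.2 ⟨z, hz⟩)]; simp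
      have e2 := Finset.add_sum_erase X (fun x => ((X.filter (h x)).card : ℝ)) hz
      have e3 : ∀ x ∈ X.erase z, ((X.filter (h x)).card : ℝ) ≤ ((X.erase z).filter (h x)).card + (if h x z then 1 else 0) := by
        intro x hx
        have : X.filter (h x) ⊆ (X.erase z).filter (h x) ∪ (if h x z then {z} else ∅) := by
          intro w hw
          rw [Finset.mem_filter] at hw
          by_cases hwz : w = z
          · subst hwz; simp [hw.2]
          · simp [hw, hwz]
        have h4 := (Finset.card_le_card this).trans (Finset.card_union_le _ _)
        have h5 : ((if h x z then {z} else ∅ : Finset V).card) = if h x z then 1 else 0 := by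
          split_ifs <;> simp
        rw [h5] at h4
        exact_mod_cast h4
      have e4 := Finset.sum_le_sum e3
      rw [Finset.sum_add_distrib] at e4
      have e5 : ∑ x ∈ X.erase z, (if h x z then (1:ℝ) else 0) ≤ (X.filter (h z)).card := by
        rw [← Finset.sum_filter, Finset.sum_const, nsmul_eq_mul, mul_one]
        norm_cast
        apply Finset.card_le_card
        intro x hx
        rw [Finset.mem_filter] at hx ⊢
        have hxX := Finset.mem_of_mem_erase hx.1
        exact ⟨hxX, hs x hxX z hz hx.2⟩
      rw [e1]
      linarith)
    exact ⟨Z, h1.trans (Finset.erase_subset _ _), h2, h3⟩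

/-- generic extension: X reachable, closed up to few -/
theorem reachExt {V C : Type} [Fintype V] {h : V → V → Prop} {c : V → V → C}
    (hprop : ∀ v w w', h v w → h v w' → c v w = c v w' → w = w')
    {y z : V} {S : Finset V} {T : Finset C} (hp : RP h c y z S T) (Z : Finset V)
    (hZ : 2 * T.card + 1 < (Z.filter (h z)).card) :
    ∃ w ∈ Z, ∃ S' T', RP h c y w S' T' ∧ T'.card = T.card + 1 := by
  let Z1 := (Z.filter (h z)).filter fun w => w ∈ S
  let Z2 := (Z.filter (h z)).filter fun w => c z w ∈ T
  have h1 : Z1.card ≤ S.card := Finset.card_le_card fun w hw => (Finset.mem_filter.1 hw).2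
  have h2 : Z2.card ≤ T.card := by
    apply Finset.card_le_card_of_injOn (c z)
    · intro x hx; exact (Finset.mem_filter.1 hx).2
    · intro x hx x' hx' e
      exact hprop z x x' (Finset.mem_filter.1 (Finset.mem_filter.1 hx).1).2 (Finset.mem_filter.1 (Finset.mem_filter.1 hx').1).2 e
  have h3 := hp.card
  have h4 := Finset.card_union_le Z1 Z2
  obtain ⟨w, hw, hw'⟩ : ∃ w ∈ Z.filter (h z), w ∉ Z1 ∪ Z2 := by
    by_contra hcon
    push Not at hcon
    have := Finset.card_le_card (show Z.filter (h z) ⊆ Z1 ∪ Z2 from hcon)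
    omega
  simp only [Finset.mem_union, not_or, Z1, Z2, Finset.mem_filter, not_and] at hw'
  have hw2 := Finset.mem_filter.1 hw
  have a1 := hw'.1 hw2
  have a2 := hw'.2 hw2
  refine ⟨w, hw2.1, _, _, RP.snoc hp hw2.2 a1 a2, ?_⟩
  rw [Finset.card_insert_of_notMem a2]

theorem longExt {V C : Type} [Fintype V] {h : V → V → Prop} {c : V → V → C}
    (hprop : ∀ v w w', h v w → h v w' → c v w = c v w' → w = w')
    (Y Z : Finset V) (hZ : ∃ y ∈ Y, ∃ z ∈ Z, ∃ S T, RP h c y z S T) (ℓ : ℕ)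
    (hd : ∀ z ∈ Z, 2 * ℓ + 1 < (Z.filter (h z)).card) :
    ∃ y ∈ Y, ∃ w S T, RP h c y w S T ∧ ℓ ≤ T.card := by
  by_contra hcon
  push Not at hcon
  have : ∀ n, ∃ y ∈ Y, ∃ z ∈ Z, ∃ S T, RP h c y z S T ∧ n ≤ T.card := by
    intro n
    induction n with
    | zero =>
      obtain ⟨y, hy, z, hz, S, T, g⟩ := hZ
      exact ⟨y, hy, z, hz, S, T, g, by omega⟩
    | succ n ih =>
      obtain ⟨y, hy, z, hz, S, T, g, hn⟩ := ih
      have h1 := hcon y hy z S T g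
      obtain ⟨w, hw, S', T', g', e⟩ := reachExt hprop g Z (by have := hd z hz; omega)
      exact ⟨y, hy, w, hw, S', T', g', by omega⟩
  obtain ⟨y, hy, z, hz, S, T, g, hn⟩ := this ℓ
  have := hcon y hy z S T g
  omega

set_option maxHeartbeats 1000000 in
theorem pieceE {ε K : ℝ} (hε : 0 < ε) (hε1 : ε ≤ 1) (hK : 1 ≤ K) {d ℓ : ℕ} (hd : 0 < d)
    (hℓ : 2 * (ℓ:ℝ) + 1 ≤ ε * d / 16) {V C : Type} [Fintype V] [Fintype C]
    {Adj : V → V → Prop} {c : V → V → C} (hP : PG Adj c)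
    (hmin : ∀ v, (d:ℝ) ≤ (Finset.univ.filter (Adj v)).card)
    (hmax : ∀ v, ((Finset.univ.filter (Adj v)).card : ℝ) ≤ K * d)
    {W : Finset V} {R : Finset C}
    (hWR : ∀ v, (((Finset.univ.filter (Adj v)).filter fun z => z ∈ W ∨ c v z ∈ R).card : ℝ) ≤ ε / 8 * d)
    {S : Finset V} {T : Finset C} (hS : (S.card : ℝ) ≤ d) (hT : (T.card : ℝ) ≤ (1 - ε) * d)
    {Y : Finset V} (hY : 20 * K ^ 2 / ε ^ 2 * d ≤ (Y.card : ℝ)) :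
    ∃ y ∈ Y, y ∉ S ∧ ∃ w S' T', RP Adj c y w S' T' ∧ (∀ x ∈ S', x ∉ S) ∧
      (∀ x ∈ S', x = y ∨ x ∉ W) ∧ (∀ x ∈ T', x ∉ R ∧ x ∉ T) ∧ ℓ ≤ T'.card := by
  have hd0 : (0:ℝ) < d := by exact_mod_cast hd
  have hf1 : ∀ (v : V) (A : Finset V), ((A.filter (Adj v)).card : ℝ) ≤ K * d := fun v A =>
    le_trans (by exact_mod_cast Finset.card_le_card (Finset.filter_subset_filter _ (Finset.subset_univ _))) (hmax v)
  -- edges to S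
  have hNS : ∀ A : Finset V, ∑ y ∈ A, ((S.filter (Adj y)).card : ℝ) ≤ K * d * d := by
    intro A
    have h1 := dcount Adj S A
    have h2 : ∑ y ∈ A, ((S.filter (Adj y)).card : ℝ) = ∑ x ∈ S, ((A.filter fun y => Adj y x).card : ℝ) := by
      exact_mod_cast h1
    rw [h2]
    calc ∑ x ∈ S, ((A.filter fun y => Adj y x).card : ℝ) ≤ ∑ x ∈ S, K * d := by
          apply Finset.sum_le_sum
          intro x _
          refine le_trans ?_ (hf1 x A)
          norm_cast
          apply Finset.card_le_card
          intro y hy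
          rw [Finset.mem_filter] at hy ⊢
          exact ⟨hy.1, hP.symm _ _ hy.2⟩
      _ = S.card * (K * d) := by rw [Finset.sum_const, nsmul_eq_mul]
      _ ≤ d * (K * d) := by gcongr
      _ = K * d * d := by ring
  let Y1 := Y.filter fun y => ε * d / 4 < (S.filter (Adj y)).card
  have hY1 : (Y1.card : ℝ) ≤ 4 * K / ε * d := by
    have h1 : ∑ y ∈ Y1, (ε * d / 4) ≤ ∑ y ∈ Y1, ((S.filter (Adj y)).card : ℝ) :=
      Finset.sum_le_sum fun y hy => (Finset.mem_filter.1 hy).2.le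
    have h2 := h1.trans (hNS Y1)
    rw [Finset.sum_const, nsmul_eq_mul] at h2
    have h3 : (Y1.card : ℝ) * ε ≤ 4 * K * d := by
      have : ((Y1.card : ℝ) * ε) * d ≤ (4 * K * d) * d := by linarith
      exact le_of_mul_le_mul_right this hd0
    rw [div_mul_eq_mul_div, le_div_iff₀ hε]; linarith
  let Y' := (Y \ Y1) \ S
  have hY'c : 13 * K ^ 2 / ε ^ 2 * d ≤ (Y'.card : ℝ) := by
    have h1 : Y ⊆ Y' ∪ Y1 ∪ S := by
      intro y hy
      simp only [Y', Finset.mem_union, Finset.mem_sdiff]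
      tauto
    have h2 := (Finset.card_le_card h1).trans (Finset.card_union_le _ _)
    have h3 := Finset.card_union_le Y' Y1
    have h4 : (Y.card : ℝ) ≤ Y'.card + Y1.card + S.card := by exact_mod_cast (by omega : Y.card ≤ Y'.card + Y1.card + S.card)
    have hq : 1 ≤ K / ε := by rw [le_div_iff₀ hε]; linarith
    have e1 : K ^ 2 / ε ^ 2 = (K / ε) ^ 2 := by rw [div_pow]
    have e2 : 4 * K / ε = 4 * (K / ε) := by ring
    have e3 : ∀ t : ℝ, t * K ^ 2 / ε ^ 2 = t * (K / ε) ^ 2 := fun t => by rw [← e1]; ring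
    rw [e3] at hY ⊢
    rw [e2] at hY1
    have h5 : K / ε ≤ (K / ε) ^ 2 := by nlinarith
    have h6 : (1 + 4 * (K / ε)) * d ≤ 5 * (K / ε) ^ 2 * d := by
      apply mul_le_mul_of_nonneg_right _ hd0.le
      nlinarith
    have h7 : 0 ≤ (K / ε) ^ 2 * d := by positivity
    linarith
  obtain ⟨h, hh⟩ : ∃ h : V → V → Prop, ∀ x y, h x y ↔ (Adj x y ∧ y ∉ W ∧ y ∉ S ∧ c x y ∉ R ∧ c x y ∉ T) := ⟨_, fun _ _ => Iff.rfl⟩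
  have hprop : ∀ v w w', h v w → h v w' → c v w = c v w' → w = w' := fun v w w' a b e =>
    hP.proper v w w' ((hh _ _).1 a).1 ((hh _ _).1 b).1 e
  have hdeg : ∀ x, 7 / 8 * ε * d - (S.filter (Adj x)).card ≤ ((Finset.univ.filter (h x)).card : ℝ) := by
    intro x
    let Bs := (Finset.univ.filter (Adj x)).filter fun z => z ∈ W ∨ c x z ∈ R
    let Cs := (Finset.univ.filter (Adj x)).filter fun z => c x z ∈ T
    have h1 : Finset.univ.filter (Adj x) ⊆ (Finset.univ.filter (h x) ∪ Bs) ∪ (Cs ∪ S.filter (Adj x)) := by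
      intro z hz
      simp only [Bs, Cs, hh, Finset.mem_union, Finset.mem_filter, Finset.mem_univ, true_and] at hz ⊢
      tauto
    have h2 : Cs.card ≤ T.card := hP.card_col x Cs T fun z hz => by
      simp only [Cs, Finset.mem_filter] at hz; exact ⟨hz.1.2, hz.2⟩
    have h3 := Finset.card_le_card h1
    have h4 := Finset.card_union_le (Finset.univ.filter (h x) ∪ Bs) (Cs ∪ S.filter (Adj x))
    have h5 := Finset.card_union_le (Finset.univ.filter (h x)) Bs
    have h6 := Finset.card_union_le Cs (S.filter (Adj x))
    have h7 : (Finset.univ.filter (Adj x)).card ≤ (Finset.univ.filter (h x)).card + Bs.card + T.card + (S.filter (Adj x)).card := by omega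
    have h8 : ((Finset.univ.filter (Adj x)).card : ℝ) ≤ (Finset.univ.filter (h x)).card + Bs.card + T.card + (S.filter (Adj x)).card := by exact_mod_cast h7
    have h9 := hmin x
    have h10 : (Bs.card : ℝ) ≤ ε / 8 * d := hWR x
    linarith
  suffices hmain : ∃ y ∈ Y', ∃ w S' T', RP h c y w S' T' ∧ ℓ ≤ T'.card by
    obtain ⟨y, hy, w, S', T', g, hl⟩ := hmain
    have hy' := Finset.mem_sdiff.1 hy
    have hv : ∀ x ∈ S', x = y ∨ (x ∉ W ∧ x ∉ S) := by
      clear hl hdeg hY hℓ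
      induction g with
      | nil => intro x hx; simp at hx; exact Or.inl hx
      | @snoc v w S T h hA hw hc ih =>
        intro x hx
        rcases Finset.mem_insert.1 hx with rfl | hx
        · have := (hh _ _).1 hA
          exact Or.inr ⟨this.2.1, this.2.2.1⟩
        · exact ih x hx
    refine ⟨y, (Finset.mem_sdiff.1 hy'.1).1, hy'.2, w, S', T', g.mono fun a b _ _ k => ((hh _ _).1 k).1, ?_, ?_, ?_, hl⟩
    · intro x hx
      rcases hv x hx with rfl | h
      · exact hy'.2
      · exact h.2
    · intro x hx
      rcases hv x hx with rfl | h
      · exact Or.inl rfl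
      · exact Or.inr h.1
    · intro x hx
      obtain ⟨a, -, b, -, hab, rfl⟩ := g.col hx
      exact ((hh _ _).1 hab).2.2.2
  by_contra hcon
  push Not at hcon
  let X := Finset.univ.filter fun x => ∃ y ∈ Y', ∃ S T, RP h c y x S T ∧ 0 < T.card
  have hXmem : ∀ x, x ∈ X ↔ ∃ y ∈ Y', ∃ S T, RP h c y x S T ∧ 0 < T.card := fun x => by simp [X]
  have hXout : ∀ x ∈ X, x ∉ W ∧ x ∉ S := by
    intro x hx
    obtain ⟨y, hy, S', T', g, hT'⟩ := (hXmem x).1 hx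
    cases g with
    | nil => simp at hT'
    | snoc g' hA hw hc =>
      have := (hh _ _).1 hA
      exact ⟨this.2.1, this.2.2.1⟩
  have hYX : ∀ y ∈ Y', Finset.univ.filter (h y) ⊆ X.filter (Adj y) := by
    intro y hy z hz
    rw [Finset.mem_filter] at hz ⊢
    have hA := ((hh _ _).1 hz.2).1
    have hne : z ≠ y := fun e => hP.irrefl y (by rw [e] at hA; exact hA)
    refine ⟨(hXmem z).2 ⟨y, hy, _, _, RP.snoc (RP.nil y) hz.2 (by simpa using hne) (by simp), by simp⟩, hA⟩
  have hXc : 8 * K / ε * d ≤ (X.card : ℝ) := by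
    have h1 : ∑ y ∈ Y', (5 / 8 * ε * d) ≤ ∑ y ∈ Y', ((X.filter (Adj y)).card : ℝ) := by
      apply Finset.sum_le_sum
      intro y hy
      have h2 : ((Finset.univ.filter (h y)).card : ℝ) ≤ (X.filter (Adj y)).card := by
        exact_mod_cast Finset.card_le_card (hYX y hy)
      have h3 : ((S.filter (Adj y)).card : ℝ) ≤ ε * d / 4 := by
        have hy' := Finset.mem_sdiff.1 (Finset.mem_sdiff.1 hy).1
        by_contra hc
        push Not at hc
        exact hy'.2 (Finset.mem_filter.2 ⟨hy'.1, hc⟩)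
      have := hdeg y
      linarith
    have h2 : ∑ y ∈ Y', ((X.filter (Adj y)).card : ℝ) = ∑ x ∈ X, ((Y'.filter fun y => Adj y x).card : ℝ) := by
      exact_mod_cast dcount Adj X Y'
    have h3 : ∑ x ∈ X, ((Y'.filter fun y => Adj y x).card : ℝ) ≤ ∑ x ∈ X, K * d := by
      apply Finset.sum_le_sum
      intro x _
      refine le_trans ?_ (hf1 x Y')
      norm_cast
      apply Finset.card_le_card
      intro y hy
      rw [Finset.mem_filter] at hy ⊢
      exact ⟨hy.1, hP.symm _ _ hy.2⟩
    rw [h2] at h1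
    have h4 := h1.trans h3
    rw [Finset.sum_const, nsmul_eq_mul, Finset.sum_const, nsmul_eq_mul] at h4
    have h5 : (Y'.card : ℝ) * (5 / 8 * ε) ≤ X.card * K := by
      have : ((Y'.card : ℝ) * (5 / 8 * ε)) * d ≤ (X.card * K) * d := by linarith
      exact le_of_mul_le_mul_right this hd0
    have h6 : 13 * K ^ 2 / ε ^ 2 * d * (5 / 8 * ε) ≤ X.card * K := le_trans (by gcongr) h5
    have h7 : 13 * K ^ 2 / ε ^ 2 * d * (5 / 8 * ε) = (65 / 8 * K / ε * d) * K := by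
      field_simp; ring
    rw [h7] at h6
    have h8 := le_of_mul_le_mul_right h6 (by linarith)
    refine le_trans ?_ h8
    gcongr
    norm_num
  have hXpos : (0:ℝ) < X.card := lt_of_lt_of_le (by positivity) hXc
  have hXdeg : ∀ x ∈ X, ((Finset.univ.filter (h x)).card : ℝ) ≤ (X.filter (h x)).card + ε * d / 16 := by
    intro x hx
    obtain ⟨y, hy, S', T', g, hT'⟩ := (hXmem x).1 hx
    have hlt := hcon y hy x S' T' g
    let Z := Finset.univ.filter (h x) \ X
    have h1 : (Z.filter (h x)).card ≤ 2 * T'.card + 1 := by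
      by_contra hc
      push Not at hc
      obtain ⟨w, hw, S2, T2, g2, e2⟩ := reachExt hprop g Z hc
      exact (Finset.mem_sdiff.1 hw).2 ((hXmem w).2 ⟨y, hy, S2, T2, g2, by omega⟩)
    have h2 : Finset.univ.filter (h x) ⊆ X.filter (h x) ∪ Z.filter (h x) := by
      intro z hz
      have := (Finset.mem_filter.1 hz).2
      by_cases hzX : z ∈ X
      · exact Finset.mem_union_left _ (Finset.mem_filter.2 ⟨hzX, this⟩)
      · exact Finset.mem_union_right _ (Finset.mem_filter.2 ⟨Finset.mem_sdiff.2 ⟨hz, hzX⟩, this⟩)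
    have h3 := (Finset.card_le_card h2).trans (Finset.card_union_le _ _)
    have h4 : (Finset.univ.filter (h x)).card ≤ (X.filter (h x)).card + (2 * ℓ + 1) := by omega
    have h5 : ((Finset.univ.filter (h x)).card : ℝ) ≤ (X.filter (h x)).card + (2 * ℓ + 1) := by exact_mod_cast h4
    linarith
  obtain ⟨Z, hZX, hZne, hZd⟩ := coreZ h (ε * d / 4) X.card X rfl (by
    intro x hx y hy hxy
    have h1 := (hh _ _).1 hxy
    have h2 := hXout x hx
    rw [hh, ← hP.csymm _ _ h1.1]
    exact ⟨hP.symm _ _ h1.1, h2.1, h2.2, h1.2.2.2⟩) (by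
    have h1 : ∑ x ∈ X, (7 / 8 * ε * d - (S.filter (Adj x)).card - ε * d / 16) ≤ ∑ x ∈ X, ((X.filter (h x)).card : ℝ) := by
      apply Finset.sum_le_sum
      intro x hx
      have := hdeg x
      have := hXdeg x hx
      linarith
    refine lt_of_lt_of_le ?_ h1
    rw [Finset.sum_sub_distrib, Finset.sum_sub_distrib, Finset.sum_const, Finset.sum_const, nsmul_eq_mul, nsmul_eq_mul]
    have h2 := hNS X
    have h3 : 8 * K * d ≤ X.card * ε := by
      rw [div_mul_eq_mul_div, div_le_iff₀ hε] at hXc; linarith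
    have h4 : 8 * K * d * d ≤ X.card * ε * d := by gcongr
    have h5 : 0 < X.card * ε * d := by positivity
    linarith)
  have hZr : ∃ y ∈ Y', ∃ z ∈ Z, ∃ S T, RP h c y z S T := by
    obtain ⟨z, hz⟩ := hZne
    obtain ⟨y, hy, S', T', g, -⟩ := (hXmem z).1 (hZX hz)
    exact ⟨y, hy, z, hz, S', T', g⟩
  obtain ⟨y, hy, w, S', T', g, hl⟩ := longExt hprop Y' Z hZr ℓ (by
    intro z hz
    have h1 := hZd z hz
    have h2 : (2 * (ℓ:ℝ) + 1) < (Z.filter (h z)).card := by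
      have : 0 < ε * d := by positivity
      linarith
    exact_mod_cast h2)
  have := hcon y hy w S' T' g
  omega

noncomputable def Low {V : Type} [Fintype V] (Adj : V → V → Prop) (t : ℝ) (S : Finset V) (x : V) : Finset V :=
  (Finset.univ.filter (Adj x)).filter fun y => y ∉ S ∧ ((S.filter (Adj y)).card : ℝ) < t

noncomputable def LowX {V : Type} [Fintype V] (Adj : V → V → Prop) (t q : ℝ) (S : Finset V) : Finset V :=
  S.filter fun x => q ≤ (Low Adj t S x).card

theorem dich {K ξ δ M' ζ κ : ℝ} (hK : 1 ≤ K) (hξ : 0 < ξ) (hδ : 0 < δ) (hδξ : δ ≤ ξ) (hM : 1 ≤ M')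
    (hζ : ζ = ξ * δ / (8 * K)) (hκ : κ = ξ * δ / (16 * K * M'))
    {d : ℕ} (hd : 0 < d) {V C : Type} [Fintype V] {Adj : V → V → Prop} {c : V → V → C} (hP : PG Adj c)
    (hmin : ∀ v, (d:ℝ) ≤ (Finset.univ.filter (Adj v)).card)
    (hmax : ∀ v, ((Finset.univ.filter (Adj v)).card : ℝ) ≤ K * d)
    (hno : ∀ U0 : Finset V, U0.Nonempty → (U0.card : ℝ) ≤ M' * d →
      ∃ u ∈ U0, ((U0.filter (Adj u)).card : ℝ) < (1 - ξ) * d)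
    {t : ℝ} {S : Finset V} (hS1 : δ * d ≤ S.card) (hS2 : (S.card : ℝ) ≤ M' * d)
    (hT : ((Finset.univ.filter fun y => y ∉ S ∧ t ≤ ((S.filter (Adj y)).card : ℝ)).card : ℝ) ≤ ζ * d) :
    κ * d ≤ (LowX Adj t (κ * d) S).card := by
  have hd0 : (0:ℝ) < d := by exact_mod_cast hd
  have hκ0 : 0 < κ := by rw [hκ]; positivity
  set T := Finset.univ.filter fun y => y ∉ S ∧ t ≤ ((S.filter (Adj y)).card : ℝ) with hTd
  let B := S.filter fun x => ξ * d / 2 ≤ ((Finset.univ.filter (Adj x) \ S).card : ℝ)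
  have hB : δ * d / 2 ≤ B.card := by
    by_contra hc
    push Not at hc
    have hBS : B ⊆ S := Finset.filter_subset _ _
    have hne : (S \ B).Nonempty := by
      rw [Finset.sdiff_nonempty]
      intro hsub
      have h1 : (S.card : ℝ) ≤ B.card := by exact_mod_cast Finset.card_le_card hsub
      have : 0 < δ * d := by positivity
      linarith
    obtain ⟨u, hu, hlt⟩ := hno (S \ B) hne (le_trans (by exact_mod_cast Finset.card_le_card Finset.sdiff_subset) hS2)
    have hu' := Finset.mem_sdiff.1 hu
    have h1 : ((Finset.univ.filter (Adj u) \ S).card : ℝ) < ξ * d / 2 := by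
      by_contra hc2
      push Not at hc2
      exact hu'.2 (Finset.mem_filter.2 ⟨hu'.1, hc2⟩)
    have h2 : Finset.univ.filter (Adj u) ⊆ ((S \ B).filter (Adj u) ∪ (Finset.univ.filter (Adj u) \ S)) ∪ B := by
      intro z hz
      simp only [Finset.mem_union, Finset.mem_filter, Finset.mem_sdiff, Finset.mem_univ, true_and] at hz ⊢
      tauto
    have h3 := (Finset.card_le_card h2).trans (Finset.card_union_le _ _)
    have h4 := Finset.card_union_le ((S \ B).filter (Adj u)) (Finset.univ.filter (Adj u) \ S)
    have h5 : ((Finset.univ.filter (Adj u)).card : ℝ) ≤ ((S \ B).filter (Adj u)).card + (Finset.univ.filter (Adj u) \ S).card + B.card := by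
      exact_mod_cast (by omega : (Finset.univ.filter (Adj u)).card ≤ ((S \ B).filter (Adj u)).card + (Finset.univ.filter (Adj u) \ S).card + B.card)
    have h6 := hmin u
    have h7 : δ * d ≤ ξ * d := by gcongr
    linarith
  have e1 : ξ * δ * d * d / 4 ≤ ∑ x ∈ S, ((Finset.univ.filter (Adj x) \ S).card : ℝ) := by
    calc ξ * δ * d * d / 4 = (δ * d / 2) * (ξ * d / 2) := by ring
      _ ≤ B.card * (ξ * d / 2) := by gcongr
      _ = ∑ x ∈ B, (ξ * d / 2) := by rw [Finset.sum_const, nsmul_eq_mul]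
      _ ≤ ∑ x ∈ B, ((Finset.univ.filter (Adj x) \ S).card : ℝ) := Finset.sum_le_sum fun x hx => (Finset.mem_filter.1 hx).2
      _ ≤ _ := Finset.sum_le_sum_of_subset_of_nonneg (Finset.filter_subset _ _) (by intros; positivity)
  have e2 : ∑ x ∈ S, ((Finset.univ.filter (Adj x) \ S).card : ℝ) ≤
      ∑ x ∈ S, ((Low Adj t S x).card : ℝ) + ∑ x ∈ S, ((T.filter (Adj x)).card : ℝ) := by
    rw [← Finset.sum_add_distrib]
    apply Finset.sum_le_sum
    intro x _
    have : Finset.univ.filter (Adj x) \ S ⊆ Low Adj t S x ∪ T.filter (Adj x) := by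
      intro z hz
      simp only [Low, hTd, Finset.mem_union, Finset.mem_filter, Finset.mem_sdiff, Finset.mem_univ, true_and] at hz ⊢
      rcases lt_or_ge ((S.filter (Adj z)).card : ℝ) t with h | h
      · exact Or.inl ⟨hz.1, hz.2, h⟩
      · exact Or.inr ⟨⟨hz.2, h⟩, hz.1⟩
    exact_mod_cast (Finset.card_le_card this).trans (Finset.card_union_le _ _)
  have e3 : ∑ x ∈ S, ((T.filter (Adj x)).card : ℝ) ≤ ξ * δ * d * d / 8 := by
    have h1 : ∑ y ∈ S, ((T.filter (Adj y)).card : ℝ) = ∑ x ∈ T, ((S.filter fun y => Adj y x).card : ℝ) := by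
      exact_mod_cast dcount Adj T S
    rw [h1]
    calc ∑ x ∈ T, ((S.filter fun y => Adj y x).card : ℝ) ≤ ∑ x ∈ T, K * d := by
          apply Finset.sum_le_sum
          intro x _
          refine le_trans ?_ (hmax x)
          norm_cast
          apply Finset.card_le_card
          intro y hy
          rw [Finset.mem_filter] at hy ⊢
          exact ⟨Finset.mem_univ _, hP.symm _ _ hy.2⟩
      _ = T.card * (K * d) := by rw [Finset.sum_const, nsmul_eq_mul]
      _ ≤ ζ * d * (K * d) := by gcongr
      _ = _ := by rw [hζ]; field_simp
  have e4 : ∑ x ∈ S, ((Low Adj t S x).card : ℝ) ≤ (LowX Adj t (κ * d) S).card * (K * d) + S.card * (κ * d) := by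
    calc ∑ x ∈ S, ((Low Adj t S x).card : ℝ) ≤ ∑ x ∈ S, ((if κ * d ≤ (Low Adj t S x).card then K * d else 0) + κ * d) := by
          apply Finset.sum_le_sum
          intro x _
          have h0 : ((Low Adj t S x).card : ℝ) ≤ K * d := le_trans (by
            exact_mod_cast Finset.card_le_card (Finset.filter_subset _ _)) (hmax x)
          have : 0 ≤ κ * d := by positivity
          split_ifs with h
          · linarith
          · push Not at h; linarith
      _ = _ := by
          rw [Finset.sum_add_distrib, ← Finset.sum_filter, Finset.sum_const, Finset.sum_const, nsmul_eq_mul, nsmul_eq_mul, LowX]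
  have e5 : S.card * (κ * d) ≤ ξ * δ * d * d / 16 := by
    calc S.card * (κ * d) ≤ M' * d * (κ * d) := by gcongr
      _ = (ξ * δ * d * d / 16) / K := by rw [hκ]; field_simp
      _ ≤ _ := div_le_self (by positivity) hK
  have e6 : ξ * δ * d * d / 16 ≤ (LowX Adj t (κ * d) S).card * (K * d) := by linarith
  have e7 : κ * d ≤ ξ * δ * d / 16 / K := by
    rw [hκ]
    calc ξ * δ / (16 * K * M') * d = ξ * δ * d / 16 / K / M' := by field_simp
      _ ≤ _ := div_le_self (by positivity) hM
  refine e7.trans ?_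
  rw [div_le_iff₀ (by linarith)]
  have : (ξ * δ * d / 16) * d ≤ ((LowX Adj t (κ * d) S).card * K) * d := by linarith
  exact le_of_mul_le_mul_right this hd0

theorem growB {K ξ δ M' ζ κ : ℝ} (hK : 1 ≤ K) (hξ : 0 < ξ) (hδ : 0 < δ) (hδξ : δ ≤ ξ) (hM : 1 ≤ M')
    (hζ : ζ = ξ * δ / (8 * K)) (hκ : κ = ξ * δ / (16 * K * M'))
    {d : ℕ} (hd : 0 < d) {V C : Type} [Fintype V] {Adj : V → V → Prop} {c : V → V → C} (hP : PG Adj c)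
    (hmin : ∀ v, (d:ℝ) ≤ (Finset.univ.filter (Adj v)).card)
    (hmax : ∀ v, ((Finset.univ.filter (Adj v)).card : ℝ) ≤ K * d)
    (hno : ∀ U0 : Finset V, U0.Nonempty → (U0.card : ℝ) ≤ M' * d →
      ∃ u ∈ U0, ((U0.filter (Adj u)).card : ℝ) < (1 - ξ) * d)
    {t : ℝ} {L : ℕ → Finset V} (h0 : δ * d ≤ (L 0).card)
    (hL : ∀ i, L (i+1) = L i ∪ Finset.univ.filter fun y => t ≤ ((L i).filter (Adj y)).card)
    {s : ℕ} (hs : M' < s * ζ) :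
    ∃ i ≤ s, M' * d < (L i).card ∨ κ * d ≤ (LowX Adj t (κ * d) (L i)).card := by
  have hd0 : (0:ℝ) < d := by exact_mod_cast hd
  by_contra hcon
  push Not at hcon
  have key : ∀ i, i ≤ s → δ * d + i * (ζ * d) ≤ (L i).card := by
    intro i
    induction i with
    | zero => intro _; simpa using h0
    | succ i ih =>
      intro hi
      have h1 := ih (by omega)
      obtain ⟨h2, h3⟩ := hcon i (by omega)
      have hζ0 : 0 < ζ := by rw [hζ]; positivity
      have h4 : ζ * d < ((Finset.univ.filter fun y => y ∉ L i ∧ t ≤ (((L i).filter (Adj y)).card : ℝ)).card : ℝ) := by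
        by_contra hc
        push Not at hc
        have : 0 ≤ (i:ℝ) * (ζ * d) := by positivity
        have := dich hK hξ hδ hδξ hM hζ hκ hd hP hmin hmax hno (by linarith) h2 hc
        linarith
      have h5 : L i ∪ (Finset.univ.filter fun y => y ∉ L i ∧ t ≤ (((L i).filter (Adj y)).card : ℝ)) ⊆ L (i+1) := by
        rw [hL i]
        intro y hy
        simp only [Finset.mem_union, Finset.mem_filter, Finset.mem_univ, true_and] at hy ⊢
        tauto
      have h6 := Finset.card_le_card h5
      rw [Finset.card_union_of_disjoint (by
        rw [Finset.disjoint_left]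
        intro y hy hy'
        exact (Finset.mem_filter.1 hy').2.1 hy)] at h6
      have h7 : ((L i).card : ℝ) + ((Finset.univ.filter fun y => y ∉ L i ∧ t ≤ (((L i).filter (Adj y)).card : ℝ)).card : ℝ) ≤ (L (i+1)).card := by
        exact_mod_cast h6
      push_cast
      linarith
  have h1 := key s le_rfl
  have h2 := (hcon s le_rfl).1
  have : 0 < δ * d := by positivity
  have h3 : M' * d < s * ζ * d := by gcongr
  linarith

theorem reachB {V C : Type} [Fintype V] {Adj : V → V → Prop} {c : V → V → C}
    (hP : PG Adj c) {W : Finset V} {R : Finset C} {L : ℕ → Finset V} {v : V} {k : ℝ} {s : ℕ}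
    (h0 : ∀ z ∈ L 0, Adj v z ∧ z ∈ W ∧ c v z ∈ R)
    (h1 : ∀ i ≤ s, ∀ y ∈ L (i+1), y ∉ L i →
      k ≤ ((L i).filter fun z => Adj y z ∧ z ∈ W ∧ c y z ∈ R).card)
    {i : ℕ} (hi : i ≤ s) {m mm t q q' : ℝ} (ht : 0 < t) (hq' : 0 ≤ q')
    (hcase : mm < (L i).card ∨ q ≤ (LowX Adj t q (L i)).card)
    (hX : q ≤ (LowX Adj t q (L i)).card → q' ≤ ((LowX Adj t q (L i)).filter fun z => z ∈ W).card)
    (hLw : ∀ x, q ≤ (Low Adj t (L i) x).card → q' ≤ ((Low Adj t (L i) x).filter fun z => z ∈ W ∧ c x z ∈ R).card)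
    {FV : Finset V} {FC : Finset C} (hv : v ∈ FV)
    (hk : (FV.card : ℝ) + 2 * FC.card + 3 * s + 3 < k)
    (hF : (FV.card : ℝ) + FC.card ≤ q' / 2)
    (hm : m + FV.card + FC.card ≤ mm) (hmt : m * t ≤ (q' / 2) ^ 2) :
    ∃ Y : Finset V, m ≤ Y.card ∧ ∀ y ∈ Y, ∃ S T, RP Adj c v y S T ∧
      (∀ x ∈ S, x = v ∨ x = y ∨ (x ∈ W ∧ x ∉ FV)) ∧ (∀ x ∈ T, x ∈ R ∧ x ∉ FC) ∧ T.card ≤ s + 2 := by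
  have hir : (i:ℝ) ≤ s := by exact_mod_cast hi
  rcases hcase with hbig | hlow
  · let B := (L i).filter fun y => Adj v y ∧ c v y ∈ FC
    have hB : B.card ≤ FC.card := hP.card_col v B FC fun z hz => (Finset.mem_filter.1 hz).2
    let Y := ((L i) \ FV) \ B
    refine ⟨Y, ?_, ?_⟩
    · have hs : L i ⊆ Y ∪ FV ∪ B := by
        intro y hy
        simp only [Y, Finset.mem_union, Finset.mem_sdiff]
        tauto
      have a1 := (Finset.card_le_card hs).trans (Finset.card_union_le _ _)
      have a2 := Finset.card_union_le Y FV
      have a3 : ((L i).card : ℝ) ≤ Y.card + FV.card + FC.card := by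
        exact_mod_cast (by omega : (L i).card ≤ Y.card + FV.card + FC.card)
      linarith
    · intro y hy
      have hy1 := Finset.mem_sdiff.1 hy
      have hy2 := Finset.mem_sdiff.1 hy1.1
      obtain ⟨S, T, g1, g2, g3, g4⟩ := link hP h0 h1 i (by omega) y FV FC hy2.1 hv hy2.2 (by
        intro hy0 hc
        exact hy1.2 (Finset.mem_filter.2 ⟨hy2.1, (h0 y hy0).1, hc⟩)) (by linarith)
      exact ⟨S, T, g1, g2, g3, by omega⟩
  · have hX := hX hlow
    let X0 := (LowX Adj t q (L i)).filter fun z => z ∈ W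
    let X1 := X0.filter fun x => Adj v x ∧ c v x ∈ FC
    let X := (X0 \ FV) \ X1
    have hX1 : X1.card ≤ FC.card := hP.card_col v X1 FC fun z hz => (Finset.mem_filter.1 hz).2
    have hXc : q' / 2 ≤ X.card := by
      have hs : X0 ⊆ X ∪ FV ∪ X1 := by
        intro y hy
        simp only [X, Finset.mem_union, Finset.mem_sdiff]
        tauto
      have a1 := (Finset.card_le_card hs).trans (Finset.card_union_le _ _)
      have a2 := Finset.card_union_le X FV
      have a3 : (X0.card : ℝ) ≤ X.card + FV.card + FC.card := by
        exact_mod_cast (by omega : X0.card ≤ X.card + FV.card + FC.card)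
      have a4 : q' ≤ X0.card := hX
      linarith
    obtain ⟨G, hG⟩ : ∃ G : V → V → Prop, ∀ x y, G x y ↔ (y ∈ Low Adj t (L i) x ∧ c x y ∈ R ∧ c x y ∉ FC ∧ y ∉ FV) :=
      ⟨_, fun _ _ => Iff.rfl⟩
    have hGA : ∀ x y, G x y → Adj x y ∧ y ∉ L i ∧ (((L i).filter (Adj y)).card : ℝ) < t := by
      intro x y h
      have := ((hG x y).1 h).1
      simp only [Low, Finset.mem_filter, Finset.mem_univ, true_and] at this
      exact this
    have hXm : ∀ x ∈ X, x ∈ L i ∧ q ≤ (Low Adj t (L i) x).card ∧ x ∈ W ∧ x ∉ FV ∧ ¬ (Adj v x ∧ c v x ∈ FC) := by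
      intro x hx
      simp only [X, X1, X0, LowX, Finset.mem_sdiff, Finset.mem_filter] at hx
      tauto
    have hYs : ∀ x ∈ X, q' / 2 ≤ ((Finset.univ.filter (G x)).card : ℝ) := by
      intro x hx
      have b1 := hLw x (hXm x hx).2.1
      let Z := (Low Adj t (L i) x).filter fun z => z ∈ W ∧ c x z ∈ R
      let Z1 := Z.filter fun z => c x z ∈ FC
      have hZ1 : Z1.card ≤ FC.card := hP.card_col x Z1 FC fun z hz => by
        simp only [Z1, Z, Low, Finset.mem_filter] at hz
        exact ⟨hz.1.1.1.2, hz.2⟩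
      have hs : Z ⊆ Finset.univ.filter (G x) ∪ FV ∪ Z1 := by
        intro z hz
        have hz' := Finset.mem_filter.1 hz
        simp only [Finset.mem_union, Z1, Finset.mem_filter, Finset.mem_univ, true_and, hG]
        tauto
      have a1 := (Finset.card_le_card hs).trans (Finset.card_union_le _ _)
      have a2 := Finset.card_union_le (Finset.univ.filter (G x)) FV
      have a3 : (Z.card : ℝ) ≤ (Finset.univ.filter (G x)).card + FV.card + FC.card := by
        exact_mod_cast (by omega : Z.card ≤ (Finset.univ.filter (G x)).card + FV.card + FC.card)
      have a4 : q' ≤ Z.card := b1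
      linarith
    let Y := Finset.univ.filter fun y => ∃ x ∈ X, G x y
    have hYm : ∀ y, y ∈ Y ↔ ∃ x ∈ X, G x y := fun y => by simp [Y]
    refine ⟨Y, ?_, ?_⟩
    · have c1 : (q' / 2) ^ 2 ≤ ∑ x ∈ X, ((Y.filter (G x)).card : ℝ) := by
        calc (q' / 2) ^ 2 = (q' / 2) * (q' / 2) := by ring
          _ ≤ X.card * (q' / 2) := by gcongr
          _ = ∑ x ∈ X, (q' / 2) := by rw [Finset.sum_const, nsmul_eq_mul]
          _ ≤ _ := by
            apply Finset.sum_le_sum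
            intro x hx
            refine (hYs x hx).trans ?_
            norm_cast
            apply Finset.card_le_card
            intro y hy
            rw [Finset.mem_filter] at hy ⊢
            exact ⟨(hYm y).2 ⟨x, hx, hy.2⟩, hy.2⟩
      have c2 : ∑ x ∈ X, ((Y.filter (G x)).card : ℝ) = ∑ y ∈ Y, ((X.filter fun x => G x y).card : ℝ) := by
        exact_mod_cast dcount G Y X
      have c3 : ∑ y ∈ Y, ((X.filter fun x => G x y).card : ℝ) ≤ ∑ y ∈ Y, t := by
        apply Finset.sum_le_sum
        intro y hy
        obtain ⟨x0, hx0, hg⟩ := (hYm y).1 hy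
        refine le_trans ?_ (hGA x0 y hg).2.2.le
        norm_cast
        apply Finset.card_le_card
        intro x hx
        rw [Finset.mem_filter] at hx ⊢
        exact ⟨(hXm x hx.1).1, hP.symm _ _ (hGA x y hx.2).1⟩
      rw [Finset.sum_const, nsmul_eq_mul] at c3
      have c4 : m * t ≤ Y.card * t := by linarith
      exact le_of_mul_le_mul_right c4 ht
    · intro y hy
      obtain ⟨x, hx, hg⟩ := (hYm y).1 hy
      obtain ⟨hxL, -, hxW, hxF, hxv⟩ := hXm x hx
      obtain ⟨hA, hyL, -⟩ := hGA x y hg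
      obtain ⟨-, hR, hFC, hyF⟩ := (hG x y).1 hg
      have hxy : x ≠ y := fun e => hP.irrefl y (e ▸ hA)
      have hyv : y ≠ v := fun e => hyF (e ▸ hv)
      obtain ⟨S, T, g1, g2, g3, g4⟩ := link hP h0 h1 i (by omega) x (insert y FV) (insert (c x y) FC) hxL
        (by simp [hv]) (by simp [hxy, hxF]) (by
          intro hx0
          have hvx := (h0 x hx0).1
          simp only [Finset.mem_insert, not_or]
          refine ⟨fun e => ?_, fun h => hxv ⟨hvx, h⟩⟩
          rw [hP.csymm _ _ hvx] at e
          exact hyv (hP.proper x v y (hP.symm _ _ hvx) hA e).symm) (by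
          have a1 : ((insert y FV).card : ℝ) ≤ FV.card + 1 := by exact_mod_cast Finset.card_insert_le _ _
          have a2 : ((insert (c x y) FC).card : ℝ) ≤ FC.card + 1 := by exact_mod_cast Finset.card_insert_le _ _
          linarith)
      refine ⟨_, _, RP.snoc g1 hA ?_ ?_, ?_, ?_, ?_⟩
      · intro hyS
        rcases g2 y hyS with h | h | h
        · exact hyv h
        · exact hxy h.symm
        · exact h.2 (by simp)
      · intro hcT
        exact (g3 _ hcT).2 (by simp)
      · intro z hz
        rcases Finset.mem_insert.1 hz with rfl | hz
        · tauto
        · rcases g2 z hz with h | rfl | h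
          · exact Or.inl h
          · exact Or.inr (Or.inr ⟨hxW, hxF⟩)
          · exact Or.inr (Or.inr ⟨h.1, fun h' => h.2 (by simp [h'])⟩)
      · intro z hz
        rcases Finset.mem_insert.1 hz with rfl | hz
        · exact ⟨hR, hFC⟩
        · exact ⟨(g3 z hz).1, fun h' => (g3 z hz).2 (by simp [h'])⟩
      · exact (Finset.card_insert_le _ _).trans (by omega)

/-- sequencing of pieces -/
theorem pieces {ε K : ℝ} (hε : 0 < ε) (hε1 : ε ≤ 1) (hK : 1 ≤ K) {d ℓ b : ℕ} (hd : 0 < d)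
    (hℓ : 2 * (ℓ:ℝ) + 1 ≤ ε * d / 16) (hεd : 1 ≤ ε * d) {V C : Type} [Fintype V] [Fintype C]
    {Adj : V → V → Prop} {c : V → V → C} (hP : PG Adj c)
    (hmin : ∀ v, (d:ℝ) ≤ (Finset.univ.filter (Adj v)).card)
    (hmax : ∀ v, ((Finset.univ.filter (Adj v)).card : ℝ) ≤ K * d)
    {W : Finset V} {R : Finset C}
    (hWR : ∀ v, (((Finset.univ.filter (Adj v)).filter fun z => z ∈ W ∨ c v z ∈ R).card : ℝ) ≤ ε / 8 * d)
    {J : ℕ}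
    (hreach : ∀ (v : V) (FV : Finset V) (FC : Finset C), v ∈ FV → FV.card ≤ J * (b + 1) + 2 → FC.card ≤ J * (b + 1) →
      ∃ Y : Finset V, 20 * K ^ 2 / ε ^ 2 * d ≤ Y.card ∧ ∀ y ∈ Y, ∃ S T, RP Adj c v y S T ∧
      (∀ x ∈ S, x = v ∨ x = y ∨ (x ∈ W ∧ x ∉ FV)) ∧ (∀ x ∈ T, x ∈ R ∧ x ∉ FC) ∧ T.card ≤ b)
    (v0 : V) (j : ℕ) : j ≤ J →
    (∃ v S T, RP Adj c v0 v S T ∧ (1 - ε) * d ≤ T.card) ∨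
    ∃ v S T, RP Adj c v0 v S T ∧ j * ℓ ≤ T.card ∧ (S.filter fun x => x ∈ W).card ≤ j * (b + 1) + 1 ∧
      (T.filter fun x => x ∈ R).card ≤ j * (b + 1) := by
  induction j with
  | zero =>
    intro _
    refine Or.inr ⟨v0, _, _, RP.nil v0, by simp, ?_, by simp⟩
    exact (Finset.card_filter_le _ _).trans (by simp)
  | succ j ih =>
    intro hj
    rcases ih (by omega) with h | ⟨v, S, T, g, hT, hSW, hTR⟩
    · exact Or.inl h
    by_cases hdone : (1 - ε) * d ≤ T.card
    · exact Or.inl ⟨v, S, T, g, hdone⟩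
    push Not at hdone
    right
    have hjJ : j * (b + 1) ≤ J * (b + 1) := Nat.mul_le_mul_right _ (by omega)
    obtain ⟨Y, hY, hYr⟩ := hreach v (insert v (S.filter fun x => x ∈ W)) (T.filter fun x => x ∈ R)
      (by simp) ((Finset.card_insert_le _ _).trans (by omega)) (by omega)
    have hSc : (S.card : ℝ) = T.card + 1 := by exact_mod_cast g.card
    obtain ⟨y, hy, hyS, w, S', T', g', p1, p2, p3, p4⟩ := pieceE hε hε1 hK hd hℓ hP hmin hmax hWR (S := S) (T := T)
      (by linarith) hdone.le hY
    obtain ⟨Sl, Tl, gl, l1, l2, l3⟩ := hYr y hy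
    have hvS := g.end_mem
    have gA := g.append gl (by
      intro x hx hxS
      rcases l1 x hx with h | h | ⟨h, h'⟩
      · exact h
      · exact absurd (h ▸ hxS) hyS
      · exact absurd (by simp [hxS, h]) h') (by
      rw [Finset.disjoint_left]
      intro x hx hx'
      exact (l2 x hx').2 (Finset.mem_filter.2 ⟨hx, (l2 x hx').1⟩))
    have gB := gA.append g' (by
      intro x hx hxS
      rcases Finset.mem_union.1 hxS with h | h
      · exact absurd h (p1 x hx)
      · rcases p2 x hx with h' | h'
        · exact h'
        · rcases l1 x h with h2 | h2 | h2
          · exact absurd (h2 ▸ hvS) (p1 x hx)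
          · exact h2
          · exact absurd h2.1 h') (by
      rw [Finset.disjoint_left]
      intro x hx hx'
      rcases Finset.mem_union.1 hx with h | h
      · exact (p3 x hx').2 h
      · exact (p3 x hx').1 (l2 x h).1)
    have hdTT : Disjoint T T' := by
      rw [Finset.disjoint_left]
      intro x hx hx'
      exact (p3 x hx').2 hx
    refine ⟨w, _, _, gB, ?_, ?_, ?_⟩
    · have a1 : (T ∪ T').card ≤ (T ∪ Tl ∪ T').card := Finset.card_le_card (by
        intro x hx; simp only [Finset.mem_union] at hx ⊢; tauto)
      rw [Finset.card_union_of_disjoint hdTT] at a1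
      have : (j + 1) * ℓ = j * ℓ + ℓ := by ring
      omega
    · have a1 : ((S ∪ Sl ∪ S').filter fun x => x ∈ W) ⊆ (S.filter fun x => x ∈ W) ∪ Sl := by
        intro x hx
        simp only [Finset.mem_filter, Finset.mem_union] at hx ⊢
        rcases hx.1 with (h | h) | h
        · exact Or.inl ⟨h, hx.2⟩
        · exact Or.inr h
        · rcases p2 x h with h' | h'
          · subst h'; exact Or.inr gl.end_mem
          · exact absurd hx.2 h'
      have a2 := (Finset.card_le_card a1).trans (Finset.card_union_le _ _)
      have a3 := gl.card
      have : (j + 1) * (b + 1) = j * (b + 1) + (b + 1) := by ring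
      omega
    · have a1 : ((T ∪ Tl ∪ T').filter fun x => x ∈ R) ⊆ (T.filter fun x => x ∈ R) ∪ Tl := by
        intro x hx
        simp only [Finset.mem_filter, Finset.mem_union] at hx ⊢
        rcases hx.1 with (h | h) | h
        · exact Or.inl ⟨h, hx.2⟩
        · exact Or.inr h
        · exact absurd hx.2 (p3 x h).1
      have a2 := (Finset.card_le_card a1).trans (Finset.card_union_le _ _)
      have : (j + 1) * (b + 1) = j * (b + 1) + (b + 1) := by ring
      omega

theorem layers3 {V C : Type} [Fintype V] [Fintype C] {Adj : V → V → Prop} {c : V → V → C}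
    (hP : PG Adj c) {r : ℕ} (hr : 0 < r) (t1 t2 q : ℝ) (ht2 : 0 ≤ t2)
    (ht12 : t2 ≤ t1) (ht2q : t2 ≤ q) (hqt1 : q ≤ t1) (s : ℕ) (v0 : V)
    (hmin : ∀ v, t1 ≤ (Finset.univ.filter (Adj v)).card)
    (hsmall : (10 * ((s:ℝ) + 1) * (Fintype.card V : ℝ) ^ 2) * Real.exp (- (t2 / (4 * r ^ 2))) < 1) :
    ∃ (W : Finset V) (R : Finset C) (L : V → ℕ → Finset V),
      (∀ v, ∀ z ∈ L v 0, Adj v z ∧ z ∈ W ∧ c v z ∈ R) ∧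
      (∀ v, t1 / (4 * r ^ 2) ≤ (L v 0).card) ∧
      (∀ v i, L v (i+1) = L v i ∪ Finset.univ.filter fun y => t2 ≤ ((L v i).filter (Adj y)).card) ∧
      (∀ v, ∀ i ≤ s, ∀ y ∈ L v (i+1), y ∉ L v i →
        t2 / (4 * r ^ 2) ≤ ((L v i).filter fun z => Adj y z ∧ z ∈ W ∧ c y z ∈ R).card) ∧
      (∀ v, ∀ i ≤ s, q ≤ (LowX Adj t2 q (L v i)).card → q / (4 * r ^ 2) ≤ ((LowX Adj t2 q (L v i)).filter fun z => z ∈ W).card) ∧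
      (∀ v, ∀ i ≤ s, ∀ x, q ≤ (Low Adj t2 (L v i) x).card → q / (4 * r ^ 2) ≤
        ((Low Adj t2 (L v i) x).filter fun z => z ∈ W ∧ c x z ∈ R).card) ∧
      (∀ v, (((Finset.univ.filter (Adj v)).filter fun z => z ∈ W ∨ c v z ∈ R).card : ℝ)
          ≤ 24 / r * (Finset.univ.filter (Adj v)).card) := by
  obtain ⟨W1, R1, L, y1, y2, y3, y4, -, -, -, y8⟩ := layers hP Finset.univ hr t1 t2 ht2
    ht12 s (fun _ => ∅) (fun _ => ∅) (fun _ _ => ∅) (by simp) hsmall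
  have hV1 : (1:ℝ) ≤ Fintype.card V := by exact_mod_cast Fintype.card_pos_iff.2 ⟨v0⟩
  have hs1 : (1:ℝ) ≤ (s:ℝ) + 1 := by have : (0:ℝ) ≤ s := by positivity
                                     linarith
  have hV2 : (Fintype.card V : ℝ) ≤ (Fintype.card V : ℝ)^2 := by nlinarith
  have hV3 : (Fintype.card V : ℝ)^2 ≤ ((s:ℝ)+1) * (Fintype.card V : ℝ)^2 := by nlinarith
  have hV4 : ((s:ℝ)+1) * (Fintype.card V : ℝ) ≤ ((s:ℝ)+1) * (Fintype.card V : ℝ)^2 := by nlinarith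
  obtain ⟨W2, R2, h2, h2x, h2u⟩ := sampleVC (ι := V × Fin (s+1) × V)
    (κ := V × Fin (s+1)) c hr q (ht2.trans ht2q)
    (fun p => p.2.2) (fun p => Low Adj t2 (L p.1 p.2.1) p.2.2)
    (fun p => LowX Adj t2 q (L p.1 p.2)) (fun v => Finset.univ.filter (Adj v)) (by
      rintro ⟨v, i, y⟩ z hz z' hz' e
      simp only [Low, Finset.mem_filter] at hz hz' e
      exact hP.proper y z z' hz.1.2 hz'.1.2 e) (by
      intro v z hz z' hz' e
      exact hP.proper v z z' (Finset.mem_filter.1 hz).2 (Finset.mem_filter.1 hz').2 e) (by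
      refine lt_of_le_of_lt ?_ hsmall
      apply mul_le_mul
      · simp only [Fintype.card_prod, Fintype.card_fin]
        push_cast
        nlinarith
      · apply Real.exp_le_exp.2
        apply neg_le_neg
        gcongr
      · positivity
      · positivity)
  refine ⟨W1 ∪ W2, R1 ∪ R2, L, ?_, fun v => y2 v (hmin v), y3, ?_, ?_, ?_, ?_⟩
  · intro v z hz
    obtain ⟨-, a, b, e⟩ := y1 v z hz
    exact ⟨a, Finset.mem_union_left _ b, Finset.mem_union_left _ e⟩
  · intro v i hi y hy hy'
    refine (y4 v i hi y hy hy').trans ?_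
    norm_cast
    apply Finset.card_le_card
    intro z hz
    have hz := Finset.mem_filter.1 hz
    exact Finset.mem_filter.2 ⟨hz.1, hz.2.1, Finset.mem_union_left _ hz.2.2.1, Finset.mem_union_left _ hz.2.2.2⟩
  · intro v i hi h
    refine (h2x (v, ⟨i, by omega⟩) h).trans ?_
    norm_cast
    apply Finset.card_le_card
    intro z hz
    have hz := Finset.mem_filter.1 hz
    exact Finset.mem_filter.2 ⟨hz.1, Finset.mem_union_right _ hz.2⟩
  · intro v i hi x h
    refine (h2 (v, ⟨i, by omega⟩, x) h).trans ?_
    norm_cast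
    apply Finset.card_le_card
    intro z hz
    have hz := Finset.mem_filter.1 hz
    exact Finset.mem_filter.2 ⟨hz.1, Finset.mem_union_right _ hz.2.1, Finset.mem_union_right _ hz.2.2⟩
  · intro v
    have h5 := y8 v (hmin v)
    have h6 := h2u v (hqt1.trans (hmin v))
    have h7 : ((Finset.univ.filter (Adj v)).filter fun z => z ∈ W1 ∪ W2 ∨ c v z ∈ R1 ∪ R2).card ≤
      ((Finset.univ.filter (Adj v)).filter fun z => z ∈ W1 ∨ c v z ∈ R1).card +
      ((Finset.univ.filter (Adj v)).filter fun z => z ∈ W2 ∨ c v z ∈ R2).card := by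
      refine le_trans (Finset.card_le_card ?_) (Finset.card_union_le _ _)
      intro z hz
      simp only [Finset.mem_filter, Finset.mem_union] at hz ⊢
      tauto
    have h8 : (((Finset.univ.filter (Adj v)).filter fun z => z ∈ W1 ∪ W2 ∨ c v z ∈ R1 ∪ R2).card : ℝ) ≤
      ((Finset.univ.filter (Adj v)).filter fun z => z ∈ W1 ∨ c v z ∈ R1).card +
      ((Finset.univ.filter (Adj v)).filter fun z => z ∈ W2 ∨ c v z ∈ R2).card := by exact_mod_cast h7
    have e : (24 / r * (Finset.univ.filter (Adj v)).card : ℝ) = 16 / r * (Finset.univ.filter (Adj v)).card + 8 / r * (Finset.univ.filter (Adj v)).card := by ring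
    rw [e]
    linarith

set_option maxHeartbeats 2000000 in
theorem caseB (ε K : ℝ) (hε : 0 < ε) (hε1 : ε ≤ 1) (hK : 1 ≤ K) (p : ℕ) :
    ∃ M' : ℝ, 1 ≤ M' ∧ ∃ d0 : ℕ, ∀ d : ℕ, d0 ≤ d → ∀ (V C : Type) [Fintype V] [Fintype C] (Adj : V → V → Prop)
      (c : V → V → C), PG Adj c → (∀ v, (d:ℝ) ≤ (Finset.univ.filter (Adj v)).card) →
      (∀ v, ((Finset.univ.filter (Adj v)).card : ℝ) ≤ K * d) →
      ((Fintype.card V : ℝ) ≤ (d:ℝ)^p) →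
      (∀ U0 : Finset V, U0.Nonempty → (U0.card : ℝ) ≤ M' * d →
        ∃ u ∈ U0, ((U0.filter (Adj u)).card : ℝ) < (1 - ε / 16) * d) →
      ∀ v0 : V, ∃ v S T, RP Adj c v0 v S T ∧ (1 - ε) * d ≤ T.card := by
  obtain ⟨ξ, hξ⟩ : ∃ ξ, ξ = ε / 16 := ⟨_, rfl⟩
  have hξ0 : 0 < ξ := by rw [hξ]; positivity
  obtain ⟨r, hr⟩ := exists_nat_ge (200 * K / ε)
  have hr0 : (0:ℝ) < r := lt_of_lt_of_le (by positivity) hr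
  have hrN : 0 < r := by exact_mod_cast hr0
  have hr1 : (1:ℝ) ≤ r := by exact_mod_cast hrN
  rw [div_le_iff₀ hε] at hr
  have hr24 : 24 / r * K ≤ ε / 8 := by
    rw [div_mul_eq_mul_div, div_le_iff₀ hr0]; linarith
  obtain ⟨δ, hδ⟩ : ∃ δ : ℝ, δ = 1 / (4 * r ^ 2) := ⟨_, rfl⟩
  have hδ0 : 0 < δ := by rw [hδ]; positivity
  have hδξ : δ ≤ ξ := by
    rw [hδ, hξ, div_le_div_iff₀ (by positivity) (by norm_num)]
    nlinarith
  have hδ1 : δ ≤ 1 := by rw [hξ] at hδξ; linarith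
  obtain ⟨M1, hM1⟩ : ∃ M1 : ℝ, M1 = 20 * K ^ 2 / ε ^ 2 := ⟨_, rfl⟩
  have hM10 : 1 ≤ M1 := by
    rw [hM1, le_div_iff₀ (by positivity)]; nlinarith
  obtain ⟨M', hM'⟩ : ∃ M' : ℝ, M' = M1 + 1 := ⟨_, rfl⟩
  have hM'1 : 1 ≤ M' := by linarith
  obtain ⟨ζ, hζ⟩ : ∃ ζ : ℝ, ζ = ξ * δ / (8 * K) := ⟨_, rfl⟩
  obtain ⟨κ, hκ⟩ : ∃ κ : ℝ, κ = ξ * δ / (16 * K * M') := ⟨_, rfl⟩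
  have hζ0 : 0 < ζ := by rw [hζ]; positivity
  have hκ0 : 0 < κ := by rw [hκ]; positivity
  have hκ1 : κ ≤ 1 := by
    rw [hκ, div_le_one (by positivity)]
    have h1 : ξ * δ ≤ 1 * 1 := by gcongr; rw [hξ]; linarith
    have h2 : 1 * 1 ≤ K * M' := by gcongr
    nlinarith
  obtain ⟨s, hs⟩ := exists_nat_gt (M' / ζ)
  rw [div_lt_iff₀ hζ0] at hs
  obtain ⟨κ', hκ'⟩ : ∃ κ' : ℝ, κ' = κ / (4 * r ^ 2) := ⟨_, rfl⟩
  have hκ'0 : 0 < κ' := by rw [hκ']; positivity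
  have hκ'1 : κ' ≤ κ := by
    rw [hκ']; apply div_le_self hκ0.le; nlinarith
  obtain ⟨η, hη⟩ : ∃ η : ℝ, η = κ' ^ 2 / (4 * M1) := ⟨_, rfl⟩
  have hη0 : 0 < η := by rw [hη]; positivity
  have hηκ : η ≤ κ := by
    have : η ≤ κ' := by
      rw [hη, div_le_iff₀ (by positivity)]; nlinarith
    linarith
  obtain ⟨k0, hk0⟩ : ∃ k0 : ℝ, k0 = η / (4 * r ^ 2) := ⟨_, rfl⟩
  have hk00 : 0 < k0 := by rw [hk0]; positivity
  obtain ⟨J, hJ⟩ := exists_nat_ge (128 / ε)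
  rw [div_le_iff₀ hε] at hJ
  obtain ⟨N, hN⟩ : ∃ N : ℕ, N = J * (s + 2 + 1) + 2 := ⟨_, rfl⟩
  obtain ⟨d1, hd1⟩ := expsmall (10 * ((s:ℝ) + 1)) (2 * p) k0 hk00
  obtain ⟨d2, hd2⟩ := exists_nat_ge' (128 / ε)
  obtain ⟨d3, hd3⟩ := exists_nat_ge' ((3 * N + 3 * s + 4) / k0)
  obtain ⟨d4, hd4⟩ := exists_nat_ge' (4 * N / κ')
  obtain ⟨d5, hd5⟩ := exists_nat_ge' (2 * N)
  refine ⟨M', hM'1, max (max d1 d2) (max d3 (max d4 (max d5 1))), ?_⟩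
  intro d hd V C _ _ Adj c hP hmin hmax hcard hno v0
  simp only [max_le_iff] at hd
  obtain ⟨⟨hda, hdb⟩, hdc, hdd, hde, hdf⟩ := hd
  replace hda := hd1 d hda
  replace hdb := hd2 d hdb
  replace hdc := hd3 d hdc
  replace hdd := hd4 d hdd
  replace hde := hd5 d hde
  rw [div_le_iff₀ hε] at hdb
  rw [div_le_iff₀ hk00] at hdc
  rw [div_le_iff₀ hκ'0] at hdd
  clear hd1 hd2 hd3 hd4 hd5
  have hdpos : (0:ℝ) < d := by exact_mod_cast hdf
  have ek : η * d / (4 * r ^ 2) = k0 * d := by rw [hk0]; ring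
  have eq' : κ * d / (4 * r ^ 2) = κ' * d := by rw [hκ']; ring
  obtain ⟨W, R, L, y1, y2, y3, y4, y5, y6, y7⟩ := layers3 hP hrN (d:ℝ) (η * d) (κ * d) (by positivity)
    (by nlinarith) (by gcongr) (by nlinarith) s v0 hmin (by
      rw [ek]
      refine lt_of_le_of_lt ?_ hda
      gcongr
      rw [mul_comm 2 p, pow_mul]
      gcongr)
  rw [ek] at y4
  rw [eq'] at y5 y6
  have hWR : ∀ v, (((Finset.univ.filter (Adj v)).filter fun z => z ∈ W ∨ c v z ∈ R).card : ℝ) ≤ ε / 8 * d := by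
    intro v
    refine (y7 v).trans ?_
    calc 24 / r * ((Finset.univ.filter (Adj v)).card : ℝ) ≤ 24 / r * (K * d) := by gcongr; exact hmax v
      _ = (24 / r * K) * d := by ring
      _ ≤ _ := by gcongr
  obtain ⟨ℓ, hℓ⟩ : ∃ ℓ : ℕ, ℓ = ⌊ε * d / 64⌋₊ := ⟨_, rfl⟩
  have hℓ1 : (ℓ:ℝ) ≤ ε * d / 64 := by rw [hℓ]; exact Nat.floor_le (by positivity)
  have hℓ2 : ε * d / 64 < ℓ + 1 := by rw [hℓ]; exact Nat.lt_floor_add_one _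
  have hfin := pieces (J := J) (b := s + 2) hε hε1 hK hdf (ℓ := ℓ) (by linarith) (by linarith) hP hmin hmax hWR (by
    intro v FV FC hv hFV hFC
    rw [← hN] at hFV
    have hFC : FC.card ≤ N := by omega
    have hFV' : (FV.card : ℝ) ≤ N := by exact_mod_cast hFV
    have hFC' : (FC.card : ℝ) ≤ N := by exact_mod_cast hFC
    obtain ⟨i, hi, hcase⟩ := growB hK hξ0 hδ0 hδξ hM'1 hζ hκ hdf hP hmin hmax (by rw [hξ]; exact hno)
      (L := L v) (t := η * d) (by rw [hδ]; refine le_trans (le_of_eq ?_) (y2 v); ring) (y3 v) hs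
    rw [← hM1]
    exact reachB hP (y1 v) (y4 v) hi (q := κ * d) (q' := κ' * d) (t := η * d) (mm := M' * d) (by positivity) (by positivity) hcase
      (y5 v i hi) (y6 v i hi) hv (by linarith) (by linarith) (by rw [hM']; linarith) (by
        apply le_of_eq
        rw [hη]; field_simp; ring)) v0 J le_rfl
  rcases hfin with h | ⟨v, S, T, g, hT, -, -⟩
  · exact h
  · refine ⟨v, S, T, g, ?_⟩
    have h1 : (J:ℝ) * ℓ ≤ T.card := by exact_mod_cast hT
    have h2 : ε * d / 128 ≤ ℓ := by linarith
    have h3 : (J:ℝ) * (ε * d / 128) ≤ J * ℓ := by gcongr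
    have h4 : 128 * (d:ℝ) ≤ J * ε * d := by gcongr
    have h5 : 0 ≤ ε * d := by positivity
    nlinarith

theorem coreThm (ε K : ℝ) (hε : 0 < ε) (hε1 : ε ≤ 1) (hK : 1 ≤ K) (L p : ℕ) :
    ∃ d0 : ℕ, ∀ d : ℕ, d0 ≤ d → ∀ (V C : Type) [Fintype V] [Fintype C] (Adj : V → V → Prop)
      (c : V → V → C), PG Adj c → (∀ v, (d:ℝ) ≤ (Finset.univ.filter (Adj v)).card) →
      (∀ v, ((Finset.univ.filter (Adj v)).card : ℝ) ≤ K * d) →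
      ((Fintype.card V : ℝ) ≤ (d:ℝ)^p) →
      ∀ v0 : V, (∀ x, ∃ S T, RP Adj c v0 x S T ∧ T.card ≤ L) →
      ∃ v S T, RP Adj c v0 v S T ∧ (1 - ε) * d ≤ T.card := by
  obtain ⟨M', hM', d1, h1⟩ := caseB ε K hε hε1 hK p
  obtain ⟨d2, h2⟩ := caseA ε K M' hε hε1 hK hM' L p
  refine ⟨max d1 d2, ?_⟩
  intro d hd V C _ _ Adj c hP hmin hmax hcard v0 hr
  by_cases h : ∀ U0 : Finset V, U0.Nonempty → (U0.card : ℝ) ≤ M' * d →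
        ∃ u ∈ U0, ((U0.filter (Adj u)).card : ℝ) < (1 - ε / 16) * d
  · exact h1 d (le_trans (le_max_left _ _) hd) V C Adj c hP hmin hmax hcard h v0
  · push Not at h
    obtain ⟨U0, a, b, e⟩ := h
    exact h2 d (le_trans (le_max_right _ _) hd) V C Adj c hP hmax hcard v0 hr U0 a b e

theorem window {V C : Type} {H : V → V → Prop} {c : V → V → C} (hP : PG H c)
    {v x : V} {S : Finset V} {T : Finset C} (g : RP H c v x S T)
    (hmin : ∀ S' T', RP H c v x S' T' → T.card ≤ T'.card) {y : V} (hy : y ∉ S ∨ y = x) :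
    ((S.erase x).filter fun z => H y z ∧ c y z ∉ T).card ≤ 3 := by
  obtain ⟨n, hn⟩ : ∃ n, n = T.card := ⟨_, rfl⟩
  obtain ⟨p, p0, p1, p2, p3, p4⟩ := g.fn
  have hSc := g.card
  rw [← hn] at p1 p2 p3 p4 hSc
  have hp : ∀ i ≤ n, ∀ j ≤ n, p i = p j → i = j := by
    intro i hi j hj e
    exact RP.injp (n := n + 1) (by rw [← p2, hSc]) i (by omega) j (by omega) e
  have hcol : ∀ i < n, ∀ j < n, c (p i) (p (i+1)) = c (p j) (p (j+1)) → i = j := by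
    intro i hi j hj e
    exact RP.injp (p := fun i => c (p i) (p (i+1))) (n := n) (by rw [← p3, hn]) i (by omega) j (by omega) e
  have hT : ∀ i < n, c (p i) (p (i+1)) ∈ T := by
    intro i hi
    rw [p3]
    exact Finset.mem_image.2 ⟨i, by simpa using hi, rfl⟩
  have hSp : ∀ z ∈ S, ∃ i ≤ n, p i = z := by
    intro z hz
    rw [p2] at hz
    obtain ⟨i, hi, e⟩ := Finset.mem_image.1 hz
    exact ⟨i, by simp at hi; omega, e⟩
  have hpS : ∀ i ≤ n, p i ∈ S := by
    intro i hi
    rw [p2]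
    exact Finset.mem_image.2 ⟨i, by simp; omega, rfl⟩
  let I := (Finset.range n).filter fun i => H y (p i) ∧ c y (p i) ∉ T
  have hI : ((S.erase x).filter fun z => H y z ∧ c y z ∉ T).card ≤ I.card := by
    refine le_trans (Finset.card_le_card ?_) (Finset.card_image_le (f := p))
    intro z hz
    rw [Finset.mem_filter, Finset.mem_erase] at hz
    obtain ⟨i, hi, rfl⟩ := hSp z hz.1.2
    refine Finset.mem_image.2 ⟨i, Finset.mem_filter.2 ⟨?_, hz.2⟩, rfl⟩
    rw [Finset.mem_range]
    rcases Nat.lt_or_ge i n with h | h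
    · exact h
    · have : i = n := by omega
      subst this
      exact absurd p1 hz.1.1
  refine hI.trans ?_
  rcases hy with hyS | hyx
  · have key : ∀ i ∈ I, ∀ j ∈ I, i < j → j ≤ i + 2 := by
      intro i hi j hj hij
      simp only [I, Finset.mem_filter, Finset.mem_range] at hi hj
      have a1 := RP.ofFn (A := H) (c := c) hp hcol p4 0 i (by omega)
      simp only [zero_add] at a1
      have ci : c (p i) y = c y (p i) := (hP.csymm _ _ hi.2.1).symm
      have hyi : ∀ i ≤ n, p i ≠ y := fun i hi e => hyS (e ▸ hpS i hi)
      have a2 := a1.snoc (hP.symm _ _ hi.2.1) (by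
        intro h
        obtain ⟨k, hk, e⟩ := Finset.mem_image.1 h
        rw [Finset.mem_Icc] at hk
        exact hyi k (by omega) e) (by
        rw [ci]
        intro h
        obtain ⟨k, hk, e⟩ := Finset.mem_image.1 h
        rw [Finset.mem_Ico] at hk
        exact hi.2.2 (e ▸ hT k (by omega)))
      have a3 := a2.snoc hj.2.1 (by
        intro h
        rcases Finset.mem_insert.1 h with h | h
        · exact hyi j (by omega) h
        · obtain ⟨k, hk, e⟩ := Finset.mem_image.1 h
          rw [Finset.mem_Icc] at hk
          have := hp k (by omega) j (by omega) e
          omega) (by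
        intro h
        rcases Finset.mem_insert.1 h with h | h
        · rw [ci] at h
          have := hp _ (by omega) _ (by omega) (hP.proper _ _ _ hj.2.1 hi.2.1 h)
          omega
        · obtain ⟨k, hk, e⟩ := Finset.mem_image.1 h
          rw [Finset.mem_Ico] at hk
          exact hj.2.2 (e ▸ hT k (by omega)))
      have a4 := RP.ofFn (A := H) (c := c) hp hcol p4 j (n - j) (by omega)
      rw [show j + (n - j) = n by omega] at a4
      have a5 := a3.append a4 (by
        intro z hz hz'
        obtain ⟨k, hk, rfl⟩ := Finset.mem_image.1 hz
        rw [Finset.mem_Icc] at hk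
        rcases Finset.mem_insert.1 hz' with h | h
        · exact h
        rcases Finset.mem_insert.1 h with h | h
        · exact absurd h (hyi k (by omega))
        · obtain ⟨k', hk', e⟩ := Finset.mem_image.1 h
          rw [Finset.mem_Icc] at hk'
          have := hp _ (by omega) _ (by omega) e
          omega) (by
        rw [Finset.disjoint_left]
        intro t ht ht'
        obtain ⟨k, hk, rfl⟩ := Finset.mem_image.1 ht'
        rw [Finset.mem_Ico] at hk
        rcases Finset.mem_insert.1 ht with h | h
        · exact hj.2.2 (h ▸ hT k (by omega))
        rcases Finset.mem_insert.1 h with h | h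
        · rw [ci] at h
          exact hi.2.2 (h ▸ hT k (by omega))
        · obtain ⟨k', hk', e⟩ := Finset.mem_image.1 h
          rw [Finset.mem_Ico] at hk'
          have := hcol _ (by omega) _ (by omega) e
          omega)
      rw [p0, p1] at a5
      have a6 := hmin _ _ a5
      have b1 := Finset.card_union_le (insert (c y (p j)) (insert (c (p i) y) (Finset.image (fun i => c (p i) (p (i + 1))) (Finset.Ico 0 i)))) (Finset.image (fun i => c (p i) (p (i + 1))) (Finset.Ico j n))
      have b2 := Finset.card_insert_le (c y (p j)) (insert (c (p i) y) (Finset.image (fun i => c (p i) (p (i + 1))) (Finset.Ico 0 i)))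
      have b3 := Finset.card_insert_le (c (p i) y) (Finset.image (fun i => c (p i) (p (i + 1))) (Finset.Ico 0 i))
      have b4 := Finset.card_image_le (f := fun i => c (p i) (p (i + 1))) (s := Finset.Ico 0 i)
      have b5 := Finset.card_image_le (f := fun i => c (p i) (p (i + 1))) (s := Finset.Ico j n)
      rw [Nat.card_Ico] at b4 b5
      omega
    by_cases hne : I.Nonempty
    · have : I ⊆ Finset.Icc (I.min' hne) (I.min' hne + 2) := by
        intro i hi
        rw [Finset.mem_Icc]
        have h1 := I.min'_le i hi
        refine ⟨h1, ?_⟩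
        rcases Nat.lt_or_ge (I.min' hne) i with h | h
        · exact key _ (I.min'_mem hne) i hi h
        · omega
      have h2 := Finset.card_le_card this
      rw [Nat.card_Icc] at h2
      omega
    · rw [Finset.not_nonempty_iff_eq_empty] at hne
      rw [hne]; simp
  · subst hyx
    have : I = ∅ := by
      rw [Finset.eq_empty_iff_forall_notMem]
      intro i hi
      simp only [I, Finset.mem_filter, Finset.mem_range] at hi
      have a1 := RP.ofFn (A := H) (c := c) hp hcol p4 0 i (by omega)
      simp only [zero_add] at a1
      have ci : c (p i) y = c y (p i) := (hP.csymm _ _ hi.2.1).symm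
      have a2 := a1.snoc (hP.symm _ _ hi.2.1) (by
        intro h
        obtain ⟨k, hk, e⟩ := Finset.mem_image.1 h
        rw [Finset.mem_Icc] at hk
        rw [← p1] at e
        have := hp _ (by omega) _ (by omega) e
        omega) (by
        rw [ci]
        intro h
        obtain ⟨k, hk, e⟩ := Finset.mem_image.1 h
        rw [Finset.mem_Ico] at hk
        exact hi.2.2 (e ▸ hT k (by omega)))
      rw [p0] at a2
      have a6 := hmin _ _ a2
      have b3 := Finset.card_insert_le (c (p i) y) (Finset.image (fun i => c (p i) (p (i + 1))) (Finset.Ico 0 i))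
      have b4 := Finset.card_image_le (f := fun i => c (p i) (p (i + 1))) (s := Finset.Ico 0 i)
      rw [Nat.card_Ico] at b4
      have : i + 1 = n := by omega
      have h7 := hT i (by omega)
      rw [this, p1, ci] at h7
      exact hi.2.2 h7
    rw [this]; simp

theorem PG.sub {V C : Type} {Adj : V → V → Prop} {c : V → V → C} (hP : PG Adj c) (Y : Finset V) (T : Finset C) :
    PG (fun a b => Adj a b ∧ a ∈ Y ∧ b ∈ Y ∧ c a b ∉ T) c where
  symm u v h := ⟨hP.symm _ _ h.1, h.2.2.1, h.2.1, by rw [← hP.csymm _ _ h.1]; exact h.2.2.2⟩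
  irrefl u h := hP.irrefl u h.1
  csymm u v h := hP.csymm u v h.1
  proper u v w h h' e := hP.proper u v w h.1 h'.1 e

theorem geoStep {V C : Type} [Fintype V] [Fintype C] {Adj : V → V → Prop} {c : V → V → C} (hP : PG Adj c)
    {d L : ℕ} (hL : 1 ≤ L) {u v : V} {S : Finset V} {T : Finset C} {Y : Finset V}
    (g : RP Adj c u v S T) (hvY : v ∈ Y) (hSY : ∀ x ∈ S, x ∈ Y → x = v)
    (hdeg : ∀ y ∈ Y, L * d ≤ L * (Y.filter fun w => Adj y w ∧ c y w ∉ T).card + (L + 3) * T.card)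
    {x : V} {S' : Finset V} {T' : Finset C}
    (g' : RP (fun a b => Adj a b ∧ a ∈ Y ∧ b ∈ Y ∧ c a b ∉ T) c v x S' T') (hT' : T'.card = L)
    (hmin : ∀ S'' T'', RP (fun a b => Adj a b ∧ a ∈ Y ∧ b ∈ Y ∧ c a b ∉ T) c v x S'' T'' → L ≤ T''.card) :
    ∃ (v : V) (S : Finset V) (T2 : Finset C) (Y : Finset V), RP Adj c u v S T2 ∧ v ∈ Y ∧ (∀ x ∈ S, x ∈ Y → x = v) ∧
    (∀ y ∈ Y, L * d ≤ L * (Y.filter fun w => Adj y w ∧ c y w ∉ T2).card + (L + 3) * T2.card) ∧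
    T.card + 1 ≤ T2.card := by
  have hS'Y : ∀ z ∈ S', z ∈ Y := by
    intro z hz
    rcases g'.vert hz with h | ⟨y, -, h⟩
    · rw [h]; exact hvY
    · exact h.2.2.1
  have hTT : Disjoint T T' := by
    rw [Finset.disjoint_left]
    intro t ht ht'
    obtain ⟨a, -, b, -, h, rfl⟩ := g'.col ht'
    exact h.2.2.2 ht
  have hc : (T ∪ T').card = T.card + L := by rw [Finset.card_union_of_disjoint hTT, hT']
  refine ⟨x, S ∪ S', T ∪ T', Y \ (S'.erase x), g.append (g'.mono fun a b _ _ h => h.1) ?_ hTT, ?_, ?_, ?_, ?_⟩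
  · intro z hz hz'
    exact hSY z hz' (hS'Y z hz)
  · simp [hS'Y x g'.end_mem]
  · intro z hz hzY
    rw [Finset.mem_sdiff, Finset.mem_erase] at hzY
    by_contra hne
    have hzS' : z ∉ S' := fun h => hzY.2 ⟨hne, h⟩
    rcases Finset.mem_union.1 hz with h | h
    · have := hSY z h hzY.1
      exact hzS' (this ▸ g'.start_mem)
    · exact hzS' h
  · intro y hy
    rw [Finset.mem_sdiff, Finset.mem_erase] at hy
    have h1 := hdeg y hy.1
    have h2 := window (hP.sub Y T) g' (by intro A B h; rw [hT']; exact hmin A B h) (y := y) (by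
      by_cases h : y = x
      · exact Or.inr h
      · exact Or.inl fun h' => hy.2 ⟨h, h'⟩)
    let N1 := (Y \ (S'.erase x)).filter fun w => Adj y w ∧ c y w ∉ T ∪ T'
    let N2 := Y.filter fun w => Adj y w ∧ c y w ∈ T'
    have h3 : N2.card ≤ L := by
      rw [← hT']
      exact hP.card_col y N2 T' fun z hz => (Finset.mem_filter.1 hz).2
    have h4 : (Y.filter fun w => Adj y w ∧ c y w ∉ T) ⊆ (N1 ∪ N2) ∪
        ((S'.erase x).filter fun z => (Adj y z ∧ y ∈ Y ∧ z ∈ Y ∧ c y z ∉ T) ∧ c y z ∉ T') := by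
      intro w hw
      have hw := Finset.mem_filter.1 hw
      have hyY := hy.1
      simp only [N1, N2, Finset.mem_union, Finset.mem_filter, Finset.mem_sdiff]
      tauto
    have h5 := (Finset.card_le_card h4).trans (Finset.card_union_le _ _)
    have h6 := Finset.card_union_le N1 N2
    have h7 : (Y.filter fun w => Adj y w ∧ c y w ∉ T).card ≤ N1.card + (L + 3) := by
      refine h5.trans ?_
      have h2' : ((S'.erase x).filter fun z => (Adj y z ∧ y ∈ Y ∧ z ∈ Y ∧ c y z ∉ T) ∧ c y z ∉ T').card ≤ 3 := by
        convert h2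
      refine (add_le_add h6 h2').trans ?_
      omega
    have h8 : N1.card = ((Y \ (S'.erase x)).filter fun w => Adj y w ∧ c y w ∉ T ∪ T').card := rfl
    rw [← h8, hc]
    calc L * d ≤ L * (Y.filter fun w => Adj y w ∧ c y w ∉ T).card + (L + 3) * T.card := h1
      _ ≤ L * (N1.card + (L + 3)) + (L + 3) * T.card := by gcongr
      _ = _ := by ring
  · rw [hc]; omega

theorem geoMax {V C : Type} [Fintype V] [Fintype C] {Adj : V → V → Prop} {c : V → V → C} (hP : PG Adj c)
    {d L : ℕ} (hL : 1 ≤ L) (u : V) (hmin : ∀ v, d ≤ (Finset.univ.filter (Adj v)).card) :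
    ∃ (v : V) (S : Finset V) (T : Finset C) (Y : Finset V), RP Adj c u v S T ∧ v ∈ Y ∧ (∀ x ∈ S, x ∈ Y → x = v) ∧
    (∀ y ∈ Y, L * d ≤ L * (Y.filter fun w => Adj y w ∧ c y w ∉ T).card + (L + 3) * T.card) ∧
    (∀ x S' T', RP (fun a b => Adj a b ∧ a ∈ Y ∧ b ∈ Y ∧ c a b ∉ T) c v x S' T' → T'.card ≤ L →
      ∃ S'' T'', RP (fun a b => Adj a b ∧ a ∈ Y ∧ b ∈ Y ∧ c a b ∉ T) c v x S'' T'' ∧ T''.card < L) := by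
  by_contra hcon
  push Not at hcon
  have key : ∀ n : ℕ, ∃ (v : V) (S : Finset V) (T : Finset C) (Y : Finset V), RP Adj c u v S T ∧ v ∈ Y ∧ (∀ x ∈ S, x ∈ Y → x = v) ∧
    (∀ y ∈ Y, L * d ≤ L * (Y.filter fun w => Adj y w ∧ c y w ∉ T).card + (L + 3) * T.card) ∧ n ≤ T.card := by
    intro n
    induction n with
    | zero =>
      refine ⟨u, _, _, Finset.univ, RP.nil u, by simp, by simp, ?_, by simp⟩
      intro y _
      have := hmin y
      simp only [Finset.notMem_empty, not_false_eq_true, and_true, Finset.card_empty, mul_zero, add_zero]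
      gcongr
    | succ n ih =>
      obtain ⟨v, S, T, Y, h1, h2, h3, h4, h5⟩ := ih
      obtain ⟨x, S', T', g', hT', hm⟩ := hcon v S T Y h1 h2 h3 h4
      obtain ⟨v', S2, T2, Y2, a1, a2, a3, a4, a5⟩ := geoStep hP hL h1 h2 h3 h4 g' (le_antisymm hT' (hm _ _ g')) hm
      exact ⟨v', S2, T2, Y2, a1, a2, a3, a4, by omega⟩
  obtain ⟨v, S, T, Y, -, -, -, -, h⟩ := key (Fintype.card C + 1)
  have := Finset.card_le_univ T
  omega

theorem RP.lift {V C : Type} {A : V → V → Prop} {c : V → V → C} {X' : Type} (f : X' → V) (hf : Function.Injective f)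
    {u v : V} {S : Finset V} {T : Finset C}
    (g : RP A c u v S T) : (∀ x ∈ S, ∃ a, f a = x) → ∀ a b, f a = u → f b = v →
    ∃ S' : Finset X', RP (fun a b : X' => A (f a) (f b)) (fun a b => c (f a) (f b)) a b S' T ∧ S'.image f = S := by
  induction g with
  | nil =>
    intro _ a b ha hb
    obtain rfl : a = b := hf (ha.trans hb.symm)
    exact ⟨_, RP.nil _, by simp [ha]⟩
  | @snoc v w S T h hA hw hc ih =>
    intro hX a b ha hb
    obtain ⟨z, hz⟩ := hX v (by simp [h.end_mem])
    obtain ⟨S', g', e⟩ := ih (fun x hx => hX x (by simp [hx])) a z ha hz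
    subst hb hz
    refine ⟨_, RP.snoc (w := b) g' hA ?_ hc, ?_⟩
    · intro hm
      exact hw (e ▸ Finset.mem_image.2 ⟨_, hm, rfl⟩)
    · rw [Finset.image_insert, e]

theorem ballCard {V C : Type} [Fintype V] {A : V → V → Prop} {c : V → V → C} (v : V) {B : ℝ} (hB : 0 ≤ B)
    (hA : ∀ x, ((Finset.univ.filter (A x)).card : ℝ) ≤ B) (i : ℕ) :
    ((Finset.univ.filter fun x => ∃ S T, RP A c v x S T ∧ T.card ≤ i).card : ℝ) ≤ (1 + B) ^ i := by
  induction i with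
  | zero =>
    have : (Finset.univ.filter fun x => ∃ S T, RP A c v x S T ∧ T.card ≤ 0) ⊆ {v} := by
      intro x hx
      obtain ⟨-, S, T, g, hT⟩ := Finset.mem_filter.1 hx
      have := g.card
      have h1 : S.card = 1 := by omega
      have := Finset.card_le_one.1 h1.le _ g.start_mem _ g.end_mem
      simp [this]
    have := Finset.card_le_card this
    simpa using this
  | succ i ih =>
    let X := Finset.univ.filter fun x => ∃ S T, RP A c v x S T ∧ T.card ≤ i
    have hs : (Finset.univ.filter fun x => ∃ S T, RP A c v x S T ∧ T.card ≤ i + 1) ⊆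
        X ∪ X.biUnion fun x => Finset.univ.filter (A x) := by
      intro x hx
      obtain ⟨-, S, T, g, hT⟩ := Finset.mem_filter.1 hx
      cases g with
      | nil => exact Finset.mem_union_left _ (Finset.mem_filter.2 ⟨Finset.mem_univ _, _, _, RP.nil _, by simp⟩)
      | @snoc w _ S T g hA hw hc =>
        rw [Finset.card_insert_of_notMem hc] at hT
        refine Finset.mem_union_right _ (Finset.mem_biUnion.2 ⟨w, Finset.mem_filter.2 ⟨Finset.mem_univ _, _, _, g, by omega⟩, by simp [hA]⟩)
    have h1 := (Finset.card_le_card hs).trans (Finset.card_union_le _ _)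
    have h2 : ((X.biUnion fun x => Finset.univ.filter (A x)).card : ℝ) ≤ X.card * B := by
      calc ((X.biUnion fun x => Finset.univ.filter (A x)).card : ℝ) ≤ ∑ x ∈ X, ((Finset.univ.filter (A x)).card : ℝ) := by
            exact_mod_cast Finset.card_biUnion_le
        _ ≤ ∑ x ∈ X, B := Finset.sum_le_sum fun x _ => hA x
        _ = _ := by rw [Finset.sum_const, nsmul_eq_mul]
    have h3 : ((Finset.univ.filter fun x => ∃ S T, RP A c v x S T ∧ T.card ≤ i + 1).card : ℝ) ≤
        X.card + (X.biUnion fun x => Finset.univ.filter (A x)).card := by exact_mod_cast h1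
    calc _ ≤ _ := h3
      _ ≤ X.card + X.card * B := by gcongr
      _ = X.card * (1 + B) := by ring
      _ ≤ (1 + B) ^ i * (1 + B) := by gcongr
      _ = _ := by ring

set_option maxHeartbeats 4000000 in
theorem mainThm (ε K : ℝ) (hε : 0 < ε) (hε1 : ε ≤ 1) (hK : 1 ≤ K) :
    ∃ d0 : ℕ, ∀ d : ℕ, d0 ≤ d → ∀ (V C : Type) [Fintype V] [Fintype C] (Adj : V → V → Prop)
      (c : V → V → C), PG Adj c → (∀ v, (d:ℝ) ≤ (Finset.univ.filter (Adj v)).card) →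
      (∀ v, ((Finset.univ.filter (Adj v)).card : ℝ) ≤ K * d) →
      ∀ u : V, ∃ v S T, RP Adj c u v S T ∧ (1 - ε) * d ≤ T.card := by
  obtain ⟨L, hL24⟩ := exists_nat_ge (24 / ε)
  have hL24' : 24 ≤ L * ε := by rwa [div_le_iff₀ hε] at hL24
  have hLpos : 1 ≤ L := by
    rcases Nat.eq_zero_or_pos L with h | h
    · subst h; norm_num at hL24'
    · exact h
  have hK1 : 1 ≤ 2 * K / ε := by
    rw [le_div_iff₀ hε]; linarith
  obtain ⟨d0, hcore⟩ := coreThm (ε / 4) (2 * K / ε) (by linarith) (by linarith) hK1 L (2 * L)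
  obtain ⟨n1, hn1⟩ := exists_nat_ge' (4 / ε)
  obtain ⟨n2, hn2⟩ := exists_nat_ge' (8 * (2 * L + 1) / ε)
  obtain ⟨n3, hn3⟩ := exists_nat_ge' (4 * (1 + K) / ε ^ 2)
  obtain ⟨n4, hn4⟩ := exists_nat_ge' (2 * d0 / ε)
  refine ⟨n1 + n2 + n3 + n4 + 1, ?_⟩
  intro d hd V C _ _ Adj c hP hmin hmax u
  have q1 : 4 ≤ d * ε := by have := hn1 d (by omega); rwa [div_le_iff₀ hε] at this
  have q2 : 8 * (2 * L + 1) ≤ d * ε := by have := hn2 d (by omega); rwa [div_le_iff₀ hε] at this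
  have q3 : 4 * (1 + K) ≤ d * ε ^ 2 := by have := hn3 d (by omega); rwa [div_le_iff₀ (by positivity)] at this
  have q4 : 2 * d0 ≤ d * ε := by have := hn4 d (by omega); rwa [div_le_iff₀ hε] at this
  have hd1 : (1:ℝ) ≤ d := by exact_mod_cast (by omega : 1 ≤ d)
  obtain ⟨v, S, T, Y, g, hvY, hSY, hdeg, hterm⟩ := geoMax hP hLpos u (d := d) (fun v => by exact_mod_cast hmin v)
  by_cases hdone : (1 - ε) * d ≤ T.card
  · exact ⟨v, S, T, g, hdone⟩
  push Not at hdone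
  have hPH := hP.sub Y T
  obtain ⟨H, hH⟩ : ∃ H : V → V → Prop, H = fun a b => Adj a b ∧ a ∈ Y ∧ b ∈ Y ∧ c a b ∉ T := ⟨_, rfl⟩
  rw [← hH] at hterm hPH
  have hHiff : ∀ a b, H a b ↔ Adj a b ∧ a ∈ Y ∧ b ∈ Y ∧ c a b ∉ T := by intro a b; rw [hH]
  have hHdeg : ∀ x, ((Finset.univ.filter (H x)).card : ℝ) ≤ K * d := by
    intro x
    refine le_trans ?_ (hmax x)
    have : Finset.univ.filter (H x) ⊆ Finset.univ.filter (Adj x) := by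
      intro w hw
      simp only [Finset.mem_filter, Finset.mem_univ, true_and] at hw ⊢
      exact ((hHiff _ _).1 hw).1
    exact_mod_cast Finset.card_le_card this
  obtain ⟨X, hX⟩ : ∃ X : Finset V, ∀ x, x ∈ X ↔ ∃ S' T', RP H c v x S' T' ∧ T'.card < L :=
    ⟨Finset.univ.filter fun x => ∃ S' T', RP H c v x S' T' ∧ T'.card < L, by simp⟩
  have hvX : v ∈ X := (hX v).2 ⟨_, _, RP.nil v, by simp; omega⟩
  have hXY : ∀ x ∈ X, x ∈ Y := by
    intro x hx
    obtain ⟨S', T', g', -⟩ := (hX x).1 hx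
    rcases g'.vert g'.end_mem with h | ⟨y, -, h⟩
    · rw [h]; exact hvY
    · exact ((hHiff _ _).1 h).2.2.1
  have hXcard : (X.card : ℝ) ≤ (1 + K * d) ^ L := by
    refine le_trans (Nat.cast_le.2 (Finset.card_le_card ?_)) (ballCard (A := H) (c := c) v (by positivity) hHdeg L)
    intro x hx
    obtain ⟨S', T', g', h⟩ := (hX x).1 hx
    simp only [Finset.mem_filter, Finset.mem_univ, true_and]
    exact ⟨S', T', g', h.le⟩
  have hout : ∀ x ∈ X, ((Finset.univ \ X).filter (H x)).card ≤ 2 * L + 1 := by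
    intro x hx
    by_contra hcon
    push Not at hcon
    obtain ⟨S', T', g', h⟩ := (hX x).1 hx
    obtain ⟨w, hw, S2, T2, g2, h2⟩ := reachExt (fun a b b' => hPH.proper a b b') g' (Finset.univ \ X) (by omega)
    have := hterm w S2 T2 g2 (by omega)
    exact (Finset.mem_sdiff.1 hw).2 ((hX w).2 this)
  set t : ℝ := (T.card : ℝ) with ht
  have ht0 : 0 ≤ t := by positivity
  have hεd : 0 < ε * d := by positivity
  obtain ⟨d1, hd1a, hd1b⟩ : ∃ d1 : ℕ, (d1:ℝ) ≤ d - t - ε * d / 4 ∧ d - t - ε * d / 4 - 1 ≤ d1 := by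
    refine ⟨⌊(d:ℝ) - t - ε * d / 4⌋₊, Nat.floor_le (by nlinarith), ?_⟩
    have := Nat.lt_floor_add_one ((d:ℝ) - t - ε * d / 4)
    linarith
  have hd1c : ε * d / 2 ≤ d1 := by nlinarith
  have hinX : ∀ x ∈ X, (d1 : ℝ) ≤ (X.filter (H x)).card := by
    intro x hx
    have h1 := hdeg x (hXY x hx)
    have h2 : (Y.filter fun w => Adj x w ∧ c x w ∉ T) ⊆ X.filter (H x) ∪ (Finset.univ \ X).filter (H x) := by
      intro w hw
      have hw := Finset.mem_filter.1 hw
      have hHw : H x w := (hHiff _ _).2 ⟨hw.2.1, hXY x hx, hw.1, hw.2.2⟩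
      by_cases hwX : w ∈ X <;> simp [hwX, hHw]
    have h3 := (Finset.card_le_card h2).trans (Finset.card_union_le _ _)
    have h4 := hout x hx
    have h5 : L * d ≤ L * ((X.filter (H x)).card + (2 * L + 1)) + (L + 3) * T.card := by
      refine h1.trans ?_
      gcongr
      omega
    have h6 : (L:ℝ) * d ≤ L * ((X.filter (H x)).card + (2 * L + 1)) + (L + 3) * t := by
      rw [ht]; exact_mod_cast h5
    have hLp : (0:ℝ) < L := by exact_mod_cast hLpos
    have h7 : 3 * t ≤ L * (ε * d / 8) := by
      have : t ≤ d := by nlinarith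
      nlinarith
    have h8 : (L:ℝ) * d1 ≤ L * (X.filter (H x)).card := by
      have : (L:ℝ) * d1 ≤ L * (d - t - ε * d / 4) := by gcongr
      have : (L:ℝ) * (2 * L + 1) ≤ L * (ε * d / 8) := by
        gcongr; linarith
      nlinarith
    exact le_of_mul_le_mul_left h8 hLp
  obtain ⟨X', instF, f, hf, hfX, hcX⟩ : ∃ (X' : Type) (_ : Fintype X') (f : X' → V), Function.Injective f ∧
      (∀ x, x ∈ X ↔ ∃ a, f a = x) ∧ Fintype.card X' = X.card :=
    ⟨{x // x ∈ X}, inferInstance, Subtype.val, Subtype.val_injective, by simp, by simp⟩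
  obtain ⟨v', hv'⟩ := (hfX v).1 hvX
  obtain ⟨H', hH'⟩ : ∃ H' : X' → X' → Prop, H' = fun a b => H (f a) (f b) := ⟨_, rfl⟩
  have hPH' : PG H' (fun a b => c (f a) (f b)) := by
    rw [hH']
    exact { symm := fun a b h => hPH.symm _ _ h
            irrefl := fun a h => hPH.irrefl _ h
            csymm := fun a b h => hPH.csymm _ _ h
            proper := fun a b b' h h' e => hf (hPH.proper _ _ _ h h' e) }
  have hdegeq : ∀ a, (Finset.univ.filter (H' a)).card = (X.filter (H (f a))).card := by
    intro a
    rw [← Finset.card_image_of_injective _ hf]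
    congr 1
    ext x
    simp only [Finset.mem_image, Finset.mem_filter, Finset.mem_univ, true_and, hH', hfX]
    constructor
    · rintro ⟨b, hb, rfl⟩; exact ⟨⟨b, rfl⟩, hb⟩
    · rintro ⟨⟨b, rfl⟩, hb⟩; exact ⟨b, hb, rfl⟩
  obtain ⟨w, S1, T1, g1, hlen⟩ := hcore d1 (by
      have : (d0:ℝ) ≤ d1 := by nlinarith
      exact_mod_cast this) X' C H' _ hPH'
    (fun a => by rw [hdegeq]; exact hinX _ ((hfX _).2 ⟨a, rfl⟩))
    (fun a => by
      rw [hdegeq]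
      have h1 : ((X.filter (H (f a))).card : ℝ) ≤ K * d := by
        refine le_trans ?_ (hHdeg (f a))
        exact_mod_cast Finset.card_le_card (Finset.filter_subset_filter _ (Finset.subset_univ X))
      have h2 : 2 * K / ε * (ε * d / 2) ≤ 2 * K / ε * d1 := by gcongr
      have h3 : 2 * K / ε * (ε * d / 2) = K * d := by field_simp
      linarith)
    (by
      rw [hcX, pow_mul]
      refine hXcard.trans ?_
      gcongr
      have h1 : (ε * d / 2) ^ 2 ≤ (d1:ℝ) ^ 2 := by gcongr
      have h2 : (4 * (1 + K)) * d ≤ (d * ε ^ 2) * d := by gcongr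
      nlinarith)
    v'
    (by
      intro x
      obtain ⟨S', T', g', h⟩ := (hX (f x)).1 ((hfX _).2 ⟨x, rfl⟩)
      obtain ⟨S2, g2, -⟩ := g'.lift f hf (by
        intro y hy
        rw [← hfX, hX]
        obtain ⟨A, B, -, hB, g3, -⟩ := g'.pre hy
        exact ⟨A, B, g3, (Finset.card_le_card hB).trans_lt h⟩) v' x hv' rfl
      refine ⟨S2, T', ?_, h.le⟩
      rw [hH']
      exact g2)
  have g2 : RP H c (f v') (f w) (S1.image f) T1 :=
    g1.map_val f hf (fun x y h => by rw [hH'] at h; exact h) (fun _ _ => rfl)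
  rw [hv'] at g2
  have hTT : Disjoint T T1 := by
    rw [Finset.disjoint_left]
    intro t ht ht'
    obtain ⟨a, -, b, -, h, rfl⟩ := g2.col ht'
    exact ((hHiff _ _).1 h).2.2.2 ht
  refine ⟨_, _, _, g.append (g2.mono fun a b _ _ h => ((hHiff _ _).1 h).1) ?_ hTT, ?_⟩
  · intro z hz hz'
    obtain ⟨a, -, rfl⟩ := Finset.mem_image.1 hz
    exact hSY _ hz' (hXY _ ((hfX _).2 ⟨a, rfl⟩))
  · rw [Finset.card_union_of_disjoint hTT]
    push_cast
    rw [← ht]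
    have h1 : (1 - ε / 4) * (d - t - ε * d / 4 - 1) ≤ (1 - ε / 4) * d1 := by
      apply mul_le_mul_of_nonneg_left hd1b; linarith
    have h2 : 0 ≤ ε * t := by positivity
    have h3 : 0 ≤ ε * (ε * d) := by positivity
    nlinarith

theorem RP.toFn {V C : Type} {A : V → V → Prop} {c : V → V → C} {u v : V} {S : Finset V} {T : Finset C}
    (g : RP A c u v S T) : ∃ p : Fin (T.card + 1) → V, Function.Injective p ∧
      (∀ i : Fin T.card, A (p i.castSucc) (p i.succ)) ∧
      Function.Injective fun i : Fin T.card => c (p i.castSucc) (p i.succ) := by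
  obtain ⟨p, -, -, h2, h3, h4⟩ := g.fn
  have i1 := RP.injp (p := p) (n := T.card + 1) (by rw [← h2]; exact g.card)
  have i2 := RP.injp (p := fun i => c (p i) (p (i+1))) (n := T.card) (by rw [← h3])
  refine ⟨fun i => p i.1, ?_, ?_, ?_⟩
  · intro i j h
    exact Fin.ext (i1 i.1 i.2 j.1 j.2 h)
  · intro i
    simpa using h4 i.1 i.2
  · intro i j h
    exact Fin.ext (i2 i.1 i.2 j.1 j.2 (by simpa using h))

end helpers

/-- For every `ε > 0` and `K > 0` there exists `d₀` such that for all `d ≥ d₀`: every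
properly edge-coloured graph with minimum degree at least `d` and maximum degree at
most `Kd` contains a rainbow path of length at least `(1-ε)d`. -/
theorem stmt18 (ε K : ℝ) (hε : 0 < ε) (hK : 0 < K) :
    ∃ d₀ : ℕ, ∀ d : ℕ, d₀ ≤ d →
      ∀ (V C : Type) [Fintype V] [Nonempty V] (G : SimpleGraph V) (c : V → V → C),
        IsProperEdgeColoring G c →
        (∀ v, d ≤ (G.neighborSet v).ncard) →
        (∀ v, ((G.neighborSet v).ncard : ℝ) ≤ K * d) →
        ∃ (ℓ : ℕ) (p : Fin (ℓ + 1) → V),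
          IsRainbowPath G c p ∧ (1 - ε) * d ≤ (ℓ : ℝ) := by
  classical
  have hε' : 0 < min ε 1 := lt_min hε one_pos
  obtain ⟨d0, h⟩ := mainThm (min ε 1) (max K 1) hε' (min_le_right _ _) (le_max_right _ _)
  refine ⟨d0, ?_⟩
  intro d hd V C _ hne G c hc hmin hmax
  obtain ⟨u⟩ := hne
  have hfin : (Set.range fun q : V × V => c q.1 q.2).Finite := Set.finite_range _
  have hF : Fintype (Set.range fun q : V × V => c q.1 q.2) := hfin.fintype
  have hdeg : ∀ v, (G.neighborSet v).ncard = (Finset.univ.filter (G.Adj v)).card := by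
    intro v
    rw [← Set.ncard_coe_finset]
    congr 1
    ext w
    simp
  obtain ⟨C', hC', f, c', hf, hcc⟩ : ∃ (C' : Type) (_ : Fintype C') (f : C' → C) (c' : V → V → C'),
      Function.Injective f ∧ ∀ a b, f (c' a b) = c a b :=
    ⟨_, hF, Subtype.val, fun a b => ⟨c a b, ⟨(a, b), rfl⟩⟩, Subtype.val_injective, fun _ _ => rfl⟩
  have hP : PG G.Adj c' :=
    { symm := fun a b h => h.symm
      irrefl := fun a h => G.loopless.irrefl a h
      csymm := fun a b h => hf (by rw [hcc, hcc]; exact hc.1 a b h)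
      proper := fun a b b' h h' e => by
        by_contra hne
        exact hc.2 a b b' h h' hne (by rw [← hcc, ← hcc, e]) }
  obtain ⟨v, S, T, g, hlen⟩ := h d hd V C' G.Adj c' hP
    (fun v => by rw [← hdeg]; exact_mod_cast hmin v)
    (fun v => by
      rw [← hdeg]
      refine (hmax v).trans ?_
      gcongr
      exact le_max_left _ _) u
  obtain ⟨p, p1, p2, p3⟩ := g.toFn
  refine ⟨T.card, p, ⟨p1, p2, ?_⟩, le_trans ?_ hlen⟩
  · intro i j hij
    apply p3
    apply hf
    simpa only [hcc] using hij
  · gcongr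
    exact min_le_left _ _
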